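/- arXiv:0806.0492 — 2 statements merged into one kernel-verified Lean document; each statement's English description precedes it below -/
import Mathlib

section
/- Let f ∈ C²([0,∞)) be nondecreasing and convex with f > 0 on (0,∞), assume q₀ = lim_{u→0⁺} q(u) exists with conjugate exponent p₀, and assume p₀ is in the supercritical range: p_S(N) < p₀ < +∞ if 3 ≤ N ≤ 10, or p_S(N) < p₀ < p_c(N) if N ≥ 11. Assume the local bounds: there exist ε, c₁, c₂ > 0 with f(u) ≥ c₁ u^{p₀} and f'(u) ≤ c₂ u^{p₀−1} for u ∈ (0, ε); and the global inequality (p₀+1)F(s) ≤ s f(s) for all s ≥ 0, where F is the antiderivative of f vanishing at 0. Then any bounded nonnegative solution u ∈ C²(ℝ^N) of −Δu = f(u) in ℝ^N which is stable outside a compact set satisfies u ≡ 0. -/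
open MeasureTheory Filter Topology
open scoped ENNReal

/-- The Laplacian of `u : ℝ^N → ℝ`. -/
noncomputable def lap {N : ℕ} (u : EuclideanSpace ℝ (Fin N) → ℝ)
    (x : EuclideanSpace ℝ (Fin N)) : ℝ :=
  ∑ i : Fin N, iteratedFDeriv ℝ 2 u x ![EuclideanSpace.single i 1, EuclideanSpace.single i 1]

/-- `u` is a stable solution w.r.t. the linearized weight `g = f'`:
`∫ f'(u) φ² ≤ ∫ |∇φ|²` for all `φ ∈ C¹_c(ℝ^N)`. -/
def Stable {N : ℕ} (g : ℝ → ℝ) (u : EuclideanSpace ℝ (Fin N) → ℝ) : Prop :=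
  ∀ φ : EuclideanSpace ℝ (Fin N) → ℝ, ContDiff ℝ 1 φ → HasCompactSupport φ →
    ∫ x, g (u x) * (φ x) ^ 2 ≤ ∫ x, ‖gradient φ x‖ ^ 2

/-- `u` is stable outside the set `K` : the stability inequality holds for all
`φ ∈ C¹_c(ℝ^N \ K)`. -/
def StableOutside {N : ℕ} (g : ℝ → ℝ) (u : EuclideanSpace ℝ (Fin N) → ℝ)
    (K : Set (EuclideanSpace ℝ (Fin N))) : Prop :=
  ∀ φ : EuclideanSpace ℝ (Fin N) → ℝ, ContDiff ℝ 1 φ → HasCompactSupport φ →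
    tsupport φ ⊆ Kᶜ →
    ∫ x, g (u x) * (φ x) ^ 2 ≤ ∫ x, ‖gradient φ x‖ ^ 2

/-- The quantity `q(u) = f'(u)²/(f(u) f''(u)) ∈ [0,∞]`, with the convention
`q(u) = +∞` when `f(u) f''(u) = 0`. -/
noncomputable def qfun (f : ℝ → ℝ) (t : ℝ) : ℝ≥0∞ :=
  if f t * deriv (deriv f) t = 0 then ⊤
  else ENNReal.ofReal ((deriv f t) ^ 2 / (f t * deriv (deriv f) t))

/-- The Joseph–Lundgren exponent `p_c(N)` (for `N ≥ 11`). -/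
noncomputable def pc (N : ℕ) : ℝ :=
  (((N : ℝ) - 2) ^ 2 - 4 * N + 8 * Real.sqrt ((N : ℝ) - 1)) / (((N : ℝ) - 2) * ((N : ℝ) - 10))

section GradientCalculus

variable {F : Type*} [NormedAddCommGroup F] [InnerProductSpace ℝ F] [CompleteSpace F]

theorem HasGradientAt.mul_real {f g : F → ℝ} {f' g' x : F} (hf : HasGradientAt f f' x)
    (hg : HasGradientAt g g' x) :
    HasGradientAt (fun y => f y * g y) (f x • g' + g x • f') x := by
  rw [hasGradientAt_iff_hasFDerivAt] at *
  refine (HasFDerivAt.mul (𝕜 := ℝ) hf hg).congr_fderiv ?_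
  simp

theorem HasDerivAt.comp_hasGradientAt {ψ : ℝ → ℝ} {ψ' : ℝ} {f : F → ℝ} {f' x : F}
    (hψ : HasDerivAt ψ ψ' (f x)) (hf : HasGradientAt f f' x) :
    HasGradientAt (fun y => ψ (f y)) (ψ' • f') x := by
  rw [hasGradientAt_iff_hasFDerivAt] at *
  refine (hψ.comp_hasFDerivAt x hf).congr_fderiv ?_
  simp

theorem ContDiff.hasGradientAt {f : F → ℝ} (hf : ContDiff ℝ 1 f) (x : F) :
    HasGradientAt f (gradient f x) x :=
  (hf.differentiable (by simp) x).hasGradientAt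

theorem ContDiff.continuous_gradient {f : F → ℝ} (hf : ContDiff ℝ 1 f) :
    Continuous (gradient f) :=
  (InnerProductSpace.toDual ℝ F).symm.continuous.comp (hf.continuous_fderiv (by simp))

theorem ContDiff.gradient_contDiff {f : F → ℝ} (hf : ContDiff ℝ 2 f) :
    ContDiff ℝ 1 (gradient f) :=
  (InnerProductSpace.toDual ℝ F).symm.contDiff.comp (hf.fderiv_right (m := 1) (by norm_num))

theorem gradient_mul_eq {f g : F → ℝ} (hf : ContDiff ℝ 1 f) (hg : ContDiff ℝ 1 g) (x : F) :
    gradient (fun y => f y * g y) x = f x • gradient g x + g x • gradient f x :=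
  ((hf.hasGradientAt x).mul_real (hg.hasGradientAt x)).gradient

theorem gradient_comp_eq {ψ ψ' : ℝ → ℝ} (hψ : ∀ t, HasDerivAt ψ (ψ' t) t) {f : F → ℝ}
    (hf : ContDiff ℝ 1 f) (x : F) :
    gradient (fun y => ψ (f y)) x = ψ' (f x) • gradient f x :=
  ((hψ (f x)).comp_hasGradientAt (hf.hasGradientAt x)).gradient

theorem gradient_pow_eq {f : F → ℝ} (hf : ContDiff ℝ 1 f) (m : ℕ) (x : F) :
    gradient (fun y => f y ^ m) x = (m * f x ^ (m - 1)) • gradient f x :=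
  gradient_comp_eq (fun t => hasDerivAt_pow m t) hf x

theorem contDiff_one_of_hasDerivAt {ψ ψ' : ℝ → ℝ} (hψ : ∀ t, HasDerivAt ψ (ψ' t) t)
    (hc : Continuous ψ') : ContDiff ℝ 1 ψ := by
  rw [contDiff_one_iff_deriv]
  refine ⟨fun t => (hψ t).differentiableAt, ?_⟩
  rwa [show deriv ψ = ψ' from funext fun t => (hψ t).deriv]

theorem HasCompactSupport.gradient {f : F → ℝ} (hf : HasCompactSupport f) :
    HasCompactSupport (gradient f) := by
  have := hf.fderiv (𝕜 := ℝ)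
  exact this.comp_left (g := (InnerProductSpace.toDual ℝ F).symm) (by simp)

theorem inner_fderiv_gradient_comm {f : F → ℝ} (hf : ContDiff ℝ 2 f) (x v w : F) :
    inner ℝ (fderiv ℝ (_root_.gradient f) x v) w
      = inner ℝ (fderiv ℝ (_root_.gradient f) x w) v := by
  have hd : DifferentiableAt ℝ (fderiv ℝ f) x :=
    (hf.fderiv_right (m := 1) (by norm_num)).differentiable (by simp) x
  have h : ∀ a b, inner ℝ (fderiv ℝ (_root_.gradient f) x a) b = fderiv ℝ (fderiv ℝ f) x a b := by
    intro a b
    have := ((InnerProductSpace.toDual ℝ F).symm.toContinuousLinearEquiv.toContinuousLinearMap.hasFDerivAt.comp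
      x hd.hasFDerivAt).fderiv
    change inner ℝ (fderiv ℝ ((InnerProductSpace.toDual ℝ F).symm ∘ fderiv ℝ f) x a) b = _
    erw [this]
    simp
  rw [h, h]
  exact (hf.contDiffAt.isSymmSndFDerivAt (by simp)) v w

end GradientCalculus

section IntegrationByParts

variable {N : ℕ}

theorem integrable_of_continuous_mul_compact {f g : EuclideanSpace ℝ (Fin N) → ℝ}
    (hf : Continuous f) (hg : Continuous g) (hc : HasCompactSupport g) :
    Integrable (fun x => f x * g x) :=
  (hf.mul hg).integrable_of_hasCompactSupport hc.mul_left

theorem inner_gradient_eq_sum {u φ : EuclideanSpace ℝ (Fin N) → ℝ}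
    (x : EuclideanSpace ℝ (Fin N)) :
    inner ℝ (gradient u x) (gradient φ x) = ∑ i : Fin N,
      fderiv ℝ u x (EuclideanSpace.single i 1) * fderiv ℝ φ x (EuclideanSpace.single i 1) := by
  rw [PiLp.inner_apply]
  refine Finset.sum_congr rfl fun i _ => ?_
  rw [← inner_gradient_left, ← inner_gradient_left, EuclideanSpace.inner_single_right,
    EuclideanSpace.inner_single_right]
  simp [mul_comm]

theorem fderiv_apply_contDiff {u : EuclideanSpace ℝ (Fin N) → ℝ} (hu : ContDiff ℝ 2 u)
    (v : EuclideanSpace ℝ (Fin N)) : ContDiff ℝ 1 (fun x => fderiv ℝ u x v) :=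
  (hu.fderiv_right (m := 1) (by norm_num)).clm_apply contDiff_const

theorem lap_eq_sum {u : EuclideanSpace ℝ (Fin N) → ℝ} (hu : ContDiff ℝ 2 u)
    (x : EuclideanSpace ℝ (Fin N)) :
    lap u x = ∑ i : Fin N, fderiv ℝ (fun y => fderiv ℝ u y (EuclideanSpace.single i 1)) x
      (EuclideanSpace.single i 1) := by
  refine Finset.sum_congr rfl fun i _ => ?_
  have hd : DifferentiableAt ℝ (fderiv ℝ u) x :=
    (hu.fderiv_right (m := 1) (by norm_num)).differentiable (by simp) x
  rw [iteratedFDeriv_two_apply, fderiv_clm_apply hd (by fun_prop)]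
  simp

theorem continuous_lap {u : EuclideanSpace ℝ (Fin N) → ℝ} (hu : ContDiff ℝ 2 u) :
    Continuous (lap u) := by
  have : lap u = fun x => ∑ i : Fin N, fderiv ℝ (fun y => fderiv ℝ u y
      (EuclideanSpace.single i 1)) x (EuclideanSpace.single i 1) := funext (lap_eq_sum hu)
  rw [this]
  refine continuous_finsetSum _ fun i _ => ?_
  exact ((fderiv_apply_contDiff hu _).continuous_fderiv (by simp)).clm_apply continuous_const

theorem integral_inner_gradient {u φ : EuclideanSpace ℝ (Fin N) → ℝ} (hu : ContDiff ℝ 2 u)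
    (hφ : ContDiff ℝ 1 φ) (hc : HasCompactSupport φ) :
    ∫ x, inner ℝ (gradient u x) (gradient φ x) = ∫ x, -lap u x * φ x := by
  have hφ' : ∀ v : EuclideanSpace ℝ (Fin N), Continuous fun x => fderiv ℝ φ x v := fun v =>
    (hφ.continuous_fderiv (by simp)).clm_apply continuous_const
  have hφc : ∀ v : EuclideanSpace ℝ (Fin N), HasCompactSupport fun x => fderiv ℝ φ x v :=
    fun v => hc.fderiv_apply ℝ v
  have hu1 := fun v => fderiv_apply_contDiff hu v
  have hu2 : ∀ v : EuclideanSpace ℝ (Fin N),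
      Continuous fun x => fderiv ℝ (fun y => fderiv ℝ u y v) x v := fun v =>
    ((hu1 v).continuous_fderiv (by simp)).clm_apply continuous_const
  have i1 := fun v => integrable_of_continuous_mul_compact (hu1 v).continuous (hφ' v) (hφc v)
  have i2 := fun v => integrable_of_continuous_mul_compact (hu2 v) hφ.continuous hc
  have i3 := fun v => integrable_of_continuous_mul_compact (hu1 v).continuous hφ.continuous hc
  simp_rw [inner_gradient_eq_sum, lap_eq_sum hu, neg_mul, Finset.sum_mul]
  rw [integral_finsetSum _ fun i _ => i1 _, integral_neg,
    integral_finsetSum _ fun i _ => i2 _, ← Finset.sum_neg_distrib]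
  refine Finset.sum_congr rfl fun i _ => ?_
  exact integral_mul_fderiv_eq_neg_fderiv_mul_of_integrable (i2 _) (i1 _) (i3 _)
    (fun x _ => (hu1 _).differentiable (by simp) x) (fun x _ => hφ.differentiable (by simp) x)

theorem integral_inner_self_gradient {φ : EuclideanSpace ℝ (Fin N) → ℝ}
    (hφ : ContDiff ℝ 1 φ) (hc : HasCompactSupport φ) :
    ∫ x, inner ℝ x (gradient φ x) = -N * ∫ x, φ x := by
  have hu : ContDiff ℝ 2 fun x : EuclideanSpace ℝ (Fin N) => ‖x‖ ^ 2 / 2 :=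
    (contDiff_norm_sq ℝ).div_const 2
  have hf : ∀ x : EuclideanSpace ℝ (Fin N),
      fderiv ℝ (fun x : EuclideanSpace ℝ (Fin N) => ‖x‖ ^ 2 / 2) x = innerSL ℝ x := by
    intro x
    have h := ((hasStrictFDerivAt_norm_sq x).hasFDerivAt).mul_const (2⁻¹ : ℝ)
    have h' : HasFDerivAt (fun x : EuclideanSpace ℝ (Fin N) => ‖x‖ ^ 2 / 2) (innerSL ℝ x) x := by
      refine (h.congr_fderiv ?_)
      ext v
      simp
    exact h'.fderiv
  have hg : ∀ x : EuclideanSpace ℝ (Fin N),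
      gradient (fun x : EuclideanSpace ℝ (Fin N) => ‖x‖ ^ 2 / 2) x = x := by
    intro x
    refine ext_inner_right ℝ fun v => ?_
    rw [inner_gradient_left, hf]
    simp
  have hl : ∀ x : EuclideanSpace ℝ (Fin N),
      lap (fun x : EuclideanSpace ℝ (Fin N) => ‖x‖ ^ 2 / 2) x = N := by
    intro x
    rw [lap_eq_sum hu]
    simp_rw [hf]
    have : ∀ i : Fin N, fderiv ℝ (fun y : EuclideanSpace ℝ (Fin N) =>
        (innerSL ℝ y) (EuclideanSpace.single i (1:ℝ))) x (EuclideanSpace.single i 1) = 1 := by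
      intro i
      have : (fun y : EuclideanSpace ℝ (Fin N) =>
        (innerSL ℝ y) (EuclideanSpace.single i (1:ℝ))) =
          innerSL ℝ (EuclideanSpace.single i (1:ℝ)) := by
        ext y
        simp [real_inner_comm]
      rw [this, ContinuousLinearMap.fderiv]
      simp
    rw [Finset.sum_congr rfl fun i _ => this i]
    simp
  have := integral_inner_gradient hu hφ hc
  simp_rw [hg, hl] at this
  rw [this, integral_const_mul]

end IntegrationByParts

section Hardy

variable {N : ℕ}

theorem hasGradientAt_one_add_norm_sq (x : EuclideanSpace ℝ (Fin N)) :
    HasGradientAt (fun y : EuclideanSpace ℝ (Fin N) => 1 + ‖y‖ ^ 2) ((2 : ℝ) • x) x := by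
  rw [hasGradientAt_iff_hasFDerivAt]
  refine (((hasStrictFDerivAt_norm_sq x).hasFDerivAt).const_add 1).congr_fderiv ?_
  ext v
  simp

theorem contDiff_one_add_norm_sq :
    ContDiff ℝ 1 fun y : EuclideanSpace ℝ (Fin N) => 1 + ‖y‖ ^ 2 :=
  contDiff_const.add (contDiff_norm_sq ℝ)

theorem one_add_norm_sq_pos (x : EuclideanSpace ℝ (Fin N)) : 0 < 1 + ‖x‖ ^ 2 := by positivity

theorem hardy_inequality (hN : 2 ≤ N) {v : EuclideanSpace ℝ (Fin N) → ℝ}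
    (hv : ContDiff ℝ 1 v) (hc : HasCompactSupport v) :
    ((N : ℝ) - 2) ^ 2 / 4 * ∫ x, v x ^ 2 / (1 + ‖x‖ ^ 2) ≤ ∫ x, ‖gradient v x‖ ^ 2 := by
  have hn : (0 : ℝ) ≤ (N : ℝ) - 2 := by
    have : (2 : ℝ) ≤ N := by exact_mod_cast hN
    linarith
  set φ : EuclideanSpace ℝ (Fin N) → ℝ := fun x => v x ^ 2 / (1 + ‖x‖ ^ 2) with hφdef
  have hφ : ContDiff ℝ 1 φ :=
    (hv.pow 2).div contDiff_one_add_norm_sq fun x => (one_add_norm_sq_pos x).ne'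
  have hφc : HasCompactSupport φ := by
    exact hc.mono fun x hx h => hx (by simp [hφdef, h])
  have hgrad : ∀ x, inner ℝ x (gradient φ x) = 2 * v x / (1 + ‖x‖ ^ 2) * inner ℝ x (gradient v x)
      - 2 * v x ^ 2 * ‖x‖ ^ 2 / (1 + ‖x‖ ^ 2) ^ 2 := by
    intro x
    have hb := one_add_norm_sq_pos x
    have h1 : HasGradientAt (fun y => v y ^ 2) ((2 * v x) • gradient v x) x := by
      simpa using (hasDerivAt_pow 2 (v x)).comp_hasGradientAt (hv.hasGradientAt x)
    have h2 := HasDerivAt.comp_hasGradientAt (f := fun y : EuclideanSpace ℝ (Fin N) => 1 + ‖y‖ ^ 2)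
      (hasDerivAt_inv hb.ne') (hasGradientAt_one_add_norm_sq x)
    have h3 := (h1.mul_real h2).gradient
    have h4 : gradient φ x = _ := h3
    rw [h4]
    simp only [inner_add_right, inner_smul_right, real_inner_self_eq_norm_sq]
    field_simp
    ring
  have hpt : ∀ x, -(((N : ℝ) - 2) / 2) * inner ℝ x (gradient φ x)
      - (((N : ℝ) - 2) + ((N : ℝ) - 2) ^ 2 / 4) * φ x ≤ ‖gradient v x‖ ^ 2 := by
    intro x
    have hb := one_add_norm_sq_pos x
    rw [hgrad]
    set n := (N : ℝ) - 2
    have hsq : 0 ≤ ‖gradient v x + (n / 2 * (v x / (1 + ‖x‖ ^ 2))) • x‖ ^ 2 := by positivity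
    rw [norm_add_sq_real, norm_smul, inner_smul_right, real_inner_comm, mul_pow,
      Real.norm_eq_abs, sq_abs] at hsq
    set I := inner ℝ x (gradient v x)
    have hle : v x ^ 2 * ‖x‖ ^ 2 / (1 + ‖x‖ ^ 2) ^ 2 ≤ φ x := by
      simp only [hφdef]
      rw [div_le_div_iff₀ (by positivity) hb]
      nlinarith [mul_nonneg (sq_nonneg (v x)) hb.le]
    have e1 : (n / 2 * (v x / (1 + ‖x‖ ^ 2))) ^ 2 * ‖x‖ ^ 2
        = n ^ 2 / 4 * (v x ^ 2 * ‖x‖ ^ 2 / (1 + ‖x‖ ^ 2) ^ 2) := by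
      field_simp; ring
    have e2 : -(n / 2) * (2 * v x / (1 + ‖x‖ ^ 2) * I
        - 2 * v x ^ 2 * ‖x‖ ^ 2 / (1 + ‖x‖ ^ 2) ^ 2) =
        -(n * (v x / (1 + ‖x‖ ^ 2)) * I) + n * (v x ^ 2 * ‖x‖ ^ 2 / (1 + ‖x‖ ^ 2) ^ 2) := by
      field_simp; ring
    rw [e1] at hsq
    rw [e2]
    have h5 := mul_le_mul_of_nonneg_left hle (by positivity : 0 ≤ n + n ^ 2 / 4)
    nlinarith
  have hcx : Continuous fun x => inner ℝ x (gradient φ x) :=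
    continuous_id.inner hφ.continuous_gradient
  have hcxc : HasCompactSupport fun x => inner ℝ x (gradient φ x) :=
    hφc.gradient.mono fun x hx h => hx (by simp [h])
  have i1 := hcx.integrable_of_hasCompactSupport (μ := volume) hcxc
  have i2 := hφ.continuous.integrable_of_hasCompactSupport (μ := volume) hφc
  have i3 : Integrable fun x => ‖gradient v x‖ ^ 2 :=
    (hv.continuous_gradient.norm.pow 2).integrable_of_hasCompactSupport
      (hc.gradient.mono fun x hx h => hx (by simp [h]))
  have := integral_mono ((i1.const_mul _).sub (i2.const_mul _)) i3 hpt
  simp only [Pi.sub_apply] at this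
  rw [integral_sub (i1.const_mul _) (i2.const_mul _), integral_const_mul, integral_const_mul,
    integral_inner_self_gradient hφ hφc] at this
  refine le_trans (le_of_eq ?_) this
  ring

end Hardy

section Cutoff

variable {N : ℕ}

/-- The closed annulus of radii `R` and `2 * R` centred at the origin. -/
def annulus (N : ℕ) (R : ℝ) : Set (EuclideanSpace ℝ (Fin N)) :=
  Metric.closedBall 0 (2 * R) \ Metric.ball 0 R

theorem mem_annulus {R : ℝ} {x : EuclideanSpace ℝ (Fin N)} :
    x ∈ annulus N R ↔ R ≤ ‖x‖ ∧ ‖x‖ ≤ 2 * R := by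
  simp [annulus, and_comm]

theorem measurableSet_annulus (R : ℝ) : MeasurableSet (annulus N R) :=
  Metric.isClosed_closedBall.measurableSet.diff Metric.isOpen_ball.measurableSet

theorem isCompact_annulus (R : ℝ) : IsCompact (annulus N R) :=
  (isCompact_closedBall _ _).diff Metric.isOpen_ball

theorem exists_ball_cutoff (N : ℕ) : ∃ C : ℝ, 0 < C ∧ ∀ R : ℝ, 0 < R →
    ∃ θ : EuclideanSpace ℝ (Fin N) → ℝ, ContDiff ℝ 1 θ ∧ HasCompactSupport θ ∧
      (∀ x, 0 ≤ θ x) ∧ (∀ x, θ x ≤ 1) ∧ (∀ x, ‖x‖ ≤ R → θ x = 1) ∧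
      (∀ x, 2 * R ≤ ‖x‖ → θ x = 0) ∧
      ∀ x, ‖gradient θ x‖ ≤ C / R * (annulus N R).indicator 1 x := by
  let b : ContDiffBump (0 : EuclideanSpace ℝ (Fin N)) := ⟨1, 2, one_pos, one_lt_two⟩
  have hb : ContDiff ℝ 1 b := b.contDiff
  obtain ⟨C, hC⟩ := hb.continuous_gradient.bounded_above_of_compact_support b.hasCompactSupport.gradient
  have hC0 : 0 ≤ C := (norm_nonneg _).trans (hC 0)
  have hzero : ∀ y, ¬ (1 ≤ ‖y‖ ∧ ‖y‖ ≤ 2) → gradient b y = 0 := by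
    intro y hy
    rw [not_and_or, not_le, not_le] at hy
    rcases hy with hy | hy
    · have : (b : EuclideanSpace ℝ (Fin N) → ℝ) =ᶠ[𝓝 y] fun _ => 1 :=
        b.eventuallyEq_one_of_mem_ball (by simpa using hy)
      rw [this.gradient_eq, gradient_fun_const]
    · have : (b : EuclideanSpace ℝ (Fin N) → ℝ) =ᶠ[𝓝 y] fun _ => 0 := by
        have : ∀ᶠ z in 𝓝 y, 2 < ‖z‖ := continuous_norm.continuousAt.eventually_const_lt hy
        filter_upwards [this] with z hz
        exact b.zero_of_le_dist (by simpa using hz.le)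
      rw [this.gradient_eq, gradient_fun_const]
  refine ⟨C + 1, by positivity, fun R hR => ?_⟩
  have hgr : ∀ x, gradient (fun y => b (R⁻¹ • y)) x = R⁻¹ • gradient b (R⁻¹ • x) := by
    intro x
    refine HasGradientAt.gradient ?_
    rw [hasGradientAt_iff_hasFDerivAt]
    have h1 := (hb.hasGradientAt (R⁻¹ • x)).hasFDerivAt
    have h2 : HasFDerivAt (fun y : EuclideanSpace ℝ (Fin N) => R⁻¹ • y)
      (R⁻¹ • ContinuousLinearMap.id ℝ _) x := (hasFDerivAt_id x).const_smul R⁻¹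
    refine (h1.comp x h2).congr_fderiv ?_
    ext v
    simp
  refine ⟨fun x => b (R⁻¹ • x), hb.comp (contDiff_const_smul _), ?_, fun x => b.nonneg,
    fun x => b.le_one, ?_, ?_, ?_⟩
  · exact b.hasCompactSupport.comp_smul (inv_ne_zero hR.ne')
  · intro x hx
    refine b.one_of_mem_closedBall ?_
    simp only [Metric.mem_closedBall, dist_zero_right, norm_smul, norm_inv, Real.norm_eq_abs,
      abs_of_pos hR]
    change R⁻¹ * ‖x‖ ≤ 1
    rw [inv_mul_le_iff₀ hR]; linarith
  · intro x hx
    refine b.zero_of_le_dist ?_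
    simp only [dist_zero_right, norm_smul, norm_inv, Real.norm_eq_abs, abs_of_pos hR]
    change 2 ≤ R⁻¹ * ‖x‖
    rw [le_inv_mul_iff₀ hR]; linarith
  · intro x
    rw [hgr, norm_smul, norm_inv, Real.norm_eq_abs, abs_of_pos hR]
    by_cases hx : x ∈ annulus N R
    · rw [Set.indicator_of_mem hx, Pi.one_apply, mul_one, div_eq_inv_mul]
      gcongr
      exact (hC _).trans (by linarith)
    · rw [Set.indicator_of_notMem hx, hzero]
      · simp
      · rw [norm_smul, norm_inv, Real.norm_eq_abs, abs_of_pos hR, inv_mul_le_iff₀ hR,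
          le_inv_mul_iff₀ hR]
        rw [mem_annulus] at hx
        simpa [mul_comm] using hx

theorem exists_annular_cutoff {K : Set (EuclideanSpace ℝ (Fin N))} (hK : IsCompact K) :
    ∃ C R₁ : ℝ, 0 < C ∧ 1 ≤ R₁ ∧ ∀ R : ℝ, R₁ ≤ R →
    ∃ ζ : EuclideanSpace ℝ (Fin N) → ℝ, ContDiff ℝ 1 ζ ∧ HasCompactSupport ζ ∧ tsupport ζ ⊆ Kᶜ ∧
      (∀ x, 0 ≤ ζ x) ∧ (∀ x, ζ x ≤ 1) ∧ (∀ x, R₁ ≤ ‖x‖ → ‖x‖ ≤ R → ζ x = 1) ∧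
      ∀ x, ‖gradient ζ x‖ ≤ C * (Metric.closedBall 0 R₁).indicator 1 x
        + C / R * (annulus N R).indicator 1 x := by
  obtain ⟨C, hC, hcut⟩ := exists_ball_cutoff N
  obtain ⟨r, hr⟩ := hK.isBounded.subset_ball (0 : EuclideanSpace ℝ (Fin N))
  set R₀ := max r 1
  have hR₀ : 1 ≤ R₀ := le_max_right _ _
  have hKR : K ⊆ Metric.ball 0 R₀ := hr.trans (Metric.ball_subset_ball (le_max_left _ _))
  obtain ⟨θ₀, h1, h2, h3, h4, h5, h5', h6⟩ := hcut R₀ (by linarith)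
  refine ⟨C, 2 * R₀, hC, by linarith, fun R hR => ?_⟩
  obtain ⟨θ, g1, g2, g3, g4, g5, g5', g6⟩ := hcut R (by linarith)
  have hc1 : ContDiff ℝ 1 fun x => 1 - θ₀ x := contDiff_const.sub h1
  refine ⟨fun x => (1 - θ₀ x) * θ x, hc1.mul g1, g2.mul_left, ?_, ?_, ?_, ?_, ?_⟩
  · have hcl : IsClosed {x : EuclideanSpace ℝ (Fin N) | R₀ ≤ ‖x‖} :=
      isClosed_le continuous_const continuous_norm
    have hsub : tsupport (fun x => (1 - θ₀ x) * θ x) ⊆ {x | R₀ ≤ ‖x‖} := by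
      refine closure_minimal (fun x hx => ?_) hcl
      by_contra hlt
      rw [Set.mem_ofPred_eq, not_le] at hlt
      exact hx (by simp [h5 x hlt.le])
    intro x hx hxK
    have := hKR hxK
    rw [Metric.mem_ball, dist_zero_right] at this
    exact absurd (hsub hx) (not_le.mpr this)
  · exact fun x => mul_nonneg (sub_nonneg.mpr (h4 x)) (g3 x)
  · exact fun x => mul_le_one₀ (by linarith [h3 x]) (g3 x) (g4 x)
  · intro x hx hxR
    simp [h5' x hx, g5 x hxR]
  · intro x
    have hgr : gradient (fun x => 1 - θ₀ x) x = -gradient θ₀ x := by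
      have := (hasDerivAt_id (θ₀ x)).const_sub 1 |>.comp_hasGradientAt (h1.hasGradientAt x)
      simpa using this.gradient
    rw [gradient_mul_eq hc1 g1, hgr, add_comm]
    refine (norm_add_le _ _).trans (add_le_add ?_ ?_)
    · rw [norm_smul, norm_neg, Real.norm_of_nonneg (g3 x)]
      refine (mul_le_of_le_one_left (norm_nonneg _) (g4 x)).trans ((h6 x).trans ?_)
      refine mul_le_mul (div_le_self hC.le hR₀) ?_ (Set.indicator_nonneg (by simp) _) hC.le
      exact Set.indicator_le_indicator_of_subset Set.sdiff_subset (by simp) _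
    · rw [norm_smul, Real.norm_of_nonneg (by linarith [h4 x])]
      exact (mul_le_of_le_one_left (norm_nonneg _) (by linarith [h3 x])).trans (g6 x)

end Cutoff

section Caccioppoli

variable {N : ℕ}

theorem two_mul_le_of_sq_le_mul {w a b ε : ℝ} (ha : 0 ≤ a) (hb : 0 ≤ b) (hε : 0 < ε)
    (h : w ^ 2 ≤ a * b) : 2 * w ≤ ε * a + 1 / ε * b := by
  refine le_of_abs_le (abs_le_of_sq_le_sq ?_ (by positivity))
  have : ε * (1 / ε) = 1 := by field_simp
  nlinarith [sq_nonneg (ε * a - 1 / ε * b)]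

theorem integrable_of_vanishing {V : Type*} [Zero V] [TopologicalSpace V]
    {f : EuclideanSpace ℝ (Fin N) → ℝ} {g : EuclideanSpace ℝ (Fin N) → V} (hf : Continuous f)
    (hg : HasCompactSupport g) (h : ∀ x, g x = 0 → f x = 0) : Integrable f :=
  hf.integrable_of_hasCompactSupport (hg.mono fun x hx hgx => hx (h x hgx))

theorem integral_norm_gradient_mul_sq {u η : EuclideanSpace ℝ (Fin N) → ℝ} (hu : ContDiff ℝ 2 u)
    (hη : ContDiff ℝ 1 η) (hc : HasCompactSupport η) :
    ∫ x, ‖gradient (fun y => u y * η y) x‖ ^ 2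
      = (∫ x, u x * -lap u x * η x ^ 2) + ∫ x, u x ^ 2 * ‖gradient η x‖ ^ 2 := by
  have hu1 : ContDiff ℝ 1 u := hu.of_le (by norm_num)
  have hφ : ContDiff ℝ 1 fun x => u x * (η x * η x) := hu1.mul (hη.mul hη)
  have hφc : HasCompactSupport fun x => u x * (η x * η x) := (hc.mul_left).mul_left
  have h := integral_inner_gradient hu hφ hφc
  have hpt : ∀ x, inner ℝ (gradient u x) (gradient (fun x => u x * (η x * η x)) x)
      = ‖gradient (fun y => u y * η y) x‖ ^ 2 - u x ^ 2 * ‖gradient η x‖ ^ 2 := by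
    intro x
    rw [gradient_mul_eq hu1 (hη.mul hη), gradient_mul_eq hη hη, gradient_mul_eq hu1 hη,
      norm_add_sq_real]
    simp only [inner_add_right, inner_smul_right, inner_smul_left, norm_smul, mul_pow,
      real_inner_self_eq_norm_sq, Real.norm_eq_abs, sq_abs, RCLike.conj_to_real]
    rw [real_inner_comm]
    ring
  have i1 : Integrable fun x => ‖gradient (fun y => u y * η y) x‖ ^ 2 :=
    integrable_of_vanishing ((hu1.mul hη).continuous_gradient.norm.pow 2)
      (HasCompactSupport.gradient (f := fun y => u y * η y) hc.mul_left) (by simp)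
  have i2 : Integrable fun x => u x ^ 2 * ‖gradient η x‖ ^ 2 :=
    integrable_of_vanishing ((hu1.continuous.pow 2).mul (hη.continuous_gradient.norm.pow 2))
      hc.gradient (by simp +contextual)
  simp_rw [hpt] at h
  rw [integral_sub i1 i2] at h
  rw [← sub_eq_iff_eq_add, h]
  congr 1
  ext x
  ring

theorem integral_source_le_of_stable {u : EuclideanSpace ℝ (Fin N) → ℝ} (hu : ContDiff ℝ 2 u)
    {ψ ψ' Ψ : ℝ → ℝ} (hψ : ∀ t, HasDerivAt ψ (ψ' t) t) (hψ' : Continuous ψ')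
    (hΨ : ∀ t, HasDerivAt Ψ (ψ' t ^ 2) t) {d : EuclideanSpace ℝ (Fin N) → ℝ} (hd : Continuous d)
    {c C : ℝ} (hc : 0 < c) (hC : 0 < C) (hΨψ : ∀ x, Ψ (u x) ^ 2 ≤ C * (ψ' (u x) * ψ (u x)) ^ 2)
    (hdψ : ∀ x, (1 + c) * (-lap u x * Ψ (u x)) ≤ d x * ψ (u x) ^ 2) :
    ∃ C' : ℝ, 0 < C' ∧ ∀ η : EuclideanSpace ℝ (Fin N) → ℝ, ContDiff ℝ 1 η → HasCompactSupport η →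
      ∫ x, d x * (ψ (u x) * η x) ^ 2 ≤ ∫ x, ‖gradient (fun y => ψ (u y) * η y) x‖ ^ 2 →
      ∫ x, -lap u x * Ψ (u x) * η x ^ 2 ≤ C' * ∫ x, ψ (u x) ^ 2 * ‖gradient η x‖ ^ 2 := by
  set ε := c / (4 + c) with hε
  have hε0 : 0 < ε := by positivity
  have hε1 : ε < 1 := by rw [hε, div_lt_one (by positivity)]; linarith
  have hlam : (1 + ε) = (1 + c / 2) * (1 - ε) := by rw [hε]; field_simp; ring
  set C₁ := (1 + c / 2) * (C / ε) + (1 + 1 / ε) with hC₁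
  have hC₁0 : 0 < C₁ := by positivity
  refine ⟨2 / c * C₁, by positivity, fun η hη hηc hstab => ?_⟩
  have hu1 : ContDiff ℝ 1 u := hu.of_le (by norm_num)
  have hψc : ContDiff ℝ 1 ψ := contDiff_one_of_hasDerivAt hψ hψ'
  have hΨc : ContDiff ℝ 1 Ψ := contDiff_one_of_hasDerivAt hΨ (hψ'.pow 2)
  have hψu : ContDiff ℝ 1 fun x => ψ (u x) := hψc.comp hu1
  have hΨu : ContDiff ℝ 1 fun x => Ψ (u x) := hΨc.comp hu1
  have hφ : ContDiff ℝ 1 fun x => Ψ (u x) * (η x * η x) := hΨu.mul (hη.mul hη)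
  have hφc : HasCompactSupport fun x => Ψ (u x) * (η x * η x) := (hηc.mul_left).mul_left
  have h := integral_inner_gradient hu hφ hφc
  have hpt : ∀ x, ‖gradient (fun y => ψ (u y) * η y) x‖ ^ 2 ≤
      (1 + c / 2) * inner ℝ (gradient u x) (gradient (fun x => Ψ (u x) * (η x * η x)) x)
        + C₁ * (ψ (u x) ^ 2 * ‖gradient η x‖ ^ 2) := by
    intro x
    rw [gradient_mul_eq hΨu (hη.mul hη), gradient_mul_eq hη hη, gradient_mul_eq hψu hη,
      gradient_comp_eq hψ hu1, gradient_comp_eq hΨ hu1, norm_add_sq_real]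
    simp only [inner_add_right, inner_smul_right, inner_smul_left, norm_smul, mul_pow,
      real_inner_self_eq_norm_sq, Real.norm_eq_abs, sq_abs, RCLike.conj_to_real]
    rw [real_inner_comm]
    set I := inner ℝ (gradient u x) (gradient η x) with hI
    have hIle : I ^ 2 ≤ ‖gradient u x‖ ^ 2 * ‖gradient η x‖ ^ 2 := by
      rw [← mul_pow]
      exact sq_le_sq' (by linarith [neg_le_of_abs_le (abs_real_inner_le_norm (gradient u x) (gradient η x))])
        (real_inner_le_norm _ _)
    set g := ‖gradient u x‖ ^ 2
    set k := ‖gradient η x‖ ^ 2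
    have hg : 0 ≤ g := by positivity
    have hk : 0 ≤ k := by positivity
    have y1 : 2 * (ψ (u x) * (η x * (ψ' (u x) * I))) ≤
        ε * (η x ^ 2 * (ψ' (u x) ^ 2 * g)) + 1 / ε * (ψ (u x) ^ 2 * k) := by
      refine two_mul_le_of_sq_le_mul (by positivity) (by positivity) hε0 ?_
      have := mul_le_mul_of_nonneg_left hIle (sq_nonneg (ψ (u x) * η x * ψ' (u x)))
      linarith
    have y2 : 2 * -(Ψ (u x) * (η x * I)) ≤
        ε * (η x ^ 2 * (ψ' (u x) ^ 2 * g)) + 1 / ε * (C * (ψ (u x) ^ 2 * k)) := by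
      refine two_mul_le_of_sq_le_mul (by positivity) (by positivity) hε0 ?_
      have := mul_le_mul (hΨψ x) hIle (sq_nonneg I) (by positivity)
      have := mul_le_mul_of_nonneg_left this (sq_nonneg (η x))
      linarith
    have y3 := mul_le_mul_of_nonneg_left y2 (by positivity : 0 ≤ 1 + c / 2)
    have y4 : (1 + ε) * (η x ^ 2 * (ψ' (u x) ^ 2 * g))
        = (1 + c / 2) * (1 - ε) * (η x ^ 2 * (ψ' (u x) ^ 2 * g)) := by rw [hlam]
    have y5 : C₁ * (ψ (u x) ^ 2 * k) = (1 + c / 2) * (1 / ε * (C * (ψ (u x) ^ 2 * k)))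
        + (ψ (u x) ^ 2 * k + 1 / ε * (ψ (u x) ^ 2 * k)) := by rw [hC₁]; ring
    rw [y5]
    linarith
  have i1 : Integrable fun x => ‖gradient (fun y => ψ (u y) * η y) x‖ ^ 2 :=
    integrable_of_vanishing ((hψu.mul hη).continuous_gradient.norm.pow 2)
      (HasCompactSupport.gradient (f := fun y => ψ (u y) * η y) hηc.mul_left) (by simp)
  have i2 : Integrable fun x => ψ (u x) ^ 2 * ‖gradient η x‖ ^ 2 :=
    integrable_of_vanishing ((hψu.continuous.pow 2).mul (hη.continuous_gradient.norm.pow 2))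
      hηc.gradient (by simp +contextual)
  have i3 : Integrable fun x =>
      inner ℝ (gradient u x) (gradient (fun x => Ψ (u x) * (η x * η x)) x) :=
    integrable_of_vanishing (hu1.continuous_gradient.inner hφ.continuous_gradient)
      hφc.gradient (by simp +contextual)
  have i4 : Integrable fun x => d x * (ψ (u x) * η x) ^ 2 :=
    integrable_of_vanishing (hd.mul ((hψu.mul hη).continuous.pow 2)) hηc (by simp +contextual)
  have i5 : Integrable fun x => -lap u x * Ψ (u x) * η x ^ 2 :=
    integrable_of_vanishing (((continuous_lap hu).neg.mul hΨu.continuous).mul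
      (hη.continuous.pow 2)) hηc (by simp +contextual)
  have h1 := integral_mono i1 ((i3.const_mul _).add (i2.const_mul _)) hpt
  simp only [Pi.add_apply] at h1
  rw [integral_add (i3.const_mul _) (i2.const_mul _), integral_const_mul, integral_const_mul, h]
    at h1
  have h2 : (1 + c) * ∫ x, -lap u x * Ψ (u x) * η x ^ 2 ≤ ∫ x, d x * (ψ (u x) * η x) ^ 2 := by
    rw [← integral_const_mul]
    refine integral_mono (i5.const_mul _) i4 fun x => ?_
    have := mul_le_mul_of_nonneg_right (hdψ x) (sq_nonneg (η x))
    simp only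
    nlinarith
  have h3 : ∫ x, -lap u x * (Ψ (u x) * (η x * η x)) = ∫ x, -lap u x * Ψ (u x) * η x ^ 2 := by
    congr 1; ext x; ring
  rw [h3] at h1
  set Z := ∫ x, -lap u x * Ψ (u x) * η x ^ 2
  have h4 : c / 2 * Z ≤ C₁ * ∫ x, ψ (u x) ^ 2 * ‖gradient η x‖ ^ 2 := by linarith
  rw [mul_assoc, div_mul_eq_mul_div, le_div_iff₀ hc]
  linarith

end Caccioppoli

section CriticalIntegrability

variable {N : ℕ}

theorem integral_indicator_pow_annular_le (hN : N ≠ 0) {C R₁ R : ℝ} (hC : 0 < C) (hR₁ : 1 ≤ R₁)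
    (hR : R₁ ≤ R) {g : EuclideanSpace ℝ (Fin N) → ℝ} (hg : Integrable fun x => g x ^ N)
    (hg0 : ∀ x, 0 ≤ g x)
    (hle : ∀ x, g x ≤ C * (Metric.closedBall 0 R₁).indicator 1 x
      + C / R * (annulus N R).indicator 1 x) :
    ∫ x, g x ^ N ≤ 2 ^ (N - 1) * C ^ N * (R₁ ^ N + 2 ^ N) *
      volume.real (Metric.ball (0 : EuclideanSpace ℝ (Fin N)) 1) := by
  have hR0 : 0 < R := by linarith
  have hball : ∀ r, Integrable
      ((Metric.closedBall 0 r).indicator (1 : EuclideanSpace ℝ (Fin N) → ℝ)) := fun r =>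
    (integrable_indicator_iff Metric.isClosed_closedBall.measurableSet).2
      (continuous_const.continuousOn.integrableOn_compact (isCompact_closedBall _ _))
  have hpow : ∀ (s : Set (EuclideanSpace ℝ (Fin N))) x,
      s.indicator (1 : EuclideanSpace ℝ (Fin N) → ℝ) x ^ N = s.indicator 1 x := by
    intro s x
    by_cases hx : x ∈ s <;> simp [hx, hN]
  have hpt : ∀ x, g x ^ N ≤ 2 ^ (N - 1) * (C ^ N * (Metric.closedBall 0 R₁).indicator 1 x
      + (C / R) ^ N * (Metric.closedBall 0 (2 * R)).indicator 1 x) := by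
    intro x
    have h0 : ∀ s : Set (EuclideanSpace ℝ (Fin N)), 0 ≤ s.indicator (1 : EuclideanSpace ℝ (Fin N) → ℝ) x := fun s =>
      Set.indicator_nonneg (fun _ _ => zero_le_one) x
    calc g x ^ N ≤ _ := pow_le_pow_left₀ (hg0 x) (hle x) N
      _ ≤ _ := add_pow_le (mul_nonneg hC.le (h0 _)) (mul_nonneg (by positivity) (h0 _)) N
      _ ≤ _ := by
        rw [mul_pow, mul_pow, hpow, hpow]
        gcongr
        · simp
        · exact Set.sdiff_subset
  refine (integral_mono hg (((hball R₁).const_mul _).add ((hball (2 * R)).const_mul _)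
    |>.const_mul _) hpt).trans_eq ?_
  simp only [Pi.add_apply]
  rw [integral_const_mul, integral_add ((hball _).const_mul _) ((hball _).const_mul _),
    integral_const_mul, integral_const_mul,
    integral_indicator_one Metric.isClosed_closedBall.measurableSet,
    integral_indicator_one Metric.isClosed_closedBall.measurableSet,
    Measure.addHaar_real_closedBall _ _ (by linarith),
    Measure.addHaar_real_closedBall _ _ (by linarith), finrank_euclideanSpace_fin, mul_pow, div_pow]
  field_simp

theorem integrable_of_caccioppoli (hN : 3 ≤ N) {K : Set (EuclideanSpace ℝ (Fin N))}
    (hK : IsCompact K) {P : EuclideanSpace ℝ (Fin N) → ℝ} (hP : Continuous P) (hP0 : ∀ x, 0 ≤ P x)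
    {C : ℝ} (hC : 0 < C)
    (h : ∀ η : EuclideanSpace ℝ (Fin N) → ℝ, ContDiff ℝ 1 η → HasCompactSupport η →
      tsupport η ⊆ Kᶜ →
      ∫ x, P x * η x ^ 2 ≤ C * ∫ x, P x ^ (((N : ℝ) - 2) / N) * ‖gradient η x‖ ^ 2) :
    Integrable P := by
  have hNr : (3 : ℝ) ≤ N := by exact_mod_cast hN
  have hθ : 0 < ((N : ℝ) - 2) / N := by apply div_pos <;> linarith
  obtain ⟨C₁, R₁, hC₁, hR₁, hcut⟩ := exists_annular_cutoff hK
  set D := √C * N with hD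
  have hD0 : 0 ≤ D := by positivity
  refine (aecover_closedBall (μ := volume) (x := (0 : EuclideanSpace ℝ (Fin N)))
    (r := fun r : ℝ => r) tendsto_id).integrable_of_integral_bounded_of_nonneg_ae
    ((∫ x in Metric.closedBall 0 R₁, P x) + D ^ N * (2 ^ (N - 1) * C₁ ^ N * (R₁ ^ N + 2 ^ N) *
      volume.real (Metric.ball (0 : EuclideanSpace ℝ (Fin N)) 1)))
    (fun r => hP.continuousOn.integrableOn_compact (isCompact_closedBall _ _))
    (Eventually.of_forall hP0) ?_
  filter_upwards [eventually_ge_atTop R₁] with R hR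
  obtain ⟨ζ, hζ, hζc, hζK, hζ0, hζ1, hζe, hζg⟩ := hcut R hR
  have hη : ContDiff ℝ 1 fun x => ζ x ^ N := hζ.pow N
  have hsub : Function.support (fun x => ζ x ^ N) ⊆ Function.support ζ := by
    intro x hx hx0
    simp only [Function.mem_support] at hx
    exact hx (by rw [hx0, zero_pow (by omega)])
  have hηc : HasCompactSupport fun x => ζ x ^ N := hζc.mono hsub
  have hA : Integrable fun x => P x * (ζ x ^ N) ^ 2 :=
    integrable_of_vanishing (hP.mul (hη.continuous.pow 2)) hηc (by simp +contextual)
  have hgN : Integrable fun x => ‖gradient ζ x‖ ^ N :=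
    integrable_of_vanishing (hζ.continuous_gradient.norm.pow N) hζc.gradient
      (fun x hx => by rw [hx, norm_zero, zero_pow (by omega)])
  have hPr : Integrable fun x => P x ^ (((N : ℝ) - 2) / N) * ‖gradient (fun x => ζ x ^ N) x‖ ^ 2 :=
    integrable_of_vanishing ((hP.rpow_const fun x => Or.inr hθ.le).mul
      (hη.continuous_gradient.norm.pow 2)) (HasCompactSupport.gradient hηc) (by simp +contextual)
  have hconj : ((N : ℝ) / (N - 2)).HolderConjugate (N / 2) := by
    rw [Real.holderConjugate_iff]
    have : (N : ℝ) - 2 ≠ 0 := by linarith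
    constructor
    · rw [lt_div_iff₀ (by linarith)]; linarith
    · field_simp; ring
  have hpt : ∀ x, C * (P x ^ (((N : ℝ) - 2) / N) * ‖gradient (fun x => ζ x ^ N) x‖ ^ 2) ≤
      ((N : ℝ) - 2) / N * (P x * (ζ x ^ N) ^ 2) + 2 / N * (D ^ N * ‖gradient ζ x‖ ^ N) := by
    intro x
    have hB : 0 ≤ P x * (ζ x ^ N) ^ 2 := mul_nonneg (hP0 x) (by positivity)
    have hy := Real.young_inequality_of_nonneg (a := (P x * (ζ x ^ N) ^ 2) ^ (((N : ℝ) - 2) / N))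
      (b := (D * ‖gradient ζ x‖) ^ 2) (by positivity) (by positivity) hconj
    rw [← Real.rpow_mul hB, ← Real.rpow_natCast (D * _) 2, ← Real.rpow_mul (by positivity)] at hy
    have e1 : ((N : ℝ) - 2) / N * (N / (N - 2)) = 1 := by
      have : (N : ℝ) - 2 ≠ 0 := by linarith
      field_simp
    have e2 : ((2 : ℕ) : ℝ) * (N / 2) = (N : ℕ) := by push_cast; ring
    rw [e1, Real.rpow_one, e2, Real.rpow_natCast, Real.rpow_natCast, mul_pow D, mul_pow D] at hy
    have e3 : (P x * (ζ x ^ N) ^ 2) ^ (((N : ℝ) - 2) / N)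
        = P x ^ (((N : ℝ) - 2) / N) * ζ x ^ (2 * (N - 2)) := by
      rw [Real.mul_rpow (hP0 x) (by positivity), ← pow_mul, ← Real.rpow_natCast,
        ← Real.rpow_mul (hζ0 x), ← Real.rpow_natCast (ζ x) (2 * (N - 2))]
      congr 2
      push_cast [show 2 ≤ N by omega]
      field_simp
    have e4 : ζ x ^ (2 * (N - 1)) ≤ ζ x ^ (2 * (N - 2)) :=
      pow_le_pow_of_le_one (hζ0 x) (hζ1 x) (by omega)
    have e5 : ‖gradient (fun x => ζ x ^ N) x‖ ^ 2
        = (N : ℝ) ^ 2 * ζ x ^ (2 * (N - 1)) * ‖gradient ζ x‖ ^ 2 := by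
      rw [gradient_pow_eq hζ, norm_smul, mul_pow, Real.norm_eq_abs, sq_abs, mul_pow, ← pow_mul,
        mul_comm (N - 1) 2]
    have e6 : D ^ 2 = C * (N : ℝ) ^ 2 := by rw [hD, mul_pow, Real.sq_sqrt hC.le]
    have e7 := mul_le_mul_of_nonneg_left e4 (by have := hP0 x; positivity :
      0 ≤ C * P x ^ (((N : ℝ) - 2) / N) * (N : ℝ) ^ 2 * ‖gradient ζ x‖ ^ 2)
    rw [e3, e6] at hy
    rw [e5]
    have e8 : P x * (ζ x ^ N) ^ 2 / (N / (N - 2)) = ((N : ℝ) - 2) / N * (P x * (ζ x ^ N) ^ 2) := by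
      field_simp
    rw [e8] at hy
    calc _ ≤ _ := by linarith
      _ ≤ _ := hy
      _ = _ := by ring
  have h1 := h _ hη hηc ((closure_mono hsub).trans hζK)
  have h2 := integral_mono (hPr.const_mul C) ((hA.const_mul _).add
    ((hgN.const_mul _).const_mul _)) hpt
  simp only [Pi.add_apply] at h2
  rw [integral_const_mul, integral_add (hA.const_mul _) ((hgN.const_mul _).const_mul _),
    integral_const_mul, integral_const_mul, integral_const_mul] at h2
  have h3 := integral_indicator_pow_annular_le (by omega) hC₁ hR₁ hR hgN (fun _ => norm_nonneg _) hζg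
  have h4 : ∫ x, P x * (ζ x ^ N) ^ 2 ≤ D ^ N * ∫ x, ‖gradient ζ x‖ ^ N := by
    have e : ((N : ℝ) - 2) / N = 1 - 2 / N := by field_simp
    rw [e] at h1 h2
    have h5 := h1.trans h2
    have : 2 / (N : ℝ) * ∫ x, P x * (ζ x ^ N) ^ 2 ≤
        2 / (N : ℝ) * (D ^ N * ∫ x, ‖gradient ζ x‖ ^ N) := by linarith
    exact le_of_mul_le_mul_left this (by positivity)
  have h6 : ∫ x in Metric.closedBall 0 R, P x ≤
      (∫ x in Metric.closedBall 0 R₁, P x) + ∫ x, P x * (ζ x ^ N) ^ 2 := by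
    rw [← integral_indicator Metric.isClosed_closedBall.measurableSet,
      ← integral_indicator Metric.isClosed_closedBall.measurableSet]
    have i : ∀ r, Integrable ((Metric.closedBall (0 : EuclideanSpace ℝ (Fin N)) r).indicator P) :=
      fun r => (integrable_indicator_iff Metric.isClosed_closedBall.measurableSet).2
        (hP.continuousOn.integrableOn_compact (isCompact_closedBall _ _))
    rw [← integral_add (i _) hA]
    refine integral_mono (i _) ((i _).add hA) fun x => ?_
    have hB : 0 ≤ P x * (ζ x ^ N) ^ 2 := mul_nonneg (hP0 x) (by positivity)
    simp only [Set.indicator, Metric.mem_closedBall, dist_zero_right]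
    split_ifs with hx1 hx2 hx2
    · linarith
    · simp [hζe x (by linarith) hx1]
    · linarith [hP0 x]
    · linarith
  have h7 := mul_le_mul_of_nonneg_left h3 (pow_nonneg hD0 N)
  linarith

end CriticalIntegrability

section Weight

variable {N : ℕ}

/-- The weight `(ρ² b / (ρ² + b)²)^(t / 2)` with `b = 1 + ‖x‖²`, which is comparable to `1` on the
annulus of radius `ρ` and decays like `‖x‖^(-t)` at infinity. -/
noncomputable def annularWeight (t ρ : ℝ) (x : EuclideanSpace ℝ (Fin N)) : ℝ :=
  (ρ ^ 2 * (1 + ‖x‖ ^ 2) / (ρ ^ 2 + (1 + ‖x‖ ^ 2)) ^ 2) ^ (t / 2)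

theorem annularWeight_base_pos {ρ : ℝ} (hρ : 0 < ρ) (x : EuclideanSpace ℝ (Fin N)) :
    0 < ρ ^ 2 * (1 + ‖x‖ ^ 2) / (ρ ^ 2 + (1 + ‖x‖ ^ 2)) ^ 2 := by
  positivity

theorem annularWeight_sq (t : ℝ) {ρ : ℝ} (hρ : 0 < ρ) (x : EuclideanSpace ℝ (Fin N)) :
    annularWeight t ρ x ^ 2 =
      (ρ ^ 2 * (1 + ‖x‖ ^ 2) / (ρ ^ 2 + (1 + ‖x‖ ^ 2)) ^ 2) ^ t := by
  rw [annularWeight, ← Real.rpow_mul_natCast (annularWeight_base_pos hρ x).le]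
  congr 1
  push_cast
  ring

theorem annularWeight_sq_le_one {t : ℝ} (ht : 0 ≤ t) {ρ : ℝ} (hρ : 0 < ρ)
    (x : EuclideanSpace ℝ (Fin N)) : annularWeight t ρ x ^ 2 ≤ 1 := by
  rw [annularWeight_sq t hρ]
  refine Real.rpow_le_one (annularWeight_base_pos hρ x).le ?_ ht
  rw [div_le_one (by positivity)]
  nlinarith [sq_nonneg ‖x‖, sq_nonneg ρ]

theorem annularWeight_sq_le_inner {t : ℝ} (ht : 0 ≤ t) {ρ : ℝ} (hρ : 0 < ρ)
    (x : EuclideanSpace ℝ (Fin N)) :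
    annularWeight t ρ x ^ 2 ≤ ((1 + ‖x‖ ^ 2) / ρ ^ 2) ^ t := by
  rw [annularWeight_sq t hρ]
  refine Real.rpow_le_rpow (annularWeight_base_pos hρ x).le ?_ ht
  rw [div_le_div_iff₀ (by positivity) (by positivity)]
  have h : (ρ ^ 2) ^ 2 ≤ (ρ ^ 2 + (1 + ‖x‖ ^ 2)) ^ 2 :=
    pow_le_pow_left₀ (by positivity) (by nlinarith [sq_nonneg ‖x‖]) 2
  nlinarith [mul_le_mul_of_nonneg_left h (one_add_norm_sq_pos x).le]

theorem annularWeight_sq_le_outer {t : ℝ} (ht : 0 ≤ t) {ρ : ℝ} (hρ : 0 < ρ)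
    (x : EuclideanSpace ℝ (Fin N)) :
    annularWeight t ρ x ^ 2 ≤ (ρ ^ 2 / (1 + ‖x‖ ^ 2)) ^ t := by
  rw [annularWeight_sq t hρ]
  refine Real.rpow_le_rpow (annularWeight_base_pos hρ x).le ?_ ht
  rw [div_le_div_iff₀ (by positivity) (by positivity)]
  have h : (1 + ‖x‖ ^ 2) ^ 2 ≤ (ρ ^ 2 + (1 + ‖x‖ ^ 2)) ^ 2 :=
    pow_le_pow_left₀ (by positivity) (by nlinarith [sq_nonneg ρ]) 2
  nlinarith [mul_le_mul_of_nonneg_left h (sq_nonneg ρ)]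

theorem le_annularWeight_sq {t : ℝ} (ht : 0 ≤ t) {ρ : ℝ} (hρ : 1 ≤ ρ)
    {x : EuclideanSpace ℝ (Fin N)} (hx : x ∈ annulus N ρ) :
    (1 / 36 : ℝ) ^ t ≤ annularWeight t ρ x ^ 2 := by
  rw [annularWeight_sq t (by linarith)]
  refine Real.rpow_le_rpow (by norm_num) ?_ ht
  rw [mem_annulus] at hx
  have h1 : ρ ^ 2 ≤ ‖x‖ ^ 2 := pow_le_pow_left₀ (by linarith) hx.1 2
  have h2 : ‖x‖ ^ 2 ≤ (2 * ρ) ^ 2 := pow_le_pow_left₀ (norm_nonneg _) hx.2 2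
  have h3 : 1 ≤ ρ ^ 2 := by nlinarith
  rw [div_le_div_iff₀ (by norm_num) (by positivity)]
  have h4 : (ρ ^ 2 + (1 + ‖x‖ ^ 2)) ^ 2 ≤ (6 * ρ ^ 2) ^ 2 :=
    pow_le_pow_left₀ (by positivity) (by linarith) 2
  nlinarith

theorem contDiff_annularWeight (t : ℝ) {ρ : ℝ} (hρ : 0 < ρ) :
    ContDiff ℝ 1 (annularWeight (N := N) t ρ) := by
  have hb : ContDiff ℝ 1 fun x : EuclideanSpace ℝ (Fin N) => 1 + ‖x‖ ^ 2 :=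
    contDiff_one_add_norm_sq
  exact ((contDiff_const.mul hb).div ((contDiff_const.add hb).pow 2) fun x => by positivity)
    |>.rpow_const_of_ne fun x => (annularWeight_base_pos hρ x).ne'

theorem norm_gradient_annularWeight_sq_le (t : ℝ) {ρ : ℝ} (hρ : 0 < ρ)
    (x : EuclideanSpace ℝ (Fin N)) :
    ‖gradient (annularWeight t ρ) x‖ ^ 2 ≤ t ^ 2 * (annularWeight t ρ x ^ 2 / (1 + ‖x‖ ^ 2)) := by
  have hb := one_add_norm_sq_pos x
  have hbase := annularWeight_base_pos hρ x
  set b := 1 + ‖x‖ ^ 2 with hbdef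
  have hder : HasDerivAt (fun s : ℝ => (ρ ^ 2 * s / (ρ ^ 2 + s) ^ 2) ^ (t / 2))
      ((ρ ^ 2 * b / (ρ ^ 2 + b) ^ 2) ^ (t / 2) * (t / 2) * ((ρ ^ 2 - b) / (b * (ρ ^ 2 + b)))) b := by
    have h1 : HasDerivAt (fun s : ℝ => ρ ^ 2 * s / (ρ ^ 2 + s) ^ 2)
        (((ρ ^ 2 * 1) * (ρ ^ 2 + b) ^ 2 - (ρ ^ 2 * b) * ((2 : ℕ) * (ρ ^ 2 + b) ^ (2 - 1) * 1))
          / ((ρ ^ 2 + b) ^ 2) ^ 2) b :=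
      ((hasDerivAt_id b).const_mul _).div (((hasDerivAt_id b).const_add _).pow 2) (by positivity)
    refine (h1.rpow_const (p := t / 2) (Or.inl hbase.ne')).congr_deriv ?_
    rw [Real.rpow_sub_one hbase.ne']
    push_cast
    field_simp
    ring
  have hg := (HasDerivAt.comp_hasGradientAt (f := fun y => 1 + ‖y‖ ^ 2) hder
    (hasGradientAt_one_add_norm_sq x)).gradient
  have hw : annularWeight t ρ x = (ρ ^ 2 * b / (ρ ^ 2 + b) ^ 2) ^ (t / 2) := rfl
  change gradient (annularWeight t ρ) x = _ at hg
  rw [hg, ← hw, norm_smul, norm_smul, mul_pow, mul_pow, Real.norm_eq_abs, sq_abs]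
  have h2 : ((ρ ^ 2 - b) / (ρ ^ 2 + b)) ^ 2 ≤ 1 := by
    rw [div_pow, div_le_one (by positivity)]
    nlinarith [mul_pos (pow_pos hρ 2) hb]
  have h3 : ‖x‖ ^ 2 / b ≤ 1 := by
    rw [div_le_one hb]; linarith
  have h4 : ((ρ ^ 2 - b) / (ρ ^ 2 + b)) ^ 2 * (‖x‖ ^ 2 / b) ≤ 1 :=
    mul_le_one₀ h2 (by positivity) h3
  calc _ = t ^ 2 * (annularWeight t ρ x ^ 2 / b) *
        (((ρ ^ 2 - b) / (ρ ^ 2 + b)) ^ 2 * (‖x‖ ^ 2 / b)) := by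
        norm_num
        field_simp
        ring
    _ ≤ _ := mul_le_of_le_one_right (by positivity) h4

end Weight

section AnnulusDecay

variable {N : ℕ}

theorem sq_le_one_add_rpow {z Q : ℝ} (hz : 0 ≤ z) (hQ : 2 ≤ Q) : z ^ 2 ≤ 1 + z ^ Q := by
  rcases le_total z 1 with h | h
  · have := Real.rpow_nonneg hz Q
    nlinarith
  · have := Real.rpow_le_rpow_of_exponent_le h hQ
    rw [Real.rpow_two] at this
    linarith

theorem integral_annulus_sq_le {u : EuclideanSpace ℝ (Fin N) → ℝ}
    (hu : Continuous u) (hu0 : ∀ x, 0 ≤ u x) {Q : ℝ} (hQ : 2 ≤ Q)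
    (hint : Integrable fun x => u x ^ Q) {R : ℝ} (hR : 0 < R) :
    ∫ x in annulus N R, u x ^ 2 ≤ R ^ (N - 2 * N / Q) *
      (2 ^ N * volume.real (Metric.ball (0 : EuclideanSpace ℝ (Fin N)) 1) + ∫ x, u x ^ Q) := by
  have hQ0 : Q ≠ 0 := by linarith
  set r := R ^ (N / Q : ℝ) with hr
  have hr0 : 0 < r := Real.rpow_pos_of_pos hR _
  have hrQ : r ^ Q = R ^ N := by
    rw [hr, ← Real.rpow_mul hR.le, div_mul_cancel₀ _ hQ0, Real.rpow_natCast]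
  have hr2 : R ^ (N - 2 * N / Q : ℝ) = R ^ N / r ^ 2 := by
    rw [Real.rpow_sub hR, Real.rpow_natCast, hr, ← Real.rpow_mul_natCast hR.le]
    congr 2
    push_cast
    ring
  have hpt : ∀ x, u x ^ 2 ≤ (1 + R ^ N * u x ^ Q) / r ^ 2 := by
    intro x
    rw [le_div_iff₀ (by positivity), ← hrQ, ← Real.mul_rpow hr0.le (hu0 x), ← mul_pow, mul_comm]
    exact sq_le_one_add_rpow (mul_nonneg hr0.le (hu0 x)) hQ
  have i1 : IntegrableOn (fun _ : EuclideanSpace ℝ (Fin N) => (1 : ℝ)) (annulus N R) :=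
    continuous_const.continuousOn.integrableOn_compact (isCompact_annulus R)
  have i2 : IntegrableOn (fun x => u x ^ 2) (annulus N R) :=
    (hu.pow 2).continuousOn.integrableOn_compact (isCompact_annulus R)
  have i3 : IntegrableOn (fun x => R ^ N * u x ^ Q) (annulus N R) :=
    (hint.const_mul _).integrableOn
  have h1 := setIntegral_mono_on i2 ((i1.add i3).div_const (r ^ 2)) (measurableSet_annulus R)
    fun x _ => hpt x
  refine h1.trans ?_
  simp only [Pi.add_apply]
  rw [integral_div, integral_add i1 i3, integral_const_mul, hr2, div_mul_eq_mul_div]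
  gcongr
  rw [mul_add]
  gcongr
  · rw [setIntegral_const, smul_eq_mul, mul_one]
    calc volume.real (annulus N R)
        ≤ volume.real (Metric.closedBall (0 : EuclideanSpace ℝ (Fin N)) (2 * R)) :=
          measureReal_mono Set.sdiff_subset (isCompact_closedBall _ _).measure_lt_top.ne
      _ = _ := by
        rw [Measure.addHaar_real_closedBall _ _ (by linarith), finrank_euclideanSpace_fin, mul_pow]
        ring
  · exact Eventually.of_forall fun x => Real.rpow_nonneg (hu0 x) Q
  · exact Measure.restrict_le_self

theorem norm_add_sq_le_young {E : Type*} [NormedAddCommGroup E] [InnerProductSpace ℝ E] (a b : E)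
    {ν : ℝ} (hν : 0 < ν) : ‖a + b‖ ^ 2 ≤ (1 + ν) * ‖a‖ ^ 2 + (1 + 1 / ν) * ‖b‖ ^ 2 := by
  have h := two_mul_le_of_sq_le_mul (w := inner ℝ a b) (sq_nonneg ‖a‖) (sq_nonneg ‖b‖) hν (by
    rw [← mul_pow]
    exact sq_le_sq' (neg_le_of_abs_le (abs_real_inner_le_norm a b)) (real_inner_le_norm a b))
  rw [norm_add_sq_real]
  linarith

/-- The Caccioppoli inequality with an admissible weight `w`, tested with `u ζ w`. -/
theorem weighted_energy_le (hN : 3 ≤ N) {u d : EuclideanSpace ℝ (Fin N) → ℝ}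
    (hu : ContDiff ℝ 2 u) (hu0 : ∀ x, 0 ≤ u x) (hd : Continuous d) {μ A Q t ν : ℝ} (hμ : 0 ≤ μ)
    (hA : 0 ≤ A) (hν : 0 < ν)
    (hle : ∀ x, u x * -lap u x ≤ μ * (d x * u x ^ 2) + A * u x ^ Q)
    (hint : Integrable fun x => u x ^ Q) {w ζ : EuclideanSpace ℝ (Fin N) → ℝ}
    (hw : ContDiff ℝ 1 w) (hw1 : ∀ x, w x ^ 2 ≤ 1)
    (hwg : ∀ x, ‖gradient w x‖ ^ 2 ≤ t ^ 2 * (w x ^ 2 / (1 + ‖x‖ ^ 2)))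
    (hζ : ContDiff ℝ 1 ζ) (hζc : HasCompactSupport ζ) (hζ0 : ∀ x, 0 ≤ ζ x) (hζ1 : ∀ x, ζ x ≤ 1)
    (hstab : ∫ x, d x * (u x * (ζ x * w x)) ^ 2 ≤
      ∫ x, ‖gradient (fun y => u y * (ζ y * w y)) x‖ ^ 2) :
    (1 - μ - (1 + ν) * t ^ 2 * (4 / ((N : ℝ) - 2) ^ 2)) *
        ∫ x, ‖gradient (fun y => u y * (ζ y * w y)) x‖ ^ 2 ≤
      A * (∫ x, u x ^ Q * w x ^ 2) +
        (1 + 1 / ν) * ∫ x, u x ^ 2 * w x ^ 2 * ‖gradient ζ x‖ ^ 2 := by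
  have hNr : (3 : ℝ) ≤ N := by exact_mod_cast hN
  have hu1 : ContDiff ℝ 1 u := hu.of_le (by norm_num)
  have hη : ContDiff ℝ 1 fun x => ζ x * w x := hζ.mul hw
  have hηc : HasCompactSupport fun x => ζ x * w x := hζc.mul_right
  have hv : ContDiff ℝ 1 fun x => u x * (ζ x * w x) := hu1.mul hη
  have hvc : HasCompactSupport fun x => u x * (ζ x * w x) := hηc.mul_left
  have hardy := hardy_inequality (by omega) hv hvc
  have hid := integral_norm_gradient_mul_sq hu hη hηc
  set X := ∫ x, ‖gradient (fun y => u y * (ζ y * w y)) x‖ ^ 2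
  have i1 : Integrable fun x => u x * -lap u x * (ζ x * w x) ^ 2 :=
    integrable_of_vanishing ((hu.continuous.mul (continuous_lap hu).neg).mul
      (hη.continuous.pow 2)) hηc (by simp +contextual)
  have i2 : Integrable fun x => d x * (u x * (ζ x * w x)) ^ 2 :=
    integrable_of_vanishing (hd.mul (hv.continuous.pow 2)) hvc (by simp +contextual)
  have hQm : AEStronglyMeasurable (fun x => u x ^ Q * w x ^ 2) volume :=
    hint.aestronglyMeasurable.mul (hw.continuous.pow 2).aestronglyMeasurable
  have i3 : Integrable fun x => u x ^ Q * w x ^ 2 := hint.mono hQm <| Eventually.of_forall fun x => by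
    rw [norm_mul, Real.norm_of_nonneg (sq_nonneg (w x))]
    exact mul_le_of_le_one_right (norm_nonneg _) (hw1 x)
  have i4 : Integrable fun x => u x ^ 2 * ‖gradient (fun y => ζ y * w y) x‖ ^ 2 :=
    integrable_of_vanishing ((hu.continuous.pow 2).mul (hη.continuous_gradient.norm.pow 2))
      (HasCompactSupport.gradient hηc) (by simp +contextual)
  have i5 : Integrable fun x => (u x * (ζ x * w x)) ^ 2 / (1 + ‖x‖ ^ 2) :=
    integrable_of_vanishing ((hv.continuous.pow 2).div₀ (by fun_prop)
      fun x => (one_add_norm_sq_pos x).ne') hvc (by simp +contextual)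
  have i6 : Integrable fun x => u x ^ 2 * w x ^ 2 * ‖gradient ζ x‖ ^ 2 :=
    integrable_of_vanishing (((hu.continuous.pow 2).mul (hw.continuous.pow 2)).mul
      (hζ.continuous_gradient.norm.pow 2)) hζc.gradient (by simp +contextual)
  have h1 : ∫ x, u x * -lap u x * (ζ x * w x) ^ 2 ≤
      μ * (∫ x, d x * (u x * (ζ x * w x)) ^ 2) + A * ∫ x, u x ^ Q * w x ^ 2 := by
    rw [← integral_const_mul, ← integral_const_mul, ← integral_add (i2.const_mul _) (i3.const_mul _)]
    refine integral_mono i1 ((i2.const_mul _).add (i3.const_mul _)) fun x => ?_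
    have h2 := mul_le_mul_of_nonneg_right (hle x) (sq_nonneg (ζ x * w x))
    have h3 : ζ x ^ 2 ≤ 1 := pow_le_one₀ (hζ0 x) (hζ1 x)
    have h4 := mul_le_mul_of_nonneg_left h3
      (mul_nonneg hA (mul_nonneg (Real.rpow_nonneg (hu0 x) Q) (sq_nonneg (w x))))
    beta_reduce
    nlinarith
  have h5 : ∫ x, u x ^ 2 * ‖gradient (fun y => ζ y * w y) x‖ ^ 2 ≤
      (1 + ν) * t ^ 2 * (∫ x, (u x * (ζ x * w x)) ^ 2 / (1 + ‖x‖ ^ 2)) +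
        (1 + 1 / ν) * ∫ x, u x ^ 2 * w x ^ 2 * ‖gradient ζ x‖ ^ 2 := by
    rw [← integral_const_mul, ← integral_const_mul, ← integral_add (i5.const_mul _) (i6.const_mul _)]
    refine integral_mono i4 ((i5.const_mul _).add (i6.const_mul _)) fun x => ?_
    have h6 := norm_add_sq_le_young (ζ x • gradient w x) (w x • gradient ζ x) hν
    rw [← gradient_mul_eq hζ hw, norm_smul, norm_smul, mul_pow, mul_pow, Real.norm_eq_abs,
      Real.norm_eq_abs, sq_abs, sq_abs] at h6
    have h7 := mul_le_mul_of_nonneg_left (hwg x) (by positivity : 0 ≤ (1 + ν) * ζ x ^ 2)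
    have h8 := mul_le_mul_of_nonneg_left (h6.trans (add_le_add_left
      (show _ ≤ (1 + ν) * ζ x ^ 2 * (t ^ 2 * (w x ^ 2 / (1 + ‖x‖ ^ 2))) by linarith) _))
      (sq_nonneg (u x))
    calc _ ≤ _ := h8
      _ = _ := by ring
  have h9 : (∫ x, (u x * (ζ x * w x)) ^ 2 / (1 + ‖x‖ ^ 2)) ≤ 4 / ((N : ℝ) - 2) ^ 2 * X := by
    have : 0 < ((N : ℝ) - 2) ^ 2 := by apply pow_pos; linarith
    rw [div_mul_eq_mul_div, le_div_iff₀ this]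
    linarith
  have h10 := mul_le_mul_of_nonneg_left h9 (by positivity : 0 ≤ (1 + ν) * t ^ 2)
  have h11 := mul_le_mul_of_nonneg_left hstab hμ
  linarith

theorem energy_annulus_le (hN : 3 ≤ N) {u : EuclideanSpace ℝ (Fin N) → ℝ}
    (hu : ContDiff ℝ 2 u) (hu0 : ∀ x, 0 ≤ u x) (hS : ∀ x, 0 ≤ -lap u x) {t κ ρ : ℝ} (hρ : 1 ≤ ρ)
    (hκ : 0 < κ) {w ζ : EuclideanSpace ℝ (Fin N) → ℝ} (hw : ContDiff ℝ 1 w)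
    (hwκ : ∀ x ∈ annulus N ρ, 1 ≤ κ * w x ^ 2)
    (hwg : ∀ x, ‖gradient w x‖ ^ 2 ≤ t ^ 2 * (w x ^ 2 / (1 + ‖x‖ ^ 2)))
    (hζ : ContDiff ℝ 1 ζ) (hζc : HasCompactSupport ζ)
    (hζe : ∀ x ∈ annulus N ρ, ζ x = 1) (hζg : ∀ x ∈ annulus N ρ, gradient ζ x = 0) :
    ∫ x in annulus N ρ, (u x ^ 2 / ρ ^ 2 + ‖gradient u x‖ ^ 2 + u x * -lap u x) ≤
      κ * ((6 + 2 * t ^ 2) * (4 / ((N : ℝ) - 2) ^ 2) + 3) *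
        ∫ x, ‖gradient (fun y => u y * (ζ y * w y)) x‖ ^ 2 := by
  have hNr : (3 : ℝ) ≤ N := by exact_mod_cast hN
  have hu1 : ContDiff ℝ 1 u := hu.of_le (by norm_num)
  have hη : ContDiff ℝ 1 fun x => ζ x * w x := hζ.mul hw
  have hηc : HasCompactSupport fun x => ζ x * w x := hζc.mul_right
  have hv : ContDiff ℝ 1 fun x => u x * (ζ x * w x) := hu1.mul hη
  have hvc : HasCompactSupport fun x => u x * (ζ x * w x) := hηc.mul_left
  have hardy := hardy_inequality (by omega) hv hvc
  have hid := integral_norm_gradient_mul_sq hu hη hηc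
  have i1 : Integrable fun x => u x * -lap u x * (ζ x * w x) ^ 2 :=
    integrable_of_vanishing ((hu.continuous.mul (continuous_lap hu).neg).mul
      (hη.continuous.pow 2)) hηc (by simp +contextual)
  have i2 : Integrable fun x => ‖gradient (fun y => u y * (ζ y * w y)) x‖ ^ 2 :=
    integrable_of_vanishing (hv.continuous_gradient.norm.pow 2)
      (HasCompactSupport.gradient hvc) (by simp +contextual)
  have i5 : Integrable fun x => (u x * (ζ x * w x)) ^ 2 / (1 + ‖x‖ ^ 2) :=
    integrable_of_vanishing ((hv.continuous.pow 2).div₀ (by fun_prop)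
      fun x => (one_add_norm_sq_pos x).ne') hvc (by simp +contextual)
  have i6 : IntegrableOn (fun x => u x ^ 2 / ρ ^ 2 + ‖gradient u x‖ ^ 2 + u x * -lap u x)
      (annulus N ρ) :=
    (((hu.continuous.pow 2).div_const _).add (hu1.continuous_gradient.norm.pow 2) |>.add
      (hu.continuous.mul (continuous_lap hu).neg)).continuousOn.integrableOn_compact
      (isCompact_annulus ρ)
  set H : EuclideanSpace ℝ (Fin N) → ℝ := fun x =>
    κ * ((6 + 2 * t ^ 2) * ((u x * (ζ x * w x)) ^ 2 / (1 + ‖x‖ ^ 2)) +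
      2 * ‖gradient (fun y => u y * (ζ y * w y)) x‖ ^ 2 +
      u x * -lap u x * (ζ x * w x) ^ 2) with hH
  have i7 : Integrable fun x => (6 + 2 * t ^ 2) * ((u x * (ζ x * w x)) ^ 2 / (1 + ‖x‖ ^ 2)) +
      2 * ‖gradient (fun y => u y * (ζ y * w y)) x‖ ^ 2 := (i5.const_mul _).add (i2.const_mul _)
  have iH : Integrable H := (i7.add i1).const_mul κ
  have hH0 : ∀ x, 0 ≤ H x := fun x => by
    have := mul_nonneg (hu0 x) (hS x)
    simp only [hH]
    positivity
  have hpt : ∀ x ∈ annulus N ρ, u x ^ 2 / ρ ^ 2 + ‖gradient u x‖ ^ 2 + u x * -lap u x ≤ H x := by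
    intro x hx
    have hxm := mem_annulus.1 hx
    have hb : 1 + ‖x‖ ^ 2 ≤ 6 * ρ ^ 2 := by
      have h2 : ‖x‖ ^ 2 ≤ (2 * ρ) ^ 2 := pow_le_pow_left₀ (norm_nonneg _) hxm.2 2
      nlinarith
    have hb0 := one_add_norm_sq_pos x
    have hk := hwκ x hx
    have e1 : gradient (fun y => u y * (ζ y * w y)) x = u x • gradient w x + w x • gradient u x := by
      rw [gradient_mul_eq hu1 hη, gradient_mul_eq hζ hw, hζe x hx, hζg x hx]
      simp
    have e2 : w x ^ 2 * ‖gradient u x‖ ^ 2 ≤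
        2 * ‖gradient (fun y => u y * (ζ y * w y)) x‖ ^ 2 +
          2 * t ^ 2 * ((u x * w x) ^ 2 / (1 + ‖x‖ ^ 2)) := by
      have h := norm_add_sq_le_young (gradient (fun y => u y * (ζ y * w y)) x)
        (-(u x • gradient w x)) one_pos
      rw [show gradient (fun y => u y * (ζ y * w y)) x + -(u x • gradient w x)
        = w x • gradient u x by rw [e1]; abel, norm_neg, norm_smul, norm_smul, mul_pow, mul_pow,
        Real.norm_eq_abs, Real.norm_eq_abs, sq_abs, sq_abs] at h
      have h' := mul_le_mul_of_nonneg_left (hwg x) (sq_nonneg (u x))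
      have h'' : u x ^ 2 * (t ^ 2 * (w x ^ 2 / (1 + ‖x‖ ^ 2)))
        = t ^ 2 * ((u x * w x) ^ 2 / (1 + ‖x‖ ^ 2)) := by ring
      norm_num at h
      linarith
    have e3 : w x ^ 2 * (u x ^ 2 / ρ ^ 2) ≤ 6 * ((u x * w x) ^ 2 / (1 + ‖x‖ ^ 2)) := by
      rw [← mul_div_assoc, ← mul_div_assoc, div_le_div_iff₀ (by positivity) hb0]
      nlinarith [mul_le_mul_of_nonneg_left hb (by positivity : 0 ≤ w x ^ 2 * u x ^ 2)]
    have e4 : 0 ≤ u x ^ 2 / ρ ^ 2 + ‖gradient u x‖ ^ 2 + u x * -lap u x := by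
      have := mul_nonneg (hu0 x) (hS x)
      positivity
    simp only [hH, hζe x hx, one_mul]
    calc _ ≤ (κ * w x ^ 2) * (u x ^ 2 / ρ ^ 2 + ‖gradient u x‖ ^ 2 + u x * -lap u x) :=
          le_mul_of_one_le_left e4 hk
      _ = κ * (w x ^ 2 * (u x ^ 2 / ρ ^ 2) + w x ^ 2 * ‖gradient u x‖ ^ 2
            + u x * -lap u x * w x ^ 2) := by ring
      _ ≤ _ := mul_le_mul_of_nonneg_left (by linarith) hκ.le
  have h1 := setIntegral_mono_on i6 iH.integrableOn (measurableSet_annulus ρ) hpt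
  have h2 := setIntegral_le_integral (s := annulus N ρ) iH (Eventually.of_forall hH0)
  refine (h1.trans h2).trans ?_
  simp only [hH]
  rw [integral_const_mul, integral_add i7 i1,
    integral_add (i5.const_mul _) (i2.const_mul _), integral_const_mul, integral_const_mul, mul_assoc]
  refine mul_le_mul_of_nonneg_left ?_ hκ.le
  set X := ∫ x, ‖gradient (fun y => u y * (ζ y * w y)) x‖ ^ 2
  have h9 : (∫ x, (u x * (ζ x * w x)) ^ 2 / (1 + ‖x‖ ^ 2)) ≤ 4 / ((N : ℝ) - 2) ^ 2 * X := by
    have : 0 < ((N : ℝ) - 2) ^ 2 := by apply pow_pos; linarith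
    rw [div_mul_eq_mul_div, le_div_iff₀ this]
    linarith
  have h10 := mul_le_mul_of_nonneg_left h9 (by positivity : 0 ≤ 6 + 2 * t ^ 2)
  have h11 : 0 ≤ ∫ x, u x ^ 2 * ‖gradient (fun y => ζ y * w y) x‖ ^ 2 :=
    integral_nonneg fun x => by positivity
  linarith

end AnnulusDecay

section AnnulusLimit

variable {N : ℕ}

theorem integral_weight_gradient_cutoff_le {u ζ : EuclideanSpace ℝ (Fin N) → ℝ}
    (hu : Continuous u) (hζ : ContDiff ℝ 1 ζ) (hζc : HasCompactSupport ζ) {C R₁ R t ρ : ℝ}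
    (hC : 0 < C) (hR : 0 < R) (ht : 0 ≤ t) (hρ : 0 < ρ)
    (hζg : ∀ x, ‖gradient ζ x‖ ≤ C * (Metric.closedBall 0 R₁).indicator 1 x
      + C / R * (annulus N R).indicator 1 x) :
    ∫ x, u x ^ 2 * annularWeight t ρ x ^ 2 * ‖gradient ζ x‖ ^ 2 ≤
      2 * C ^ 2 * ((1 + R₁ ^ 2) / ρ ^ 2) ^ t * (∫ x in Metric.closedBall 0 R₁, u x ^ 2) +
        2 * (C / R) ^ 2 * (ρ ^ 2 / R ^ 2) ^ t * ∫ x in annulus N R, u x ^ 2 := by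
  have hw := contDiff_annularWeight (N := N) t hρ
  have i1 : Integrable fun x => u x ^ 2 * annularWeight t ρ x ^ 2 * ‖gradient ζ x‖ ^ 2 :=
    integrable_of_vanishing (((hu.pow 2).mul (hw.continuous.pow 2)).mul
      (hζ.continuous_gradient.norm.pow 2)) hζc.gradient (by simp +contextual)
  have hB : MeasurableSet (Metric.closedBall (0 : EuclideanSpace ℝ (Fin N)) R₁) :=
    Metric.isClosed_closedBall.measurableSet
  have i2 : Integrable ((Metric.closedBall 0 R₁).indicator fun x => u x ^ 2) :=
    (integrable_indicator_iff hB).2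
      ((hu.pow 2).continuousOn.integrableOn_compact (isCompact_closedBall _ _))
  have i3 : Integrable ((annulus N R).indicator fun x => u x ^ 2) :=
    (integrable_indicator_iff (measurableSet_annulus R)).2
      ((hu.pow 2).continuousOn.integrableOn_compact (isCompact_annulus R))
  rw [← integral_indicator hB, ← integral_indicator (measurableSet_annulus R),
    ← integral_const_mul, ← integral_const_mul, ← integral_add (i2.const_mul _) (i3.const_mul _)]
  refine integral_mono i1 ((i2.const_mul _).add (i3.const_mul _)) fun x => ?_
  have h1 : ‖gradient ζ x‖ ^ 2 ≤ 2 * (C ^ 2 * (Metric.closedBall 0 R₁).indicator 1 x)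
      + 2 * ((C / R) ^ 2 * (annulus N R).indicator 1 x) := by
    refine (pow_le_pow_left₀ (norm_nonneg _) (hζg x) 2).trans ?_
    refine (add_sq_le (R := ℝ)).trans (le_of_eq ?_)
    have hpow : ∀ s : Set (EuclideanSpace ℝ (Fin N)),
        s.indicator (1 : EuclideanSpace ℝ (Fin N) → ℝ) x ^ 2 = s.indicator 1 x := by
      intro s
      by_cases hx : x ∈ s <;> simp [hx]
    rw [mul_pow, mul_pow, hpow, hpow]
    ring
  have h2 := mul_le_mul_of_nonneg_left h1
    (by positivity : 0 ≤ u x ^ 2 * annularWeight t ρ x ^ 2)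
  refine h2.trans ?_
  rw [mul_add]
  beta_reduce
  refine add_le_add ?_ ?_
  · by_cases hx : x ∈ Metric.closedBall (0 : EuclideanSpace ℝ (Fin N)) R₁
    · have hxn : ‖x‖ ≤ R₁ := by simpa using hx
      have h3 : annularWeight t ρ x ^ 2 ≤ ((1 + R₁ ^ 2) / ρ ^ 2) ^ t :=
        (annularWeight_sq_le_inner ht hρ x).trans (by gcongr)
      have h4 := mul_le_mul_of_nonneg_left h3 (by positivity : 0 ≤ 2 * C ^ 2 * u x ^ 2)
      simp only [Set.indicator_of_mem hx, Pi.one_apply]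
      linarith
    · simp [hx]
  · by_cases hx : x ∈ annulus N R
    · have hxn := (mem_annulus.1 hx).1
      have h3 : annularWeight t ρ x ^ 2 ≤ (ρ ^ 2 / R ^ 2) ^ t := by
        refine (annularWeight_sq_le_outer ht hρ x).trans ?_
        have : R ^ 2 ≤ 1 + ‖x‖ ^ 2 := by
          have := pow_le_pow_left₀ hR.le hxn 2
          linarith
        gcongr
      have h4 := mul_le_mul_of_nonneg_left h3 (by positivity : 0 ≤ 2 * (C / R) ^ 2 * u x ^ 2)
      simp only [Set.indicator_of_mem hx, Pi.one_apply]
      linarith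
    · simp [hx]

theorem tendsto_integral_mul_annularWeight_sq {g : EuclideanSpace ℝ (Fin N) → ℝ}
    (hg : Integrable g) {t : ℝ} (ht : 0 < t) :
    Tendsto (fun ρ : ℝ => ∫ x, g x * annularWeight t ρ x ^ 2) atTop (𝓝 0) := by
  rw [show (0 : ℝ) = ∫ _ : EuclideanSpace ℝ (Fin N), (0 : ℝ) by simp]
  refine tendsto_integral_filter_of_dominated_convergence (fun x => ‖g x‖) ?_ ?_ hg.norm ?_
  · filter_upwards [eventually_gt_atTop 0] with ρ hρ
    exact hg.aestronglyMeasurable.mul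
      ((contDiff_annularWeight t hρ).continuous.pow 2).aestronglyMeasurable
  · filter_upwards [eventually_gt_atTop 0] with ρ hρ
    refine Eventually.of_forall fun x => ?_
    rw [norm_mul, Real.norm_of_nonneg (sq_nonneg (annularWeight t ρ x))]
    exact mul_le_of_le_one_right (norm_nonneg _) (annularWeight_sq_le_one ht.le hρ x)
  · refine Eventually.of_forall fun x => ?_
    have h1 : Tendsto (fun ρ : ℝ => ((1 + ‖x‖ ^ 2) / ρ ^ 2) ^ t) atTop (𝓝 0) := by
      have := ((tendsto_pow_atTop (α := ℝ) two_ne_zero).const_div_atTop (1 + ‖x‖ ^ 2)).rpow_const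
        (p := t) (Or.inr ht.le)
      rwa [Real.zero_rpow ht.ne'] at this
    have h2 : Tendsto (fun ρ : ℝ => annularWeight t ρ x ^ 2) atTop (𝓝 0) := by
      refine squeeze_zero' (Eventually.of_forall fun ρ => sq_nonneg _) ?_ h1
      filter_upwards [eventually_gt_atTop 0] with ρ hρ using annularWeight_sq_le_inner ht.le hρ x
    simpa using h2.const_mul (g x)

theorem tendsto_energy_annulus (hN : 3 ≤ N) {K : Set (EuclideanSpace ℝ (Fin N))}
    (hK : IsCompact K) {u d : EuclideanSpace ℝ (Fin N) → ℝ} (hu : ContDiff ℝ 2 u)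
    (hu0 : ∀ x, 0 ≤ u x) (hS : ∀ x, 0 ≤ -lap u x) (hd : Continuous d) {μ A Q t : ℝ} (hμ : 0 ≤ μ)
    (hA : 0 ≤ A) (ht : 0 < t) (hμt : 4 * t ^ 2 / ((N : ℝ) - 2) ^ 2 < 1 - μ) (hQ : 2 ≤ Q)
    (hQt : N - 2 * N / Q < 2 + 2 * t)
    (hle : ∀ x, u x * -lap u x ≤ μ * (d x * u x ^ 2) + A * u x ^ Q)
    (hint : Integrable fun x => u x ^ Q)
    (hstab : ∀ η : EuclideanSpace ℝ (Fin N) → ℝ, ContDiff ℝ 1 η → HasCompactSupport η →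
      tsupport η ⊆ Kᶜ → ∫ x, d x * (u x * η x) ^ 2 ≤ ∫ x, ‖gradient (fun y => u y * η y) x‖ ^ 2) :
    Tendsto (fun ρ : ℝ => ∫ x in annulus N ρ,
      (u x ^ 2 / ρ ^ 2 + ‖gradient u x‖ ^ 2 + u x * -lap u x)) atTop (𝓝 0) := by
  have hNr : (3 : ℝ) ≤ N := by exact_mod_cast hN
  obtain ⟨C, R₁, hC, hR₁, hcut⟩ := exists_annular_cutoff hK
  obtain ⟨ν, hν, hδ⟩ : ∃ ν : ℝ, 0 < ν ∧
      0 < 1 - μ - (1 + ν) * t ^ 2 * (4 / ((N : ℝ) - 2) ^ 2) := by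
    set s := 4 * t ^ 2 / ((N : ℝ) - 2) ^ 2 with hs
    have hs0 : 0 ≤ s := by positivity
    refine ⟨(1 - μ - s) / (2 * (s + 1)), div_pos (by linarith) (by positivity), ?_⟩
    have e : (1 + (1 - μ - s) / (2 * (s + 1))) * t ^ 2 * (4 / ((N : ℝ) - 2) ^ 2)
        = s + (1 - μ - s) * (s / (2 * (s + 1))) := by rw [hs]; ring
    have h1 : s / (2 * (s + 1)) < 1 := by rw [div_lt_one (by positivity)]; linarith
    rw [e]
    nlinarith
  set δ := 1 - μ - (1 + ν) * t ^ 2 * (4 / ((N : ℝ) - 2) ^ 2)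
  set κ : ℝ := 36 ^ t with hκdef
  have hκ : 0 < κ := Real.rpow_pos_of_pos (by norm_num) _
  set B : ℝ := κ * ((6 + 2 * t ^ 2) * (4 / ((N : ℝ) - 2) ^ 2) + 3) with hB
  have hB0 : 0 ≤ B := by positivity
  set V := 2 ^ N * volume.real (Metric.ball (0 : EuclideanSpace ℝ (Fin N)) 1) + ∫ x, u x ^ Q
    with hV
  set U := ∫ x in Metric.closedBall (0 : EuclideanSpace ℝ (Fin N)) R₁, u x ^ 2
  set T : ℝ → ℝ := fun ρ : ℝ => ∫ x in annulus N ρ,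
      (u x ^ 2 / ρ ^ 2 + ‖gradient u x‖ ^ 2 + u x * -lap u x) with hT
  have hfin : ∀ ρ R : ℝ, R₁ < ρ → 2 * ρ < R → T ρ ≤ B * ((A * (∫ x, u x ^ Q * annularWeight t ρ x ^ 2)
      + (1 + 1 / ν) * (2 * C ^ 2 * ((1 + R₁ ^ 2) / ρ ^ 2) ^ t * U +
        2 * C ^ 2 * (ρ ^ 2) ^ t * V * R ^ (-(2 + 2 * t - (N - 2 * N / Q))))) / δ) := by
    intro ρ R hρ hR
    have hρ0 : 0 < ρ := by linarith
    have hR0 : 0 < R := by linarith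
    obtain ⟨ζ, hζ, hζc, hζK, hζ0, hζ1, hζe, hζg⟩ := hcut R (by linarith)
    have hw := contDiff_annularWeight (N := N) t hρ0
    have hwg := norm_gradient_annularWeight_sq_le (N := N) t hρ0
    have hann : ∀ x ∈ annulus N ρ, R₁ < ‖x‖ ∧ ‖x‖ < R := fun x hx => by
      have := mem_annulus.1 hx
      constructor <;> linarith
    have h1 := energy_annulus_le (t := t) (ρ := ρ) hN hu hu0 hS (by linarith) hκ hw
      (fun x hx => by
        have := mul_le_mul_of_nonneg_left (le_annularWeight_sq ht.le (by linarith) hx) hκ.le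
        rwa [hκdef, ← Real.mul_rpow (by norm_num) (by norm_num), mul_one_div_cancel (by norm_num),
          Real.one_rpow] at this)
      hwg hζ hζc
      (fun x hx => hζe x (hann x hx).1.le (hann x hx).2.le)
      (fun x hx => by
        have h := hζg x
        have h2 : x ∉ Metric.closedBall (0 : EuclideanSpace ℝ (Fin N)) R₁ := by
          simpa using (hann x hx).1
        have h3 : x ∉ annulus N R := fun h => by linarith [(mem_annulus.1 h).1, (hann x hx).2]
        rw [Set.indicator_of_notMem h2, Set.indicator_of_notMem h3] at h
        simpa using h)
    have hηK : tsupport (fun x => ζ x * annularWeight t ρ x) ⊆ Kᶜ :=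
      (tsupport_mul_subset_left).trans hζK
    have h2 := weighted_energy_le hN hu hu0 hd hμ hA hν hle hint hw
      (annularWeight_sq_le_one ht.le hρ0) hwg hζ hζc hζ0 hζ1
      (hstab _ (hζ.mul hw) hζc.mul_right hηK)
    have h3 := integral_weight_gradient_cutoff_le hu.continuous hζ hζc hC hR0 ht.le hρ0 hζg
    have h4 := integral_annulus_sq_le hu.continuous hu0 hQ hint hR0
    have h5 : 2 * (C / R) ^ 2 * (ρ ^ 2 / R ^ 2) ^ t * ∫ x in annulus N R, u x ^ 2 ≤
        2 * C ^ 2 * (ρ ^ 2) ^ t * V * R ^ (-(2 + 2 * t - (N - 2 * N / Q))) := by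
      refine (mul_le_mul_of_nonneg_left h4 (by positivity)).trans_eq ?_
      rw [← hV, neg_sub, Real.rpow_sub hR0 (N - 2 * N / Q), Real.rpow_add hR0, Real.rpow_mul hR0.le,
        Real.rpow_two, Real.div_rpow (by positivity) (by positivity)]
      field_simp
    refine h1.trans (mul_le_mul_of_nonneg_left ?_ hB0)
    rw [le_div_iff₀ hδ, mul_comm]
    refine h2.trans (add_le_add le_rfl (mul_le_mul_of_nonneg_left ?_ (by positivity)))
    exact h3.trans (add_le_add le_rfl h5)
  have hlim : ∀ ρ : ℝ, R₁ < ρ → T ρ ≤ B * ((A * (∫ x, u x ^ Q * annularWeight t ρ x ^ 2)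
      + (1 + 1 / ν) * (2 * C ^ 2 * ((1 + R₁ ^ 2) / ρ ^ 2) ^ t * U)) / δ) := by
    intro ρ hρ
    have hR : Tendsto (fun R : ℝ => R ^ (-(2 + 2 * t - (N - 2 * N / Q)))) atTop (𝓝 0) :=
      tendsto_rpow_neg_atTop (by linarith)
    have h := (((((hR.const_mul (2 * C ^ 2 * (ρ ^ 2) ^ t * V)).const_add
      (2 * C ^ 2 * ((1 + R₁ ^ 2) / ρ ^ 2) ^ t * U)).const_mul (1 + 1 / ν)).const_add
      (A * (∫ x, u x ^ Q * annularWeight t ρ x ^ 2))).div_const δ).const_mul B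
    rw [mul_zero, add_zero] at h
    refine ge_of_tendsto h ?_
    filter_upwards [eventually_gt_atTop (2 * ρ)] with R hR' using hfin ρ R hρ hR'
  have hz : Tendsto (fun ρ : ℝ => ((1 + R₁ ^ 2) / ρ ^ 2) ^ t) atTop (𝓝 0) := by
    have := ((tendsto_pow_atTop (α := ℝ) two_ne_zero).const_div_atTop (1 + R₁ ^ 2)).rpow_const
      (p := t) (Or.inr ht.le)
    rwa [Real.zero_rpow ht.ne'] at this
  have hmaj := (((((tendsto_integral_mul_annularWeight_sq hint ht).const_mul A).add
    (((hz.const_mul (2 * C ^ 2)).mul_const U).const_mul (1 + 1 / ν))).div_const δ).const_mul B)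
  simp only [mul_zero, zero_mul, add_zero, zero_div] at hmaj
  refine squeeze_zero' (Eventually.of_forall fun ρ => ?_) ?_ hmaj
  · refine integral_nonneg fun x => ?_
    have := mul_nonneg (hu0 x) (hS x)
    positivity
  · filter_upwards [eventually_gt_atTop R₁] with ρ hρ using hlim ρ hρ

end AnnulusLimit

section Pohozaev

variable {N : ℕ}

theorem pohozaev_identity {u θ : EuclideanSpace ℝ (Fin N) → ℝ} (hu : ContDiff ℝ 2 u)
    {f F : ℝ → ℝ} (hF : ∀ t, HasDerivAt F (f t) t) (hf : Continuous f)
    (hsol : ∀ x, -lap u x = f (u x)) (hθ : ContDiff ℝ 1 θ) (hθc : HasCompactSupport θ) :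
    ((N : ℝ) / 2 - 1) * (∫ x, θ x * ‖gradient u x‖ ^ 2) - N * ∫ x, θ x * F (u x) =
      ∫ x, (inner ℝ x (gradient u x) * inner ℝ (gradient u x) (gradient θ x) -
        (‖gradient u x‖ ^ 2 / 2 - F (u x)) * inner ℝ x (gradient θ x)) := by
  have hu1 : ContDiff ℝ 1 u := hu.of_le (by norm_num)
  have hG := hu.gradient_contDiff
  have hFu : ContDiff ℝ 1 fun x => F (u x) := (contDiff_one_of_hasDerivAt hF hf).comp hu1
  have hxG : ContDiff ℝ 1 fun x => inner ℝ x (gradient u x) := contDiff_id.inner ℝ hG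
  have hGG : ContDiff ℝ 1 fun x => inner ℝ (gradient u x) (gradient u x) := hG.inner ℝ hG
  have hE : ContDiff ℝ 1 fun x => inner ℝ (gradient u x) (gradient u x) / 2 - F (u x) :=
    (hGG.div_const 2).sub hFu
  have hGd : ∀ x, DifferentiableAt ℝ (gradient u) x := fun x => hG.differentiable (by simp) x
  have e1 := integral_inner_gradient hu (hxG.mul hθ) hθc.mul_left
  have e2 := integral_inner_self_gradient (hE.mul hθ) hθc.mul_left
  have p1 : ∀ x, inner ℝ (gradient u x) (gradient (fun x => inner ℝ x (gradient u x) * θ x) x) =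
      inner ℝ x (gradient u x) * inner ℝ (gradient u x) (gradient θ x) + θ x * ‖gradient u x‖ ^ 2
        + θ x * inner ℝ (fderiv ℝ (gradient u) x (gradient u x)) x := by
    intro x
    have h : inner ℝ (gradient u x) (gradient (fun x => inner ℝ x (gradient u x)) x) =
        inner ℝ (fderiv ℝ (gradient u) x (gradient u x)) x + ‖gradient u x‖ ^ 2 := by
      rw [real_inner_comm, inner_gradient_left, fderiv_inner_apply ℝ differentiableAt_fun_id (hGd x),
        real_inner_comm, ← real_inner_self_eq_norm_sq]
      simp
    rw [gradient_mul_eq hxG hθ, inner_add_right, inner_smul_right, inner_smul_right, h]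
    ring
  have p2 : ∀ x, inner ℝ x
      (gradient (fun x => (inner ℝ (gradient u x) (gradient u x) / 2 - F (u x)) * θ x) x) =
      (‖gradient u x‖ ^ 2 / 2 - F (u x)) * inner ℝ x (gradient θ x) +
        θ x * inner ℝ (fderiv ℝ (gradient u) x (gradient u x)) x
        - -lap u x * (inner ℝ x (gradient u x) * θ x) := by
    intro x
    have h : inner ℝ x
        (gradient (fun x => inner ℝ (gradient u x) (gradient u x) / 2 - F (u x)) x) =
        inner ℝ (fderiv ℝ (gradient u) x (gradient u x)) x - -lap u x * inner ℝ x (gradient u x) := by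
      have hd : HasFDerivAt (fun x => inner ℝ (gradient u x) (gradient u x) / 2 - F (u x)) _ x :=
        (((hGd x).hasFDerivAt.inner ℝ (hGd x).hasFDerivAt).mul_const (2⁻¹ : ℝ)).sub
          ((hF (u x)).comp_hasFDerivAt x (hu1.differentiable (by simp) x).hasFDerivAt)
      rw [real_inner_comm, inner_gradient_left, hd.fderiv, inner_fderiv_gradient_comm hu x _ x]
      simp only [sub_apply, smul_apply,
        ContinuousLinearMap.comp_apply, ContinuousLinearMap.prod_apply, fderivInnerCLM_apply,
        smul_eq_mul, hsol, real_inner_comm x, ← inner_gradient_left]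
      rw [real_inner_comm (fderiv ℝ (gradient u) x x) (gradient u x)]
      ring
    rw [gradient_mul_eq hE hθ, inner_add_right, inner_smul_right, inner_smul_right, h,
      real_inner_self_eq_norm_sq]
    ring
  simp_rw [p1] at e1
  simp_rw [p2, real_inner_self_eq_norm_sq] at e2
  have cG := hu1.continuous_gradient
  have cθ := hθ.continuous_gradient
  have cF := hFu.continuous
  have cL := continuous_lap hu
  have cD : Continuous fun x => fderiv ℝ (gradient u) x (gradient u x) :=
    (hG.continuous_fderiv (by simp)).clm_apply cG
  have i1 : Integrable fun x => inner ℝ x (gradient u x) * inner ℝ (gradient u x) (gradient θ x) :=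
    integrable_of_vanishing (by fun_prop) hθc.gradient (by simp +contextual)
  have i2 : Integrable fun x => θ x * ‖gradient u x‖ ^ 2 :=
    integrable_of_vanishing (by fun_prop) hθc (by simp +contextual)
  have i3 : Integrable fun x => θ x * inner ℝ (fderiv ℝ (gradient u) x (gradient u x)) x :=
    integrable_of_vanishing (by fun_prop) hθc (by simp +contextual)
  have i4 : Integrable fun x => (‖gradient u x‖ ^ 2 / 2 - F (u x)) * inner ℝ x (gradient θ x) :=
    integrable_of_vanishing ((((cG.norm.pow 2).div_const 2).sub cF).mul (continuous_id.inner cθ)) hθc.gradient (by simp +contextual)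
  have i5 : Integrable fun x => -lap u x * (inner ℝ x (gradient u x) * θ x) :=
    integrable_of_vanishing (by fun_prop) hθc (by simp +contextual)
  have i6 : Integrable fun x => θ x * F (u x) :=
    integrable_of_vanishing (hθ.continuous.mul cF) hθc (by simp +contextual)
  have s1 : ∫ x, (‖gradient u x‖ ^ 2 / 2 - F (u x)) * θ x =
      (∫ x, θ x * ‖gradient u x‖ ^ 2) / 2 - ∫ x, θ x * F (u x) := by
    rw [← integral_div, ← integral_sub (i2.div_const 2) i6]
    congr 1
    ext x
    ring
  have i12 : Integrable fun x => inner ℝ x (gradient u x) * inner ℝ (gradient u x) (gradient θ x) +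
    θ x * ‖gradient u x‖ ^ 2 := i1.add i2
  have i43 : Integrable fun x => (‖gradient u x‖ ^ 2 / 2 - F (u x)) * inner ℝ x (gradient θ x) +
    θ x * inner ℝ (fderiv ℝ (gradient u) x (gradient u x)) x := i4.add i3
  rw [integral_add i12 i3, integral_add i1 i2] at e1
  rw [integral_sub i43 i5, integral_add i4 i3, s1] at e2
  rw [integral_sub i1 i4]
  linarith

theorem integral_cutoff_source_le (hN : 3 ≤ N) {u θ : EuclideanSpace ℝ (Fin N) → ℝ}
    (hu : ContDiff ℝ 2 u) (hu0 : ∀ x, 0 ≤ u x)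
    {f F : ℝ → ℝ} (hF : ∀ t, HasDerivAt F (f t) t) (hf : Continuous f)
    (hsol : ∀ x, -lap u x = f (u x)) (hF0 : ∀ x, 0 ≤ F (u x)) {p : ℝ}
    (hp : 0 ≤ p) (hFp : ∀ x, (p + 1) * F (u x) ≤ u x * f (u x)) (hθ : ContDiff ℝ 1 θ)
    (hθc : HasCompactSupport θ) (hθ0 : ∀ x, 0 ≤ θ x) {C R : ℝ} (hC : 0 < C) (hR : 0 < R)
    (hθg : ∀ x, ‖gradient θ x‖ ≤ C / R * (annulus N R).indicator 1 x) :
    ((N : ℝ) / 2 - 1 - N / (p + 1)) * ∫ x, u x * -lap u x * θ x ≤ C * (N + 3) *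
      ∫ x in annulus N R, (u x ^ 2 / R ^ 2 + ‖gradient u x‖ ^ 2 + u x * -lap u x) := by
  have hNr : (3 : ℝ) ≤ N := by exact_mod_cast hN
  have hu1 : ContDiff ℝ 1 u := hu.of_le (by norm_num)
  have hFu : ContDiff ℝ 1 fun x => F (u x) := (contDiff_one_of_hasDerivAt hF hf).comp hu1
  have e1 := pohozaev_identity hu hF hf hsol hθ hθc
  have e2 := integral_inner_gradient hu (hu1.mul hθ) hθc.mul_left
  have p2 : ∀ x, inner ℝ (gradient u x) (gradient (fun x => u x * θ x) x) =
      u x * inner ℝ (gradient u x) (gradient θ x) + θ x * ‖gradient u x‖ ^ 2 := by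
    intro x
    rw [gradient_mul_eq hu1 hθ, inner_add_right, inner_smul_right, inner_smul_right,
      real_inner_self_eq_norm_sq]
  simp_rw [p2] at e2
  have cu := hu.continuous
  have cG := hu1.continuous_gradient
  have cθ := hθ.continuous_gradient
  have cF := hFu.continuous
  have cL := continuous_lap hu
  have i1 : Integrable fun x => u x * inner ℝ (gradient u x) (gradient θ x) :=
    integrable_of_vanishing (by fun_prop) hθc.gradient (by simp +contextual)
  have i2 : Integrable fun x => θ x * ‖gradient u x‖ ^ 2 :=
    integrable_of_vanishing (by fun_prop) hθc (by simp +contextual)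
  have i3 : Integrable fun x => inner ℝ x (gradient u x) * inner ℝ (gradient u x) (gradient θ x) -
        (‖gradient u x‖ ^ 2 / 2 - F (u x)) * inner ℝ x (gradient θ x) :=
    integrable_of_vanishing (((continuous_id.inner cG).mul (cG.inner cθ)).sub
      ((((cG.norm.pow 2).div_const 2).sub cF).mul (continuous_id.inner cθ))) hθc.gradient (by simp +contextual)
  have i4 : Integrable fun x => θ x * F (u x) :=
    integrable_of_vanishing (hθ.continuous.mul cF) hθc (by simp +contextual)
  have i5 : Integrable fun x => u x * -lap u x * θ x :=
    integrable_of_vanishing (by fun_prop) hθc (by simp +contextual)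
  have i6 : Integrable ((annulus N R).indicator fun x =>
      u x ^ 2 / R ^ 2 + ‖gradient u x‖ ^ 2 + u x * -lap u x) :=
    (integrable_indicator_iff (measurableSet_annulus R)).2
      ((by fun_prop : Continuous fun x => u x ^ 2 / R ^ 2 + ‖gradient u x‖ ^ 2 +
        u x * -lap u x).continuousOn.integrableOn_compact (isCompact_annulus R))
  rw [integral_add i1 i2] at e2
  have e3 : ∫ x, -lap u x * (u x * θ x) = ∫ x, u x * -lap u x * θ x := by
    congr 1; ext x; ring
  rw [e3] at e2
  have h1 : N * ∫ x, θ x * F (u x) ≤ N / (p + 1) * ∫ x, u x * -lap u x * θ x := by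
    rw [← integral_const_mul, ← integral_const_mul]
    refine integral_mono (i4.const_mul _) (i5.const_mul _) fun x => ?_
    have h := mul_le_mul_of_nonneg_left (hFp x) (mul_nonneg (Nat.cast_nonneg N) (hθ0 x))
    beta_reduce
    rw [div_mul_eq_mul_div, le_div_iff₀ (by linarith), hsol]
    linarith
  have h2 : (∫ x, (inner ℝ x (gradient u x) * inner ℝ (gradient u x) (gradient θ x) -
        (‖gradient u x‖ ^ 2 / 2 - F (u x)) * inner ℝ x (gradient θ x))) +
      ((N : ℝ) / 2 - 1) * ∫ x, u x * inner ℝ (gradient u x) (gradient θ x) ≤ C * (N + 3) *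
      ∫ x in annulus N R, (u x ^ 2 / R ^ 2 + ‖gradient u x‖ ^ 2 + u x * -lap u x) := by
    rw [← integral_indicator (measurableSet_annulus R), ← integral_const_mul, ← integral_const_mul,
      ← integral_add i3 (i1.const_mul _)]
    refine integral_mono (i3.add (i1.const_mul _)) (i6.const_mul _) fun x => ?_
    beta_reduce
    have hg := hθg x
    by_cases hx : x ∈ annulus N R
    · have hxm := mem_annulus.1 hx
      simp only [Set.indicator_of_mem hx, Pi.one_apply, mul_one] at hg ⊢
      set G := ‖gradient u x‖
      set k := ‖gradient θ x‖
      have hG0 : 0 ≤ G := norm_nonneg _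
      have hk0 : 0 ≤ k := norm_nonneg _
      have hxk : ‖x‖ * k ≤ 2 * C := by
        calc ‖x‖ * k ≤ (2 * R) * (C / R) := by gcongr; exact hxm.2
          _ = 2 * C := by field_simp
      have a1 : |inner ℝ x (gradient u x)| ≤ ‖x‖ * G := abs_real_inner_le_norm _ _
      have a2 : |inner ℝ (gradient u x) (gradient θ x)| ≤ G * k := abs_real_inner_le_norm _ _
      have a3 : |inner ℝ x (gradient θ x)| ≤ ‖x‖ * k := abs_real_inner_le_norm _ _
      have b1 : inner ℝ x (gradient u x) * inner ℝ (gradient u x) (gradient θ x) ≤ 2 * C * G ^ 2 :=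
        calc _ ≤ |inner ℝ x (gradient u x)| * |inner ℝ (gradient u x) (gradient θ x)| := by
              rw [← abs_mul]; exact le_abs_self _
          _ ≤ (‖x‖ * G) * (G * k) := mul_le_mul a1 a2 (abs_nonneg _) (by positivity)
          _ = ‖x‖ * k * G ^ 2 := by ring
          _ ≤ _ := by gcongr
      have b2 : -((G ^ 2 / 2 - F (u x)) * inner ℝ x (gradient θ x)) ≤
          (G ^ 2 / 2 + F (u x)) * (2 * C) :=
        calc _ ≤ |G ^ 2 / 2 - F (u x)| * |inner ℝ x (gradient θ x)| := by
              rw [← abs_mul]; exact neg_le_abs _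
          _ ≤ (G ^ 2 / 2 + F (u x)) * (‖x‖ * k) := by
              refine mul_le_mul ?_ a3 (abs_nonneg _) (by have := hF0 x; positivity)
              rw [abs_le]
              constructor <;> nlinarith [hF0 x, sq_nonneg G]
          _ ≤ _ := by have := hF0 x; gcongr
      have b3 : u x * inner ℝ (gradient u x) (gradient θ x) ≤ C / 2 * (u x ^ 2 / R ^ 2 + G ^ 2) :=
        calc _ ≤ u x * (G * k) :=
              mul_le_mul_of_nonneg_left ((le_abs_self _).trans a2) (hu0 x)
          _ ≤ u x * (G * (C / R)) := by have := hu0 x; gcongr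
          _ = C / 2 * (2 * (u x / R) * G) := by field_simp
          _ ≤ C / 2 * ((u x / R) ^ 2 + G ^ 2) := by gcongr; exact two_mul_le_add_sq _ _
          _ = _ := by rw [div_pow]
      have b4 : F (u x) ≤ u x * -lap u x := by
        rw [hsol]
        nlinarith [hFp x, mul_nonneg hp (hF0 x)]
      have b5 := mul_le_mul_of_nonneg_left b3 (by linarith : 0 ≤ (N : ℝ) / 2 - 1)
      have b6 : 0 ≤ u x ^ 2 / R ^ 2 := by positivity
      have b7 := mul_le_mul_of_nonneg_left b4 hC.le
      have b8 : 0 ≤ u x * -lap u x := (hF0 x).trans b4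
      have c1 : 0 ≤ C * (u x ^ 2 / R ^ 2) := by positivity
      have c2 : 0 ≤ C * G ^ 2 := by positivity
      have c3 : 0 ≤ C * (u x * -lap u x) := by positivity
      have c4 := mul_le_mul_of_nonneg_left hNr c1
      have c5 := mul_le_mul_of_nonneg_left hNr c2
      have c6 := mul_le_mul_of_nonneg_left hNr c3
      linarith
    · simp only [Set.indicator_of_notMem hx, mul_zero, norm_le_zero_iff] at hg ⊢
      simp [hg]
  have e4 : ∫ x, θ x * ‖gradient u x‖ ^ 2 =
      (∫ x, u x * -lap u x * θ x) - ∫ x, u x * inner ℝ (gradient u x) (gradient θ x) := by linarith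
  rw [e4] at e1
  linarith

theorem mul_source_eq_zero_of_tendsto (hN : 3 ≤ N) {u : EuclideanSpace ℝ (Fin N) → ℝ}
    (hu : ContDiff ℝ 2 u) (hu0 : ∀ x, 0 ≤ u x)
    {f F : ℝ → ℝ} (hF : ∀ t, HasDerivAt F (f t) t) (hf : Continuous f)
    (hsol : ∀ x, -lap u x = f (u x)) (hf0 : ∀ x, 0 ≤ f (u x)) (hF0 : ∀ x, 0 ≤ F (u x)) {p : ℝ}
    (hp : ((N : ℝ) + 2) / (N - 2) < p) (hFp : ∀ x, (p + 1) * F (u x) ≤ u x * f (u x))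
    (hT : Tendsto (fun ρ : ℝ => ∫ x in annulus N ρ,
      (u x ^ 2 / ρ ^ 2 + ‖gradient u x‖ ^ 2 + u x * -lap u x)) atTop (𝓝 0))
    (x : EuclideanSpace ℝ (Fin N)) : u x * f (u x) = 0 := by
  have hNr : (3 : ℝ) ≤ N := by exact_mod_cast hN
  have hp0 : 0 ≤ p := le_trans (div_nonneg (by linarith) (by linarith)) hp.le
  have hκ : 0 < (N : ℝ) / 2 - 1 - N / (p + 1) := by
    rw [div_lt_iff₀ (by linarith)] at hp
    have : N / (p + 1) < (N : ℝ) / 2 - 1 := by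
      rw [div_lt_iff₀ (by linarith)]
      linarith
    linarith
  obtain ⟨C, hC, hcut⟩ := exists_ball_cutoff N
  have huf : ∀ y, 0 ≤ u y * -lap u y := fun y => by
    rw [hsol]; exact mul_nonneg (hu0 y) (hf0 y)
  have cuf : Continuous fun y => u y * -lap u y := hu.continuous.mul (continuous_lap hu).neg
  by_contra hne
  have hx : 0 < ‖x‖ + 1 := by positivity
  obtain ⟨χ, hχ, hχc, hχ0, hχ1, hχe, hχz, -⟩ := hcut (‖x‖ + 1) hx
  have hle : ∀ R : ℝ, 2 * (‖x‖ + 1) ≤ R → ∫ y, u y * -lap u y * χ y ≤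
      (C * (N + 3) * ∫ x in annulus N R,
        (u x ^ 2 / R ^ 2 + ‖gradient u x‖ ^ 2 + u x * -lap u x)) /
        ((N : ℝ) / 2 - 1 - N / (p + 1)) := by
    intro R hR
    obtain ⟨θ, hθ, hθc, hθ0, hθ1, hθe, hθz, hθg⟩ := hcut R (by linarith)
    have h1 := integral_cutoff_source_le hN hu hu0 hF hf hsol hF0 hp0 hFp hθ hθc hθ0 hC
      (by linarith) hθg
    rw [le_div_iff₀ hκ, mul_comm]
    refine le_trans (mul_le_mul_of_nonneg_left (integral_mono ?_ ?_ fun y => ?_) hκ.le) h1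
    · exact integrable_of_vanishing (cuf.mul hχ.continuous) hχc (by simp +contextual)
    · exact integrable_of_vanishing (cuf.mul hθ.continuous) hθc (by simp +contextual)
    · refine mul_le_mul_of_nonneg_left ?_ (huf y)
      rcases le_total (2 * (‖x‖ + 1)) ‖y‖ with hy | hy
      · rw [hχz y hy]; exact hθ0 y
      · rw [hθe y (hy.trans hR)]; exact hχ1 y
  have h0 : ∫ y, u y * -lap u y * χ y ≤ 0 := by
    have h := (hT.const_mul (C * (N + 3))).div_const ((N : ℝ) / 2 - 1 - N / (p + 1))
    rw [mul_zero, zero_div] at h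
    refine ge_of_tendsto h ?_
    filter_upwards [eventually_ge_atTop (2 * (‖x‖ + 1))] with R hR using hle R hR
  have cχ : Continuous fun y => u y * -lap u y * χ y := cuf.mul hχ.continuous
  have hpos := cχ.integral_pos_of_hasCompactSupport_nonneg_nonzero
    (μ := volume) hχc.mul_left (fun y => mul_nonneg (huf y) (hχ0 y)) (x := x) (by
      rwa [hχe x (by linarith), mul_one, hsol])
  linarith

end Pohozaev

section TestFunctions

theorem continuous_of_tendsto_zero {g : ℝ → ℝ} (hg : ContinuousOn g (Set.Ioi 0))
    (h0 : ∀ t ≤ 0, g t = 0) (hT : Tendsto g (𝓝[>] 0) (𝓝 0)) : Continuous g := by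
  rw [continuous_iff_continuousAt]
  intro t
  rcases lt_trichotomy t 0 with ht | rfl | ht
  · refine continuousAt_const.congr (f := fun _ => (0 : ℝ)) ?_
    filter_upwards [Iio_mem_nhds ht] with s hs using (h0 s (le_of_lt hs)).symm
  · rw [continuousAt_iff_continuous_left'_right']
    constructor
    · rw [ContinuousWithinAt, h0 0 le_rfl]
      refine tendsto_const_nhds.congr' ?_
      filter_upwards [self_mem_nhdsWithin] with s hs using (h0 s (le_of_lt hs)).symm
    · rwa [ContinuousWithinAt, h0 0 le_rfl]
  · exact hg.continuousAt (Ioi_mem_nhds ht)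

theorem hasDerivAt_of_continuous_of_pos {g g' : ℝ → ℝ} (hg : Continuous g) (hg' : Continuous g')
    (h0 : ∀ t ≤ 0, g t = 0) (h0' : ∀ t ≤ 0, g' t = 0) (hd : ∀ t, 0 < t → HasDerivAt g (g' t) t)
    (t : ℝ) : HasDerivAt g (g' t) t := by
  have hne : ∀ s, s ≠ 0 → HasDerivAt g (g' s) s := fun s hs => by
    rcases lt_or_gt_of_ne hs with h | h
    · rw [h0' s h.le]
      refine (hasDerivAt_const s (0 : ℝ)).congr_of_eventuallyEq ?_
      filter_upwards [Iio_mem_nhds h] with y hy using h0 y (le_of_lt hy)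
    · exact hd s h
  rcases eq_or_ne t 0 with rfl | ht
  · exact hasDerivAt_of_hasDerivAt_of_ne hne hg.continuousAt hg'.continuousAt
  · exact hne t ht

theorem tendsto_zero_of_le_rpow {g : ℝ → ℝ} {A a M : ℝ} (ha : 0 < a) (hM : 0 < M)
    (h : ∀ t ∈ Set.Ioc 0 M, 0 ≤ g t ∧ g t ≤ A * t ^ a) : Tendsto g (𝓝[>] 0) (𝓝 0) := by
  have hc : Tendsto (fun t : ℝ => A * t ^ a) (𝓝[>] 0) (𝓝 0) := by
    have := ((Real.continuousAt_rpow_const 0 a (Or.inr ha.le)).const_mul A).tendsto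
    simp only [Real.zero_rpow ha.ne', mul_zero] at this
    exact this.mono_left nhdsWithin_le_nhds
  refine squeeze_zero' ?_ ?_ hc <;>
    filter_upwards [Ioc_mem_nhdsGT hM] with t ht
  exacts [(h t ht).1, (h t ht).2]

/-- A `C¹` function equal to `y + 1 + o(1)` at `-∞` and vanishing on `[0, ∞)`. -/
noncomputable def softMin (y : ℝ) : ℝ := min y 0 - Real.exp (min y 0) + 1

theorem hasDerivAt_softMin (y : ℝ) : HasDerivAt softMin (1 - Real.exp (min y 0)) y := by
  have hne : ∀ y, y ≠ 0 → HasDerivAt softMin (1 - Real.exp (min y 0)) y := fun y hy => by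
    rcases lt_or_gt_of_ne hy with h | h
    · rw [min_eq_left h.le]
      refine (((hasDerivAt_id y).sub (Real.hasDerivAt_exp y)).add_const 1).congr_of_eventuallyEq ?_
      filter_upwards [Iio_mem_nhds h] with s hs
      simp [softMin, min_eq_left (Set.mem_Iio.1 hs).le]
    · rw [min_eq_right h.le, Real.exp_zero, sub_self]
      refine (hasDerivAt_const y (0 : ℝ)).congr_of_eventuallyEq ?_
      filter_upwards [Ioi_mem_nhds h] with s hs
      simp [softMin, min_eq_right (Set.mem_Ioi.1 hs).le]
  rcases eq_or_ne y 0 with rfl | hy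
  · exact hasDerivAt_of_hasDerivAt_of_ne (g := fun y => 1 - Real.exp (min y 0)) hne
      (by unfold softMin; fun_prop) (by fun_prop)
  · exact hne y hy

theorem abs_softMin_sub_le (y : ℝ) : |softMin y - y| ≤ 1 + max y 0 := by
  have h1 : Real.exp (min y 0) ≤ 1 := Real.exp_le_one_iff.2 (min_le_right _ _)
  have h2 := Real.exp_pos (min y 0)
  have h3 := min_add_max y 0
  have h4 := le_max_right y 0
  rw [abs_le, softMin]
  constructor <;> linarith

theorem mem_Icc_of_abs_log_sub_le {x y B : ℝ} (hx : 0 < x) (hy : 0 < y)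
    (h : |Real.log x - Real.log y| ≤ B) : x ∈ Set.Icc (Real.exp (-B) * y) (Real.exp B * y) := by
  rw [abs_le] at h
  constructor
  · rw [← Real.log_le_log_iff (by positivity) hx, Real.log_mul (by positivity) hy.ne', Real.log_exp]
    linarith
  · rw [← Real.log_le_log_iff hx (by positivity), Real.log_mul (by positivity) hy.ne', Real.log_exp]
    linarith

variable {f f1 f2 : ℝ → ℝ} {p : ℝ}

/-- For `f` behaving like a power `t ^ p` near zero, a function behaving like `f ^ l` near zero and
proportional to `f` on `[δ, ∞)`, together with its derivative. -/
theorem exists_interpolated_power (hf : ∀ t, 0 < t → HasDerivAt f (f1 t) t)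
    (hf1 : ContinuousOn f1 (Set.Ioi 0)) (hpos : ∀ t, 0 < t → 0 < f t)
    (hmono : MonotoneOn f (Set.Ioi 0))
    {l c C M δ : ℝ} (hl : 0 < l) (hlp : 1 < l * p) (hc : 0 < c) (hM : 0 < M)
    (hδ : 0 < δ) (hlow : ∀ t ∈ Set.Ioc 0 M, c * t ^ p ≤ f t)
    (hupp : ∀ t ∈ Set.Ioc 0 M, f1 t ≤ C * t ^ (p - 1)) (htf : ∀ t, 0 < t → f t ≤ t * f1 t) :
    ∃ ψ ψ' L : ℝ → ℝ, (∀ t, HasDerivAt ψ (ψ' t) t) ∧ Continuous ψ' ∧ (∀ t ≤ 0, ψ t = 0) ∧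
      (∀ t, 0 < t → 0 < ψ t ∧ ψ' t = ψ t * (f1 t / f t) * L t) ∧
      (∀ t, |L t - 1| ≤ |l - 1| ∧ min 1 l ≤ L t) ∧ (∀ t, δ ≤ t → L t = 1) ∧
      ∃ a > 0, ∃ A > 0, ∀ t ∈ Set.Ioc 0 M, a * t ^ (l * p) ≤ ψ t ∧ ψ t ≤ A * t ^ (l * p) ∧
        a * t ^ (l * p - 1) ≤ ψ' t ∧ ψ' t ≤ A * t ^ (l * p - 1) := by
  set y : ℝ → ℝ := fun t => Real.log (f t) - Real.log (f δ) with hy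
  set L : ℝ → ℝ := fun t => 1 + (l - 1) * (1 - Real.exp (min (y t) 0)) with hL
  set ψ : ℝ → ℝ := fun t =>
    if 0 < t then Real.exp (Real.log (f t) + (l - 1) * softMin (y t)) else 0 with hψ
  set ψ' : ℝ → ℝ := fun t => if 0 < t then ψ t * (f1 t / f t) * L t else 0 with hψ'
  have hfc : ContinuousOn f (Set.Ioi 0) := fun t ht => (hf t ht).continuousAt.continuousWithinAt
  have hyc : ContinuousOn y (Set.Ioi 0) :=
    (hfc.log fun t ht => (hpos t ht).ne').sub continuousOn_const
  have hLc : ContinuousOn L (Set.Ioi 0) := by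
    refine continuousOn_const.add (continuousOn_const.mul (continuousOn_const.sub ?_))
    exact (by fun_prop : Continuous fun s : ℝ => Real.exp (min s 0)).comp_continuousOn hyc
  have hψp : ∀ t, 0 < t → ψ t = Real.exp (Real.log (f t) + (l - 1) * softMin (y t)) :=
    fun t ht => if_pos ht
  have hψ'p : ∀ t, 0 < t → ψ' t = ψ t * (f1 t / f t) * L t := fun t ht => if_pos ht
  have hψ0 : ∀ t, 0 < t → 0 < ψ t := fun t ht => by rw [hψp t ht]; exact Real.exp_pos _
  have hψn : ∀ t ≤ 0, ψ t = 0 := fun t ht => if_neg ht.not_gt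
  have hψ'n : ∀ t ≤ 0, ψ' t = 0 := fun t ht => if_neg ht.not_gt
  have hLb : ∀ t, |L t - 1| ≤ |l - 1| ∧ min 1 l ≤ L t := fun t => by
    have h1 : Real.exp (min (y t) 0) ≤ 1 := Real.exp_le_one_iff.2 (min_le_right _ _)
    have h2 := Real.exp_pos (min (y t) 0)
    constructor
    · rw [hL, add_sub_cancel_left, abs_mul, abs_of_nonneg (by linarith : 0 ≤ 1 - Real.exp _)]
      exact mul_le_of_le_one_right (abs_nonneg _) (by linarith)
    · rcases le_total 1 l with h | h
      · rw [min_eq_left h]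
        have := mul_nonneg (sub_nonneg.2 h) (sub_nonneg.2 h1)
        simp only [hL]; linarith
      · rw [min_eq_right h]
        have := mul_nonneg (sub_nonneg.2 h) h2.le
        simp only [hL]; linarith
  have hψd : ∀ t, 0 < t → HasDerivAt ψ (ψ' t) t := fun t ht => by
    have hlog := (hf t ht).log (hpos t ht).ne'
    have hs := (hasDerivAt_softMin (y t)).comp t (hlog.sub_const (Real.log (f δ)))
    have he := (hlog.add (hs.const_mul (l - 1))).exp
    have : HasDerivAt ψ _ t := he.congr_of_eventuallyEq (by
      filter_upwards [Ioi_mem_nhds ht] with s hs using hψp s hs)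
    convert this using 1
    rw [hψ'p t ht, hψp t ht]
    simp only [hL, Pi.add_apply, Function.comp_apply]
    ring
  have hM0 : M ∈ Set.Ioc 0 M := ⟨hM, le_rfl⟩
  obtain ⟨B, hB⟩ : ∃ B, ∀ t ∈ Set.Ioc 0 M, |Real.log (ψ t) - Real.log (t ^ (l * p))| ≤ B := by
    refine ⟨|l - 1| * (1 + max (y M) 0 + |Real.log (f δ)|) +
      l * (|Real.log c| + |Real.log C|), fun t ht => ?_⟩
    have ht0 : 0 < t := ht.1
    have hCpos : 0 < C * t ^ (p - 1) :=
      lt_of_lt_of_le (pos_of_mul_pos_right ((hpos t ht0).trans_le (htf t ht0)) ht0.le) (hupp t ht)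
    have hC0 : 0 < C := pos_of_mul_pos_left hCpos (by positivity)
    have h1 : |Real.log (f t) - p * Real.log t| ≤ |Real.log c| + |Real.log C| := by
      have h2 := Real.log_le_log (by positivity) (hlow t ht)
      have h3 : f t ≤ C * t ^ p := by
        refine (htf t ht0).trans ((mul_le_mul_of_nonneg_left (hupp t ht) ht0.le).trans_eq ?_)
        rw [Real.rpow_sub_one ht0.ne']
        field_simp
      have h4 := Real.log_le_log (hpos t ht0) h3
      rw [Real.log_mul (by positivity) (by positivity), Real.log_rpow ht0] at h2 h4
      rw [abs_le]
      have := neg_abs_le (Real.log c)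
      have := le_abs_self (Real.log C)
      have := abs_nonneg (Real.log c)
      have := abs_nonneg (Real.log C)
      constructor <;> linarith
    have h5 : |softMin (y t) - y t| ≤ 1 + max (y M) 0 := by
      refine (abs_softMin_sub_le _).trans ?_
      gcongr
      exact sub_le_sub_right (Real.log_le_log (hpos t ht0) (hmono ht0 hM ht.2)) _
    have h6 : Real.log (ψ t) - Real.log (t ^ (l * p)) = (l - 1) * (softMin (y t) - y t)
        - (l - 1) * Real.log (f δ) + l * (Real.log (f t) - p * Real.log t) := by
      rw [hψp t ht0, Real.log_exp, Real.log_rpow ht0]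
      simp only [hy]
      ring
    rw [h6]
    refine (abs_add_le _ _).trans (add_le_add ((abs_sub _ _).trans ?_) ?_)
    · rw [abs_mul, abs_mul, mul_add]
      gcongr
    · rw [abs_mul, abs_of_pos hl]
      gcongr
  have hψb : ∀ t ∈ Set.Ioc 0 M, ψ t ∈
      Set.Icc (Real.exp (-B) * t ^ (l * p)) (Real.exp B * t ^ (l * p)) := fun t ht =>
    mem_Icc_of_abs_log_sub_le (hψ0 t ht.1) (Real.rpow_pos_of_pos ht.1 _) (hB t ht)
  have hC0 : 0 < C := by
    have h := lt_of_lt_of_le (pos_of_mul_pos_right ((hpos M hM).trans_le (htf M hM)) hM.le)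
      (hupp M hM0)
    exact pos_of_mul_pos_left h (by positivity)
  have hml : 0 < min 1 l := lt_min one_pos hl
  have hψ'b : ∀ t ∈ Set.Ioc 0 M, Real.exp (-B) * min 1 l * t ^ (l * p - 1) ≤ ψ' t ∧
      ψ' t ≤ Real.exp B * (C / c) * (1 + |l - 1|) * t ^ (l * p - 1) := fun t ht => by
    have ht0 : 0 < t := ht.1
    have hft := hpos t ht0
    have h1 : 1 / t ≤ f1 t / f t := by
      rw [div_le_div_iff₀ ht0 hft]
      linarith [htf t ht0]
    have h2 : f1 t / f t ≤ C / c / t := by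
      have : f1 t / f t ≤ (C * t ^ (p - 1)) / (c * t ^ p) := by
        have := (hpos t ht0).le
        exact div_le_div₀ (by positivity) (hupp t ht) (by positivity) (hlow t ht)
      refine this.trans_eq ?_
      rw [Real.rpow_sub_one ht0.ne']
      field_simp
    have h3 : L t ≤ 1 + |l - 1| := by linarith [(abs_le.1 (hLb t).1).2]
    have h4 := (hLb t).2
    obtain ⟨h5, h6⟩ := hψb t ht
    have hL0 : 0 ≤ L t := hml.le.trans h4
    have hft1 : 0 ≤ f1 t / f t := le_trans (by positivity) h1
    rw [hψ'p t ht0, Real.rpow_sub_one ht0.ne']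
    constructor
    · calc _ = Real.exp (-B) * t ^ (l * p) * (1 / t) * min 1 l := by ring
        _ ≤ _ := by
          have := (hψ0 t ht0).le
          gcongr
    · calc _ ≤ Real.exp B * t ^ (l * p) * (C / c / t) * (1 + |l - 1|) := by
            have := (hψ0 t ht0).le
            gcongr
        _ = _ := by ring
  have hψc : Continuous ψ := by
    refine continuous_of_tendsto_zero
      (fun t ht => (hψd t ht).continuousAt.continuousWithinAt) hψn
      (tendsto_zero_of_le_rpow (by linarith : 0 < l * p) hM fun t ht =>
        ⟨(hψ0 t ht.1).le, (hψb t ht).2⟩)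
  have hψ'c : Continuous ψ' := by
    refine continuous_of_tendsto_zero ?_ hψ'n
      (tendsto_zero_of_le_rpow (by linarith : 0 < l * p - 1) hM fun t ht =>
        ⟨le_trans ?_ (hψ'b t ht).1, (hψ'b t ht).2⟩)
    · refine ContinuousOn.congr ((hψc.continuousOn.mul (hf1.div hfc fun t ht => (hpos t ht).ne')).mul
        hLc) fun t ht => hψ'p t ht
    · have := ht.1.le
      positivity
  refine ⟨ψ, ψ', L, hasDerivAt_of_continuous_of_pos hψc hψ'c hψn hψ'n hψd, hψ'c, hψn,
    fun t ht => ⟨hψ0 t ht, hψ'p t ht⟩, hLb, fun t ht => ?_,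
    min (Real.exp (-B)) (Real.exp (-B) * min 1 l), by positivity,
    max (Real.exp B) (Real.exp B * (C / c) * (1 + |l - 1|)), by positivity, fun t ht => ?_⟩
  · have : 0 ≤ y t := sub_nonneg.2
      (Real.log_le_log (hpos δ hδ) (hmono hδ (hδ.trans_le ht) ht))
    simp [hL, min_eq_right this]
  · have ht0 : 0 < t := ht.1
    refine ⟨le_trans ?_ (hψb t ht).1, (hψb t ht).2.trans ?_, le_trans ?_ (hψ'b t ht).1,
      (hψ'b t ht).2.trans ?_⟩ <;> gcongr
    exacts [min_le_left _ _, le_max_left _ _, min_le_right _ _, le_max_right _ _]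

end TestFunctions

section TestPair

variable {f f1 f2 : ℝ → ℝ} {p : ℝ}

theorem exists_primitive_sq {g : ℝ → ℝ} (hg : Continuous g) {a A β M : ℝ} (ha : 0 < a) (hβ : 0 ≤ β)
    (h : ∀ t ∈ Set.Ioc 0 M, a * t ^ β ≤ g t ∧ g t ≤ A * t ^ β) :
    ∃ G : ℝ → ℝ, (∀ t, HasDerivAt G (g t ^ 2) t) ∧ G 0 = 0 ∧ ∀ t ∈ Set.Ioc 0 M,
      (a * (t / 2) ^ β) ^ 2 * (t / 2) ≤ G t ∧ G t ≤ (A * t ^ β) ^ 2 * t := by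
  have hd : ∀ t, HasDerivAt (fun t => ∫ s in (0 : ℝ)..t, g s ^ 2) (g t ^ 2) t := fun t =>
    ((hg.pow 2).integral_hasStrictDerivAt 0 t).hasDerivAt
  refine ⟨_, hd, by simp, fun t ht => ?_⟩
  have ht0 : 0 < t := ht.1
  have hmono : Monotone fun t => ∫ s in (0 : ℝ)..t, g s ^ 2 :=
    monotone_of_hasDerivAt_nonneg hd fun t => sq_nonneg _
  have hcont : Continuous fun t => ∫ s in (0 : ℝ)..t, g s ^ 2 :=
    continuous_iff_continuousAt.2 fun t => (hd t).continuousAt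
  constructor
  · obtain ⟨s, hs, hsd⟩ := exists_hasDerivAt_eq_slope _ _ (half_lt_self ht0) hcont.continuousOn
      fun s _ => hd s
    have hs0 : 0 < s := (half_pos ht0).trans hs.1
    have h1 : a * (t / 2) ^ β ≤ g s :=
      (by have := hs.1.le; gcongr : a * (t / 2) ^ β ≤ a * s ^ β).trans
        (h s ⟨hs0, hs.2.le.trans ht.2⟩).1
    rw [eq_div_iff (by linarith)] at hsd
    have h2 : 0 ≤ ∫ s in (0 : ℝ)..(t / 2), g s ^ 2 := by
      have := hmono (half_pos ht0).le
      simpa using this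
    calc _ ≤ g s ^ 2 * (t - t / 2) := by rw [sub_half]; gcongr
      _ ≤ _ := by rw [hsd]; exact sub_le_self _ h2
  · obtain ⟨s, hs, hsd⟩ := exists_hasDerivAt_eq_slope _ _ ht0 hcont.continuousOn
      fun s _ => hd s
    have hs' : s ∈ Set.Ioc 0 M := ⟨hs.1, hs.2.le.trans ht.2⟩
    have hA : 0 ≤ A := by
      have hsβ := Real.rpow_pos_of_pos hs.1 β
      have h3 : 0 < A * s ^ β := (by positivity : 0 < a * s ^ β).trans_le ((h s hs').1.trans (h s hs').2)
      exact (pos_of_mul_pos_left h3 hsβ.le).le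
    have h1 : g s ≤ A * t ^ β :=
      (h s hs').2.trans (by have := hs.1.le; have := hs.2.le; gcongr)
    have h0 : 0 ≤ g s := by
      have := hs.1.le
      exact le_trans (by positivity) (h s hs').1
    rw [eq_div_iff (by linarith), intervalIntegral.integral_same, sub_zero, sub_zero] at hsd
    rw [← hsd]
    gcongr

theorem exists_test_pair (hf : ∀ t, 0 < t → HasDerivAt f (f1 t) t)
    (hf1 : ∀ t, 0 < t → HasDerivAt f1 (f2 t) t) (hpos : ∀ t, 0 < t → 0 < f t)
    (hmono : MonotoneOn f (Set.Ioi 0)) (hf2 : ∀ t, 0 < t → 0 ≤ f2 t)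
    {l c C M δ r : ℝ} (hl : 0 < l) (hlp : 1 < l * p) (hc : 0 < c)
    (hM : 0 < M) (hδ : 0 < δ) (hlow : ∀ t ∈ Set.Ioc 0 M, c * t ^ p ≤ f t)
    (hupp : ∀ t ∈ Set.Ioc 0 M, f1 t ≤ C * t ^ (p - 1)) (htf : ∀ t, 0 < t → f t ≤ t * f1 t)
    (hr : (l - 1) ^ 2 < r) (hδr : ∀ t ∈ Set.Ioo 0 δ, r * f1 t ^ 2 ≤ f t * f2 t) :
    ∃ ψ ψ' Ψ : ℝ → ℝ, (∀ t, HasDerivAt ψ (ψ' t) t) ∧ Continuous ψ' ∧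
      (∀ t, HasDerivAt Ψ (ψ' t ^ 2) t) ∧ ψ 0 = 0 ∧ Ψ 0 = 0 ∧ ∃ k > 0, ∃ b > 0, ∃ B > 0,
      ∀ t ∈ Set.Ioc 0 M, (1 + k) * (f t * Ψ t) ≤ f1 t * ψ t ^ 2 ∧
        b * t ^ (2 * (l * p) + p - 1) ≤ f t * Ψ t ∧ ψ t ^ 2 ≤ B * t ^ (2 * (l * p)) ∧
        Ψ t ^ 2 ≤ B * (ψ' t * ψ t) ^ 2 := by
  obtain ⟨ψ, ψ', L, hψd, hψ'c, hψn, hψp, hLb, hL1, a, ha, A, hA, hb⟩ :=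
    exists_interpolated_power hf (fun t ht => (hf1 t ht).continuousAt.continuousWithinAt) hpos hmono
      hl hlp hc hM hδ hlow hupp htf
  obtain ⟨Ψ, hΨd, hΨ0, hΨb⟩ := exists_primitive_sq hψ'c ha (by linarith : 0 ≤ l * p - 1)
    fun t ht => (hb t ht).2.2
  have hΨmono : Monotone Ψ := monotone_of_hasDerivAt_nonneg hΨd fun t => sq_nonneg _
  have hΨc : Continuous Ψ := continuous_iff_continuousAt.2 fun t => (hΨd t).continuousAt
  have hΨnn : ∀ t, 0 ≤ t → 0 ≤ Ψ t := fun t ht => hΨ0 ▸ hΨmono ht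
  set E : ℝ → ℝ := fun t => f1 t * ψ t ^ 2 / f t with hE
  have hEd : ∀ t, 0 < t → HasDerivAt E
      (ψ t ^ 2 / f t ^ 2 * ((2 * L t - 1) * f1 t ^ 2 + f t * f2 t)) t := fun t ht => by
    have hft := (hpos t ht).ne'
    have h : HasDerivAt E _ t := ((hf1 t ht).mul ((hψd t).pow 2)).div (hf t ht) hft
    convert h using 1
    rw [(hψp t ht).2]
    simp only [Pi.mul_apply, Pi.pow_apply]
    field_simp
    ring
  have hle : ∀ κ : ℝ, ∀ s : Set ℝ, Convex ℝ s → s ⊆ Set.Ioi 0 → (∀ t ∈ interior s,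
      0 ≤ (2 * L t - 1 - κ * L t ^ 2) * f1 t ^ 2 + f t * f2 t) →
      MonotoneOn (fun t => E t - κ * Ψ t) s := fun κ s hs hs0 h => by
    have hd : ∀ t ∈ s, HasDerivAt (fun t => E t - κ * Ψ t) _ t := fun t ht =>
      (hEd t (hs0 ht)).sub ((hΨd t).const_mul κ)
    refine monotoneOn_of_deriv_nonneg hs
      (fun t ht => (hd t ht).continuousAt.continuousWithinAt)
      (fun t ht => (hd t (interior_subset ht)).differentiableAt.differentiableWithinAt)
      fun t ht => ?_
    have ht0 := hs0 (interior_subset ht)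
    rw [(hd t (interior_subset ht)).deriv, (hψp t ht0).2]
    have hft := (hpos t ht0).ne'
    have := mul_nonneg (by positivity : 0 ≤ ψ t ^ 2 / f t ^ 2) (h t ht)
    refine this.trans_eq ?_
    field_simp
    ring
  have hEnn : ∀ t, 0 < t → 0 ≤ E t := fun t ht => by
    have h1 := (hpos t ht).le
    have h2 : 0 ≤ f1 t := (pos_of_mul_pos_right ((hpos t ht).trans_le (htf t ht)) ht.le).le
    positivity
  set m : ℝ := (1 + |l - 1|) ^ 2 with hm
  have hm0 : 0 < m := by positivity
  set k : ℝ := (r - (l - 1) ^ 2) / m with hk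
  have hk0 : 0 < k := div_pos (sub_pos.2 hr) hm0
  have hsmall : ∀ t ∈ Set.Ioo 0 δ, (1 + k) * Ψ t ≤ E t := fun t ht => by
    have hM1 := hle (1 + k) (Set.Ioo 0 δ) (convex_Ioo 0 δ) (fun s hs => hs.1) (fun s hs => by
      rw [interior_Ioo] at hs
      have h1 := hδr s hs
      obtain ⟨h2, h3⟩ := hLb s
      have h4 : (L s - 1) ^ 2 ≤ (l - 1) ^ 2 := sq_le_sq.2 h2
      have h5 : L s ^ 2 ≤ m := by
        have hL0 : 0 ≤ L s := (lt_min one_pos hl).le.trans h3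
        have := (abs_le.1 h2).2
        exact pow_le_pow_left₀ hL0 (by linarith) 2
      have h6 : k * L s ^ 2 ≤ r - (l - 1) ^ 2 := by
        calc k * L s ^ 2 ≤ k * m := by gcongr
          _ = _ := by rw [hk]; field_simp
      have h7 : 0 ≤ (2 * L s - 1 - (1 + k) * L s ^ 2 + r) * f1 s ^ 2 :=
        mul_nonneg (by linarith) (sq_nonneg _)
      linarith)
    have hlim : Tendsto (fun s => -((1 + k) * Ψ s)) (𝓝[>] 0) (𝓝 0) := by
      have : Tendsto (fun s => -((1 + k) * Ψ s)) (𝓝 0) (𝓝 (-((1 + k) * Ψ 0))) :=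
        (hΨc.tendsto 0).const_mul (1 + k) |>.neg
      rw [hΨ0, mul_zero, neg_zero] at this
      exact this.mono_left nhdsWithin_le_nhds
    rw [← sub_nonneg]
    refine le_of_tendsto hlim ?_
    filter_upwards [Ioo_mem_nhdsGT ht.1] with s hs
    have h1 := hM1 ⟨hs.1, hs.2.trans ht.2⟩ ht hs.2.le
    have h2 := hEnn s hs.1
    beta_reduce at h1
    linarith
  have hM2 := hle 1 (Set.Ici δ) (convex_Ici δ) (fun s hs => hδ.trans_le hs) (fun s hs => by
      have hs' := interior_subset hs
      have hs0 : 0 < s := hδ.trans_le hs'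
      rw [hL1 s hs']
      have := mul_nonneg (hpos s hs0).le (hf2 s hs0)
      linarith)
  have hδE : (1 + k) * Ψ δ ≤ E δ := by
    have hc1 : ContinuousAt (fun t => E t - (1 + k) * Ψ t) δ :=
      ((hEd δ hδ).continuousAt).sub (hΨc.continuousAt.const_mul _)
    rw [← sub_nonneg]
    refine ge_of_tendsto (hc1.tendsto.mono_left (nhdsWithin_le_nhds (s := Set.Iio δ))) ?_
    filter_upwards [Ioo_mem_nhdsLT hδ] with s hs using sub_nonneg.2 (hsmall s hs)
  have hΨδ : 0 < Ψ δ := by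
    have h1 : 0 < min δ M := lt_min hδ hM
    have h2 := (hΨb (min δ M) ⟨h1, min_le_right _ _⟩).1
    exact (by positivity : (0 : ℝ) < _).trans_le (h2.trans (hΨmono (min_le_left _ _)))
  set k' : ℝ := min k (k * Ψ δ / (Ψ M + 1)) with hk'
  have hΨM := hΨnn M hM.le
  have hk'0 : 0 < k' := by positivity
  have hkey : ∀ t ∈ Set.Ioc 0 M, (1 + k') * Ψ t ≤ E t := fun t ht => by
    have hΨt := hΨnn t ht.1.le
    rcases lt_or_ge t δ with h | h
    · refine le_trans ?_ (hsmall t ⟨ht.1, h⟩)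
      have : k' ≤ k := min_le_left _ _
      gcongr
    · have h1 := hM2 (Set.mem_Ici.2 le_rfl) h h
      beta_reduce at h1
      have h2 : k' * Ψ t ≤ k * Ψ δ := by
        calc k' * Ψ t ≤ k * Ψ δ / (Ψ M + 1) * (Ψ M + 1) := by
              gcongr
              · exact min_le_right _ _
              · linarith [hΨmono ht.2]
          _ = _ := by field_simp
      linarith
  refine ⟨ψ, ψ', Ψ, hψd, hψ'c, hΨd, hψn 0 le_rfl, hΨ0, k', hk'0,
    c * (a ^ 2 * (1 / 2) ^ (2 * (l * p) - 1)), by positivity, max (A ^ 2) (A ^ 4 / a ^ 4),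
    by positivity, fun t ht => ?_⟩
  have ht0 : 0 < t := ht.1
  have hft := hpos t ht0
  obtain ⟨b1, b2, b3, b4⟩ := hb t ht
  obtain ⟨b5, b6⟩ := hΨb t ht
  have hsq : ∀ s β : ℝ, 0 < s → (s ^ β) ^ 2 = s ^ (2 * β) := fun s β hs => by
    rw [← Real.rpow_natCast, ← Real.rpow_mul hs.le, mul_comm]; rfl
  have hψt := (hψp t ht0).1
  refine ⟨?_, ?_, ?_, ?_⟩
  · have h1 := mul_le_mul_of_nonneg_left (hkey t ht) hft.le
    calc _ = f t * ((1 + k') * Ψ t) := by ring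
      _ ≤ f t * E t := h1
      _ = _ := by rw [hE]; field_simp
  · calc _ = (c * t ^ p) * ((a * (t / 2) ^ (l * p - 1)) ^ 2 * (t / 2)) := by
          have e1 : (t / 2) ^ (2 * (l * p - 1)) * (t / 2) = (t / 2) ^ (2 * (l * p) - 1) := by
            rw [← Real.rpow_add_one (by positivity)]
            ring_nf
          rw [mul_pow, hsq _ _ (by positivity), mul_assoc (a ^ 2), e1, div_eq_mul_one_div t 2,
            Real.mul_rpow ht0.le (by norm_num),
            show 2 * (l * p) + p - 1 = p + (2 * (l * p) - 1) by ring, Real.rpow_add ht0]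
          ring
      _ ≤ _ := mul_le_mul (hlow t ht) b5 (by positivity) hft.le
  · calc ψ t ^ 2 ≤ (A * t ^ (l * p)) ^ 2 := by gcongr
      _ = A ^ 2 * t ^ (2 * (l * p)) := by rw [mul_pow, hsq _ _ ht0]
      _ ≤ _ := by gcongr; exact le_max_left _ _
  · have hΨt := hΨnn t ht0.le
    have e1 : t ^ (l * p - 1) * t = t ^ (l * p) := by
      rw [← Real.rpow_add_one ht0.ne', sub_add_cancel]
    have hψ't : 0 ≤ ψ' t := le_trans (by positivity) b3
    calc Ψ t ^ 2 ≤ ((A * t ^ (l * p - 1)) ^ 2 * t) ^ 2 := by gcongr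
      _ = A ^ 4 / a ^ 4 * (a * t ^ (l * p - 1) * (a * t ^ (l * p))) ^ 2 := by
          rw [← e1]; field_simp
      _ ≤ A ^ 4 / a ^ 4 * (ψ' t * ψ t) ^ 2 := by gcongr
      _ ≤ _ := by gcongr; exact le_max_right _ _

end TestPair

section Exponents

theorem exponent_data {N : ℕ} {p : ℝ}
    (hsup : (3 ≤ N ∧ N ≤ 10 ∧ ((N : ℝ) + 2) / ((N : ℝ) - 2) < p) ∨
      (11 ≤ N ∧ ((N : ℝ) + 2) / ((N : ℝ) - 2) < p ∧ p < pc N)) :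
    3 ≤ N ∧ 1 < p ∧ 4 < (N - 2) * (p - 1) ∧ ((p - 1) * (N - 2) / 4 / p - 1) ^ 2 < 1 - 1 / p ∧
      (((N : ℝ) - 2) - 4 / (p - 1)) ^ 2 < (N - 2) ^ 2 * (1 - 1 / p) := by
  have hN : 3 ≤ N := by omega
  have hNr : (3 : ℝ) ≤ N := by exact_mod_cast hN
  have hps : ((N : ℝ) + 2) / ((N : ℝ) - 2) < p := by
    rcases hsup with h | h
    exacts [h.2.2, h.2.1]
  obtain ⟨n, hn⟩ : ∃ n : ℝ, n = N - 2 := ⟨_, rfl⟩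
  obtain ⟨P, hP⟩ : ∃ P : ℝ, P = p - 1 := ⟨_, rfl⟩
  have hn1 : 1 ≤ n := by linarith
  have hnP : 4 < n * P := by
    rw [div_lt_iff₀ (by linarith)] at hps
    rw [hn, hP]
    linarith
  have hP0 : 0 < P := pos_of_mul_pos_right (by linarith) (by linarith : 0 ≤ n)
  have hJ : 0 < n * (8 - n) * P ^ 2 + 8 * (n - 2) * P - 16 := by
    rcases le_or_gt n 8 with h8 | h8
    · nlinarith [mul_nonneg (sub_nonneg.2 h8) (mul_nonneg hP0.le (by linarith : 0 ≤ n * P - 4))]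
    · have h11 : p < pc N := by
        rcases hsup with h | h
        · have : (N : ℝ) ≤ 10 := by exact_mod_cast h.2.1
          linarith
        · exact h.2.2
      obtain ⟨s, hs⟩ : ∃ s : ℝ, s = √(n + 1) := ⟨_, rfl⟩
      have hs2 : s ^ 2 = n + 1 := by rw [hs, Real.sq_sqrt (by linarith)]
      have hs0 : 0 ≤ s := by rw [hs]; positivity
      have hs3 : 3 < s := by nlinarith
      have h1 : P * (n * (n - 8)) < 4 * n - 8 + 8 * s := by
        rw [pc, lt_div_iff₀ (by nlinarith), show (N : ℝ) - 1 = n + 1 by linarith, ← hs,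
          show (N : ℝ) = n + 2 by linarith, show p = P + 1 by linarith] at h11
        nlinarith
      have h2 : 0 < P * (n * (n - 8)) - (4 * n - 8) + 8 * s := by nlinarith
      have h3 := mul_pos h2 (sub_pos.2 h1)
      have h4 : (P * (n * (n - 8)) - (4 * n - 8) + 8 * s) * (4 * n - 8 + 8 * s - P * (n * (n - 8))) =
          n * (n - 8) * (n * (8 - n) * P ^ 2 + 8 * (n - 2) * P - 16) := by
        linear_combination 64 * hs2
      rw [h4] at h3
      exact pos_of_mul_pos_right h3 (by nlinarith)
  have hp : p = P + 1 := by linarith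
  have hp1 : 0 < P + 1 := by linarith
  refine ⟨hN, by linarith, by rw [← hn, ← hP]; exact hnP, ?_, ?_⟩
  · rw [← hn, ← hP, hp, ← sub_pos]
    have : 1 - 1 / (P + 1) - (P * n / 4 / (P + 1) - 1) ^ 2 =
        (n * (8 - n) * P ^ 2 + 8 * (n - 2) * P - 16) / (16 * (P + 1) ^ 2) := by
      field_simp
      ring
    rw [this]
    positivity
  · rw [← hn, ← hP, hp, ← sub_pos]
    have : n ^ 2 * (1 - 1 / (P + 1)) - (n - 4 / P) ^ 2 =
        (n * (8 - n) * P ^ 2 + 8 * (n - 2) * P - 16) / (P ^ 2 * (P + 1)) := by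
      field_simp
      ring
    rw [this]
    positivity

end Exponents

section Nonlinearity

variable {f : ℝ → ℝ}

theorem apply_zero_of_integral_le (hc : ContinuousOn f (Set.Ici 0)) (hmono : MonotoneOn f (Set.Ici 0))
    (hpos : ∀ t : ℝ, 0 < t → 0 < f t) {p : ℝ} (hp : 0 < p)
    (hglob : ∀ s : ℝ, 0 ≤ s → (p + 1) * ∫ t in (0 : ℝ)..s, f t ≤ s * f s) : f 0 = 0 := by
  have hlim : Tendsto f (𝓝[>] 0) (𝓝 (f 0)) :=
    (hc 0 Set.self_mem_Ici).mono_left (nhdsWithin_mono _ Set.Ioi_subset_Ici_self)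
  have h0 : 0 ≤ f 0 := ge_of_tendsto hlim (by
    filter_upwards [self_mem_nhdsWithin] with s hs using (hpos s hs).le)
  have h1 : (p + 1) * f 0 ≤ f 0 := ge_of_tendsto hlim (by
    filter_upwards [self_mem_nhdsWithin] with s hs
    have hs0 : 0 < s := hs
    have h2 : s * f 0 ≤ ∫ t in (0 : ℝ)..s, f t := by
      have h3 : ∫ _ in (0 : ℝ)..s, f 0 ≤ ∫ t in (0 : ℝ)..s, f t := by
        refine intervalIntegral.integral_mono_on hs0.le (by simp)
          (ContinuousOn.intervalIntegrable ?_) fun t ht => hmono Set.self_mem_Ici ht.1 ht.1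
        rw [Set.uIcc_of_le hs0.le]
        exact hc.mono Set.Icc_subset_Ici_self
      simpa using h3
    have h4 := (mul_le_mul_of_nonneg_left h2 (by linarith : 0 ≤ p + 1)).trans (hglob s hs0.le)
    rw [mul_left_comm] at h4
    exact le_of_mul_le_mul_left h4 hs0)
  nlinarith

theorem hasDerivAt_of_contDiffOn_two (hC2 : ContDiffOn ℝ 2 f (Set.Ici 0)) {t : ℝ} (ht : 0 < t) :
    HasDerivAt f (deriv f t) t ∧ HasDerivAt (deriv f) (deriv (deriv f) t) t := by
  have h := (contDiffOn_succ_iff_deriv_of_isOpen (n := 1) isOpen_Ioi).1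
    (hC2.mono Set.Ioi_subset_Ici_self : ContDiffOn ℝ (1 + 1) f (Set.Ioi 0))
  exact ⟨(h.1.differentiableAt (Ioi_mem_nhds ht)).hasDerivAt,
    ((h.2.2.differentiableOn (by norm_num)).differentiableAt (Ioi_mem_nhds ht)).hasDerivAt⟩

theorem deriv_deriv_nonneg_of_convexOn (hconv : ConvexOn ℝ (Set.Ici 0) f)
    (hd : ∀ t, 0 < t → HasDerivAt f (deriv f t) t) {t : ℝ} (ht : 0 < t) :
    0 ≤ deriv (deriv f) t := by
  have h := ((hconv.subset Set.Ioi_subset_Ici_self (convex_Ioi 0)).monotoneOn_deriv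
    fun s hs => (hd s hs).differentiableAt).derivWithin_nonneg (x := t)
  rwa [derivWithin_of_isOpen isOpen_Ioi ht] at h

theorem le_mul_deriv_of_convexOn (hconv : ConvexOn ℝ (Set.Ici 0) f) (h0 : f 0 = 0)
    (hd : ∀ t, 0 < t → HasDerivAt f (deriv f t) t) {t : ℝ} (ht : 0 < t) :
    f t ≤ t * deriv f t := by
  have h := hconv.slope_le_deriv Set.self_mem_Ici (Set.mem_Ici.2 ht.le) ht (hd t ht).differentiableAt
  rw [slope_def_field, h0, sub_zero, sub_zero, div_le_iff₀ ht] at h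
  linarith

theorem tendsto_of_tendsto_qfun (hf : ∀ t, 0 < t → 0 < f t) (hf1 : ∀ t, 0 < t → 0 < deriv f t)
    (hf2 : ∀ t, 0 < t → 0 ≤ deriv (deriv f) t) {q₀ : ℝ≥0∞} {p : ℝ} (hp : 1 < p)
    (hq : Tendsto (qfun f) (𝓝[>] (0 : ℝ)) (𝓝 q₀))
    (hpq : 1 / ENNReal.ofReal p + 1 / q₀ = 1) :
    Tendsto (fun t => f t * deriv (deriv f) t / deriv f t ^ 2) (𝓝[>] 0) (𝓝 (1 - 1 / p)) := by
  have hp0 : 0 < p := by linarith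
  have hq0 : q₀⁻¹ = ENNReal.ofReal (1 - 1 / p) := by
    rw [one_div, one_div, ← ENNReal.ofReal_inv_of_pos hp0] at hpq
    rw [ENNReal.ofReal_sub _ (by positivity), ENNReal.ofReal_one, ← hpq, one_div,
      ENNReal.add_sub_cancel_left ENNReal.ofReal_ne_top]
  have h := tendsto_inv_iff.2 hq
  rw [hq0] at h
  have h2 := (ENNReal.tendsto_toReal ENNReal.ofReal_ne_top).comp h
  rw [ENNReal.toReal_ofReal (by rw [sub_nonneg, div_le_one hp0]; exact hp.le)] at h2
  refine h2.congr' ?_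
  filter_upwards [self_mem_nhdsWithin] with t ht
  have a0 := hf t ht
  have a1 := hf1 t ht
  have a2 := hf2 t ht
  simp only [Function.comp_apply, qfun]
  split_ifs with hz
  · simp [hz]
  · have a3 : 0 < f t * deriv (deriv f) t := lt_of_le_of_ne (by positivity) (Ne.symm hz)
    rw [← ENNReal.ofReal_inv_of_pos (by positivity), inv_div, ENNReal.toReal_ofReal (by positivity)]

theorem le_mul_deriv_of_le_mul_deriv_deriv {f1 f2 : ℝ → ℝ} (hf : ∀ t, 0 < t → HasDerivAt f (f1 t) t)
    (hf1 : ∀ t, 0 < t → HasDerivAt f1 (f2 t) t) (hf1p : ∀ t, 0 < t → 0 < f1 t)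
    (htf : ∀ t, 0 < t → f t ≤ t * f1 t)
    {r δ : ℝ} (hr : ∀ t ∈ Set.Ioo 0 δ, r * f1 t ^ 2 ≤ f t * f2 t) {t : ℝ} (ht : t ∈ Set.Ioo 0 δ) :
    f t ≤ (1 - r) * (t * f1 t) := by
  have hd : ∀ s ∈ Set.Ioo 0 δ, HasDerivAt (fun s => (1 - r) * s - f s / f1 s) _ s := fun s hs =>
    ((hasDerivAt_id s).const_mul (1 - r)).sub ((hf s hs.1).div (hf1 s hs.1) (hf1p s hs.1).ne')
  have hmono : MonotoneOn (fun s => (1 - r) * s - f s / f1 s) (Set.Ioo 0 δ) := by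
    refine monotoneOn_of_deriv_nonneg (convex_Ioo 0 δ)
      (fun s hs => (hd s hs).continuousAt.continuousWithinAt)
      (fun s hs => (hd s (interior_subset hs)).differentiableAt.differentiableWithinAt)
      fun s hs => ?_
    rw [interior_Ioo] at hs
    have h1 := hf1p s hs.1
    have h2 := hr s hs
    rw [(hd s hs).deriv, mul_one, sub_nonneg, div_le_iff₀ (by positivity)]
    linarith
  have hlim : Tendsto (fun s : ℝ => -r * s) (𝓝[>] 0) (𝓝 0) := by
    have : Tendsto (fun s : ℝ => -r * s) (𝓝 0) (𝓝 (-r * 0)) := tendsto_id.const_mul (-r)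
    rw [mul_zero] at this
    exact this.mono_left nhdsWithin_le_nhds
  have key : 0 ≤ (1 - r) * t - f t / f1 t := by
    refine le_of_tendsto hlim ?_
    filter_upwards [Ioo_mem_nhdsGT ht.1] with s hs
    refine le_trans ?_ (hmono ⟨hs.1, hs.2.trans ht.2⟩ ht hs.2.le)
    have : f s / f1 s ≤ s := by
      rw [div_le_iff₀ (hf1p s hs.1)]
      exact htf s hs.1
    beta_reduce
    linarith
  rw [sub_nonneg, div_le_iff₀ (hf1p t ht.1)] at key
  linarith

theorem exists_rpow_bounds {f1 : ℝ → ℝ} (hpos : ∀ t, 0 < t → 0 < f t)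
    (hmono : MonotoneOn f (Set.Ioi 0)) (hf1p : ∀ t, 0 < t → 0 < f1 t)
    (hmono1 : MonotoneOn f1 (Set.Ioi 0)) {p ε c₁ c₂ : ℝ} (hp : 1 ≤ p) (hε : 0 < ε) (hc₁ : 0 < c₁)
    (hlower : ∀ t ∈ Set.Ioo 0 ε, c₁ * t ^ p ≤ f t)
    (hupper : ∀ t ∈ Set.Ioo 0 ε, f1 t ≤ c₂ * t ^ (p - 1)) {M : ℝ} (hM : 0 < M) :
    ∃ c > 0, ∃ C, ∀ t ∈ Set.Ioc 0 M, c * t ^ p ≤ f t ∧ f1 t ≤ C * t ^ (p - 1) := by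
  have hε2 : 0 < ε / 2 := half_pos hε
  have hfε := hpos _ hε2
  have hfM := hf1p _ hM
  refine ⟨min c₁ (f (ε / 2) / M ^ p), by positivity, max c₂ (f1 M / (ε / 2) ^ (p - 1)),
    fun t ht => ?_⟩
  have ht0 : 0 < t := ht.1
  rcases lt_or_ge t ε with h | h
  · constructor
    · refine le_trans ?_ (hlower t ⟨ht0, h⟩)
      gcongr
      exact min_le_left _ _
    · refine (hupper t ⟨ht0, h⟩).trans ?_
      gcongr
      exact le_max_left _ _
  · have hεt : ε / 2 ≤ t := by linarith
    constructor
    · calc _ ≤ f (ε / 2) / M ^ p * M ^ p := by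
            have := ht.2
            gcongr
            exact min_le_right _ _
        _ = f (ε / 2) := by field_simp
        _ ≤ f t := hmono hε2 ht0 hεt
    · calc f1 t ≤ f1 M := hmono1 ht0 hM ht.2
        _ = f1 M / (ε / 2) ^ (p - 1) * (ε / 2) ^ (p - 1) := by field_simp
        _ ≤ _ := by
          have : 0 ≤ p - 1 := by linarith
          gcongr
          exact le_max_right _ _

end Nonlinearity

section Liouville

variable {N : ℕ}

theorem integrable_rpow_of_stable (hN : 3 ≤ N) {K : Set (EuclideanSpace ℝ (Fin N))}
    (hK : IsCompact K) {u d : EuclideanSpace ℝ (Fin N) → ℝ} (hu : ContDiff ℝ 2 u)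
    (hu0 : ∀ x, 0 ≤ u x) (hd : Continuous d) {ψ ψ' Ψ : ℝ → ℝ}
    (hψ : ∀ t, HasDerivAt ψ (ψ' t) t) (hψ' : Continuous ψ')
    (hΨ : ∀ t, HasDerivAt Ψ (ψ' t ^ 2) t) (hψ0 : ψ 0 = 0) {k b B Q : ℝ} (hk : 0 < k) (hb : 0 < b)
    (hB : 0 < B) (hQ : 0 < Q)
    (hdψ : ∀ x, (1 + k) * (-lap u x * Ψ (u x)) ≤ d x * ψ (u x) ^ 2)
    (hbΨ : ∀ x, b * u x ^ Q ≤ -lap u x * Ψ (u x))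
    (hψB : ∀ x, ψ (u x) ^ 2 ≤ B * u x ^ (Q * ((N - 2) / N)))
    (hΨψ : ∀ x, Ψ (u x) ^ 2 ≤ B * (ψ' (u x) * ψ (u x)) ^ 2)
    (hstab : ∀ φ : EuclideanSpace ℝ (Fin N) → ℝ, ContDiff ℝ 1 φ → HasCompactSupport φ →
      tsupport φ ⊆ Kᶜ → (∀ x, u x = 0 → φ x = 0) →
      ∫ x, d x * φ x ^ 2 ≤ ∫ x, ‖gradient φ x‖ ^ 2) :
    Integrable fun x => u x ^ Q := by
  have hu1 : ContDiff ℝ 1 u := hu.of_le (by norm_num)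
  have hψu : ContDiff ℝ 1 fun x => ψ (u x) := (contDiff_one_of_hasDerivAt hψ hψ').comp hu1
  have hΨc : Continuous Ψ := continuous_iff_continuousAt.2 fun t => (hΨ t).continuousAt
  have hNr : (3 : ℝ) ≤ N := by exact_mod_cast hN
  have hNe : 0 < ((N : ℝ) - 2) / N := div_pos (by linarith) (by linarith)
  have cP : Continuous fun x => u x ^ Q := hu.continuous.rpow_const fun x => Or.inr hQ.le
  have cPe : Continuous fun x => (u x ^ Q) ^ (((N : ℝ) - 2) / N) :=
    cP.rpow_const fun x => Or.inr hNe.le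
  have cS : Continuous fun x => -lap u x * Ψ (u x) :=
    (continuous_lap hu).neg.mul (hΨc.comp hu.continuous)
  obtain ⟨C, hC, h⟩ := integral_source_le_of_stable hu hψ hψ' hΨ hd hk hB hΨψ hdψ
  refine integrable_of_caccioppoli hN hK cP (fun x => Real.rpow_nonneg (hu0 x) _)
    (by positivity : 0 < C * B / b) fun η hη hηc hηK => ?_
  have hφ : ∀ x, u x = 0 → ψ (u x) * η x = 0 := fun x hx => by rw [hx, hψ0, zero_mul]
  have h1 := h η hη hηc (hstab _ (hψu.mul hη) hηc.mul_left
    ((tsupport_mul_subset_right (f := fun x => ψ (u x)) (g := η)).trans hηK) hφ)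
  have cη := hη.continuous
  have cg := hη.continuous_gradient
  have i1 : Integrable fun x => -lap u x * Ψ (u x) * η x ^ 2 :=
    integrable_of_vanishing (cS.mul (cη.pow 2)) hηc (by simp +contextual)
  have i2 : Integrable fun x => u x ^ Q * η x ^ 2 :=
    integrable_of_vanishing (cP.mul (cη.pow 2)) hηc (by simp +contextual)
  have i3 : Integrable fun x => ψ (u x) ^ 2 * ‖gradient η x‖ ^ 2 :=
    integrable_of_vanishing ((hψu.continuous.pow 2).mul (cg.norm.pow 2)) hηc.gradient
      (by simp +contextual)
  have i4 : Integrable fun x => (u x ^ Q) ^ (((N : ℝ) - 2) / N) * ‖gradient η x‖ ^ 2 :=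
    integrable_of_vanishing (cPe.mul (cg.norm.pow 2)) hηc.gradient (by simp +contextual)
  have h2 : b * ∫ x, u x ^ Q * η x ^ 2 ≤ ∫ x, -lap u x * Ψ (u x) * η x ^ 2 := by
    rw [← integral_const_mul]
    refine integral_mono (i2.const_mul b) i1 fun x => ?_
    beta_reduce
    rw [← mul_assoc]
    exact mul_le_mul_of_nonneg_right (hbΨ x) (sq_nonneg _)
  have h3 : ∫ x, ψ (u x) ^ 2 * ‖gradient η x‖ ^ 2 ≤
      B * ∫ x, (u x ^ Q) ^ (((N : ℝ) - 2) / N) * ‖gradient η x‖ ^ 2 := by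
    rw [← integral_const_mul]
    refine integral_mono i3 (i4.const_mul B) fun x => ?_
    beta_reduce
    rw [← mul_assoc, ← Real.rpow_mul (hu0 x)]
    exact mul_le_mul_of_nonneg_right (hψB x) (sq_nonneg _)
  rw [div_mul_eq_mul_div, le_div_iff₀ hb]
  linarith [mul_le_mul_of_nonneg_left h3 hC.le]

theorem exists_weight_exponents {n P s l : ℝ} (hP : 0 < P) (hnP : 4 < n * P)
    (h1 : (l - 1) ^ 2 < s) (h2 : (n - 4 / P) ^ 2 < n ^ 2 * s) :
    ∃ t r : ℝ, 0 < t ∧ n - 4 / P < 2 * t ∧ 4 * t ^ 2 / n ^ 2 < r ∧ (l - 1) ^ 2 < r ∧ r < s := by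
  have hn : 0 < n := pos_of_mul_pos_left (by linarith) hP.le
  have hnP' : 0 < n - 4 / P := by rwa [sub_pos, div_lt_iff₀ hP]
  obtain ⟨m, hm1, hm2⟩ := exists_between h2
  have hm0 : 0 < m := (by positivity : 0 < (n - 4 / P) ^ 2).trans hm1
  have h3 : 4 * (√m / 2) ^ 2 / n ^ 2 < s := by
    rw [div_pow, Real.sq_sqrt hm0.le, div_lt_iff₀ (by positivity)]
    linarith
  obtain ⟨r, hr1, hr2⟩ := exists_between (max_lt h1 h3)
  refine ⟨√m / 2, r, by positivity, ?_, (le_max_right _ _).trans_lt hr1,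
    (le_max_left _ _).trans_lt hr1, hr2⟩
  rw [mul_div_cancel₀ _ two_ne_zero]
  exact Real.lt_sqrt_of_sq_lt hm1

end Liouville

/-- Theorem 1.24: Liouville theorem in the supercritical range, under the local bounds
`c₁ u^{p₀} ≤ f(u)`, `f'(u) ≤ c₂ u^{p₀−1}` near `0` and the global assumption
`(p₀+1) F(s) ≤ s f(s)` where `F(s) = ∫₀^s f`. -/
theorem stmt14 {N : ℕ} (f : ℝ → ℝ)
    (hC2 : ContDiffOn ℝ 2 f (Set.Ici 0))
    (hconv : ConvexOn ℝ (Set.Ici 0) f) (hmono : MonotoneOn f (Set.Ici 0))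
    (hpos : ∀ t : ℝ, 0 < t → 0 < f t)
    (q₀ : ℝ≥0∞) (p₀ : ℝ) (hq : Tendsto (qfun f) (𝓝[>] (0:ℝ)) (𝓝 q₀))
    (hpq : 1 / ENNReal.ofReal p₀ + 1 / q₀ = 1)
    (hsup : (3 ≤ N ∧ N ≤ 10 ∧ ((N : ℝ) + 2) / ((N : ℝ) - 2) < p₀) ∨
      (11 ≤ N ∧ ((N : ℝ) + 2) / ((N : ℝ) - 2) < p₀ ∧ p₀ < pc N))
    (ε c₁ c₂ : ℝ) (hε : 0 < ε) (hc₁ : 0 < c₁) (hc₂ : 0 < c₂)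
    (hlower : ∀ t : ℝ, t ∈ Set.Ioo 0 ε → c₁ * t ^ p₀ ≤ f t)
    (hupper : ∀ t : ℝ, t ∈ Set.Ioo 0 ε → deriv f t ≤ c₂ * t ^ (p₀ - 1))
    (hglob : ∀ s : ℝ, 0 ≤ s → (p₀ + 1) * ∫ t in (0:ℝ)..s, f t ≤ s * f s)
    (u : EuclideanSpace ℝ (Fin N) → ℝ) (hu : ContDiff ℝ 2 u)
    (hbd : ∃ M, ∀ x, |u x| ≤ M) (hnonneg : ∀ x, 0 ≤ u x)
    (hsol : ∀ x, -lap u x = f (u x))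
    (hstab : ∃ K : Set (EuclideanSpace ℝ (Fin N)), IsCompact K ∧
      StableOutside (deriv f) u K) :
    ∀ x, u x = 0 := by
  obtain ⟨hN, hp1, hnP, hl1, hnP2⟩ := exponent_data hsup
  obtain ⟨K, hK, hstabK⟩ := hstab
  obtain ⟨M₀, hM₀⟩ := hbd
  have hNr : (3 : ℝ) ≤ N := by exact_mod_cast hN
  have hp0 : 0 < p₀ := by linarith
  have hps : ((N : ℝ) + 2) / (N - 2) < p₀ := by
    rcases hsup with h | h
    exacts [h.2.2, h.2.1]
  have hf0 := apply_zero_of_integral_le hC2.continuousOn hmono hpos hp0 hglob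
  have hfd := fun t (ht : 0 < t) => (hasDerivAt_of_contDiffOn_two hC2 ht).1
  have hf1d := fun t (ht : 0 < t) => (hasDerivAt_of_contDiffOn_two hC2 ht).2
  have hf2 := fun t (ht : 0 < t) => deriv_deriv_nonneg_of_convexOn hconv hfd ht
  have htf := fun t (ht : 0 < t) => le_mul_deriv_of_convexOn hconv hf0 hfd ht
  have hf1p : ∀ t, 0 < t → 0 < deriv f t := fun t ht =>
    pos_of_mul_pos_right ((hpos t ht).trans_le (htf t ht)) ht.le
  have hmonoI : MonotoneOn f (Set.Ioi 0) := hmono.mono Set.Ioi_subset_Ici_self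
  have hmono1 : MonotoneOn (deriv f) (Set.Ioi 0) :=
    (hconv.subset Set.Ioi_subset_Ici_self (convex_Ioi 0)).monotoneOn_deriv
      fun s hs => (hfd s hs).differentiableAt
  have hqlim := tendsto_of_tendsto_qfun hpos hf1p hf2 hp1 hq hpq
  obtain ⟨τ, r, hτ, hτ1, hτr, hlr, hrs⟩ := exists_weight_exponents (by linarith) hnP hl1 hnP2
  obtain ⟨δ, hδ, hδs⟩ :=
    mem_nhdsGT_iff_exists_Ioo_subset.1 (hqlim.eventually (eventually_gt_nhds hrs))
  have hδ0 : 0 < δ := hδ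
  have hδr : ∀ t ∈ Set.Ioo 0 δ, r * deriv f t ^ 2 ≤ f t * deriv (deriv f) t := fun t ht => by
    have h : r < f t * deriv (deriv f) t / deriv f t ^ 2 := hδs ht
    have := hf1p t ht.1
    rw [lt_div_iff₀ (by positivity)] at h
    exact h.le
  set M := max M₀ 1 with hMdef
  have hM : 0 < M := lt_max_of_lt_right one_pos
  have huM : ∀ x, u x ≤ M := fun x => (le_abs_self _).trans ((hM₀ x).trans (le_max_left _ _))
  have hucases : ∀ x, u x = 0 ∨ u x ∈ Set.Ioc 0 M := fun x => by
    rcases (hnonneg x).eq_or_lt with h | h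
    exacts [Or.inl h.symm, Or.inr ⟨h, huM x⟩]
  obtain ⟨c, hc, C, hcC⟩ := exists_rpow_bounds hpos hmonoI hf1p hmono1 hp1.le hε hc₁ hlower hupper hM
  set l := (p₀ - 1) * (N - 2) / 4 / p₀ with hl
  have hlp : l * p₀ = (p₀ - 1) * (N - 2) / 4 := div_mul_cancel₀ _ hp0.ne'
  have hl0 : 0 < l := div_pos (by linarith) hp0
  obtain ⟨ψ, ψ', Ψ, hψ, hψ', hΨ, hψ0, hΨ0, k, hk, b, hb, B, hB, hbounds⟩ :=
    exists_test_pair hfd hf1d hpos hmonoI hf2 hl0 (by linarith) hc hM hδ0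
      (fun t ht => (hcC t ht).1) (fun t ht => (hcC t ht).2) htf hlr hδr
  set Q := (p₀ - 1) * N / 2 with hQdef
  have hQ1 : 2 * (l * p₀) + p₀ - 1 = Q := by rw [hlp]; ring
  have hQ2 : 2 * (l * p₀) = Q * (((N : ℝ) - 2) / N) := by
    rw [hlp, hQdef]
    field_simp
    ring
  have hQ : 2 ≤ Q := by linarith
  rw [hQ1, hQ2] at hbounds
  set d : EuclideanSpace ℝ (Fin N) → ℝ := fun x => derivWithin f (Set.Ici 0) (u x) with hd
  have hdc : Continuous d :=
    (hC2.continuousOn_derivWithin (uniqueDiffOn_Ici 0) (by norm_num)).comp_continuous hu.continuous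
      hnonneg
  have hdf : ∀ x, 0 < u x → d x = deriv f (u x) := fun x hx =>
    derivWithin_of_mem_nhds (Ici_mem_nhds hx)
  have hstabd : ∀ φ : EuclideanSpace ℝ (Fin N) → ℝ, ContDiff ℝ 1 φ → HasCompactSupport φ →
      tsupport φ ⊆ Kᶜ → (∀ x, u x = 0 → φ x = 0) →
      ∫ x, d x * φ x ^ 2 ≤ ∫ x, ‖gradient φ x‖ ^ 2 := fun φ hφ hφc hφK hφ0 => by
    refine le_of_eq_of_le (integral_congr_ae (Eventually.of_forall fun x => ?_))
      (hstabK φ hφ hφc hφK)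
    beta_reduce
    rcases hucases x with h | h
    · simp [hφ0 x h]
    · rw [hdf x h.1]
  have hint : Integrable fun x => u x ^ Q := by
    refine integrable_rpow_of_stable hN hK hu hnonneg hdc hψ hψ' hΨ hψ0 hk hb hB (by linarith)
      (fun x => ?_) (fun x => ?_) (fun x => ?_) (fun x => ?_) hstabd <;>
    rcases hucases x with h | h
    · simp [h, hψ0, hΨ0]
    · rw [hsol, hdf x h.1]
      exact (hbounds _ h).1
    · simp [h, hΨ0, Real.zero_rpow (by linarith : Q ≠ 0)]
    · rw [hsol]
      exact (hbounds _ h).2.1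
    · rw [h, hψ0, zero_pow two_ne_zero]
      positivity
    · exact (hbounds _ h).2.2.1
    · rw [h, hΨ0, zero_pow two_ne_zero]
      positivity
    · exact (hbounds _ h).2.2.2
  have hfu : ∀ x, 0 ≤ f (u x) := fun x => by
    rw [← hf0]
    exact hmono Set.self_mem_Ici (hnonneg x) (hnonneg x)
  have hp1' : r < 1 := hrs.trans_le (by
    have : 0 ≤ 1 / p₀ := by positivity
    linarith)
  have hle : ∀ x, u x * -lap u x ≤ (1 - r) * (d x * u x ^ 2) + M * f M / δ ^ Q * u x ^ Q :=
    fun x => by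
      have hfM := hpos M hM
      rw [hsol]
      rcases hucases x with h | h
      · rw [h, zero_mul, Real.zero_rpow (by linarith)]
        simp
      · rw [hdf x h.1]
        have hu0 := h.1
        have hf1u := hf1p _ hu0
        rcases lt_or_ge (u x) δ with hx | hx
        · have h1 := le_mul_deriv_of_le_mul_deriv_deriv hfd hf1d hf1p htf hδr ⟨hu0, hx⟩
          have h2 := mul_le_mul_of_nonneg_left h1 hu0.le
          have h3 : 0 ≤ M * f M / δ ^ Q * u x ^ Q := by positivity
          linarith
        · have h1 : u x * f (u x) ≤ M * f M :=
            mul_le_mul (huM x) (hmonoI hu0 hM (huM x)) (hfu x) hM.le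
          have h2 : M * f M ≤ M * f M / δ ^ Q * u x ^ Q := by
            calc M * f M = M * f M / δ ^ Q * δ ^ Q := by field_simp
              _ ≤ _ := by gcongr
          have h3 : 0 ≤ (1 - r) * (deriv f (u x) * u x ^ 2) :=
            mul_nonneg (by linarith) (by positivity)
          linarith
  have hA : 0 ≤ M * f M / δ ^ Q := by
    have := (hpos M hM).le
    positivity
  have hQt : (N : ℝ) - 2 * N / Q < 2 + 2 * τ := by
    have hP0 : 0 < p₀ - 1 := by linarith
    have : 2 * (N : ℝ) / Q = 4 / (p₀ - 1) := by
      rw [hQdef]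
      field_simp
      norm_num
    rw [this]
    linarith
  have hT := tendsto_energy_annulus hN hK hu hnonneg (fun x => by rw [hsol]; exact hfu x) hdc
    (by linarith : 0 ≤ 1 - r) hA hτ (by rwa [sub_sub_cancel]) hQ hQt hle hint
    fun η hη hηc hηK => hstabd _ ((hu.of_le (by norm_num)).mul hη) hηc.mul_left
      ((tsupport_mul_subset_right (f := u) (g := η)).trans hηK) fun x hx => by rw [hx, zero_mul]
  have hg : Continuous fun t => f (max t 0) :=
    hC2.continuousOn.comp_continuous (by fun_prop) fun t => le_max_right t 0
  have hgu : ∀ x, f (max (u x) 0) = f (u x) := fun x => by rw [max_eq_left (hnonneg x)]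
  have hG : ∀ s, 0 ≤ s → ∫ t in (0 : ℝ)..s, f (max t 0) = ∫ t in (0 : ℝ)..s, f t := fun s hs =>
    intervalIntegral.integral_congr fun t ht => by
      rw [Set.uIcc_of_le hs] at ht
      simp only [max_eq_left ht.1]
  intro x
  have key := mul_source_eq_zero_of_tendsto hN hu hnonneg
    (F := fun s => ∫ t in (0 : ℝ)..s, f (max t 0))
    (fun t => (hg.integral_hasStrictDerivAt 0 t).hasDerivAt) hg
    (fun x => by rw [hgu, hsol]) (fun x => by rw [hgu]; exact hfu x)
    (fun x => intervalIntegral.integral_nonneg (hnonneg x) fun t _ =>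
      hf0.symm.le.trans (hmono Set.self_mem_Ici (le_max_right t 0) (le_max_right t 0)))
    hps (fun x => by rw [hgu, hG _ (hnonneg x)]; exact hglob _ (hnonneg x)) hT x
  rw [hgu] at key
  by_contra hne
  have hx : 0 < u x := lt_of_le_of_ne (hnonneg x) (Ne.symm hne)
  exact (mul_pos hx (hpos _ hx)).ne' key
end

section
/- Let f ∈ C²([0,∞)) be nondecreasing and convex with f > 0 on [0,∞) or at least on (0,∞), and assume q̲₀ := liminf_{u→0⁺} q(u) > N/2, where q(u) = f'(u)²/(f(u)f''(u)) (with q(u) = +∞ when f(u)f''(u) = 0). If u ∈ C²(ℝ^N) is nonnegative and satisfies the differential inequality −Δu ≥ f(u) in ℝ^N, then u ≡ 0. -/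
open MeasureTheory Filter Topology
open scoped ENNReal

/-- Second-order necessary condition at a local minimum on the line. -/
theorem IsLocalMin.second_hasDerivAt_nonneg {w w' : ℝ → ℝ} {a D : ℝ} (hmin : IsLocalMin w a)
    (hw : ∀ᶠ t in 𝓝 a, HasDerivAt w (w' t) t) (hw' : HasDerivAt w' D a) : 0 ≤ D := by
  by_contra! hD
  have hderiv : deriv w =ᶠ[𝓝 a] w' := hw.mono fun t ht => ht.deriv
  have hdd : deriv (deriv w) a = D := by rw [hderiv.deriv_eq, hw'.deriv]
  have hmax : IsLocalMax w a := isLocalMax_of_deriv_deriv_neg (by rwa [hdd])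
    hmin.deriv_eq_zero hw.self_of_nhds.continuousAt
  have hconst : w =ᶠ[𝓝 a] fun _ => w a := by
    filter_upwards [hmin, hmax] with t h1 h2 using le_antisymm h2 h1
  have hzero : deriv (deriv w) a = 0 := by
    rw [hconst.deriv.deriv_eq]; simp
  linarith

/-- Second derivative of a `C²` function along a line. -/
theorem ContDiff.hasDerivAt_line {E : Type*} [NormedAddCommGroup E] [NormedSpace ℝ E]
    {u : E → ℝ} (hu : ContDiff ℝ 2 u) (x e : E) :
    (∀ t : ℝ, HasDerivAt (fun t : ℝ => u (x + t • e)) (fderiv ℝ u (x + t • e) e) t) ∧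
    HasDerivAt (fun t : ℝ => fderiv ℝ u (x + t • e) e) (iteratedFDeriv ℝ 2 u x ![e, e]) 0 := by
  have hline : ∀ t : ℝ, HasDerivAt (fun t : ℝ => x + t • e) e t := fun t => by
    simpa using ((hasDerivAt_id t).smul_const e).const_add x
  refine ⟨fun t => ?_, ?_⟩
  · exact ((hu.differentiable (by norm_num)) _).hasFDerivAt.comp_hasDerivAt t (hline t)
  · have hd : Differentiable ℝ (fderiv ℝ u) :=
      (hu.fderiv_right (m := 1) (by norm_num)).differentiable (by norm_num)
    have h := (hd (x + (0 : ℝ) • e)).hasFDerivAt.comp_hasDerivAt (0 : ℝ) (hline 0)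
    have h2 := h.clm_apply (hasDerivAt_const (0 : ℝ) e)
    rw [iteratedFDeriv_two_apply]
    simpa using h2

/-- If `u - φ` has a local minimum at `x`, then the Laplacian of `u` at `x` dominates the sum of
the pure second derivatives of `φ`. -/
theorem sum_le_lap_of_isLocalMin {N : ℕ} {u φ : EuclideanSpace ℝ (Fin N) → ℝ}
    (hu : ContDiff ℝ 2 u) {x : EuclideanSpace ℝ (Fin N)}
    (hmin : IsLocalMin (fun z => u z - φ z) x) (φ' : Fin N → ℝ → ℝ) (D : Fin N → ℝ)
    (hφ : ∀ i, ∀ᶠ t in 𝓝 (0 : ℝ), HasDerivAt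
      (fun t : ℝ => φ (x + t • EuclideanSpace.single i (1 : ℝ))) (φ' i t) t)
    (hφ' : ∀ i, HasDerivAt (φ' i) (D i) 0) : ∑ i, D i ≤ lap u x := by
  refine Finset.sum_le_sum fun i _ => ?_
  set e : EuclideanSpace ℝ (Fin N) := EuclideanSpace.single i (1 : ℝ)
  obtain ⟨h1, h2⟩ := hu.hasDerivAt_line x e
  have hcont : ContinuousAt (fun t : ℝ => x + t • e) 0 := by fun_prop
  have hmin' : IsLocalMin (fun t : ℝ => u (x + t • e) - φ (x + t • e)) 0 := by
    have ht : Tendsto (fun t : ℝ => x + t • e) (𝓝 0) (𝓝 x) := by simpa [ContinuousAt] using hcont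
    have := ht.eventually hmin
    simpa [IsLocalMin, IsMinFilter] using this
  have := hmin'.second_hasDerivAt_nonneg
    (w' := fun t => fderiv ℝ u (x + t • e) e - φ' i t)
    ((hφ i).mono fun t ht => (h1 t).sub ht) (h2.sub (hφ' i))
  linarith

theorem norm_add_smul_single_sq {N : ℕ} (x : EuclideanSpace ℝ (Fin N)) (i : Fin N) (t : ℝ) :
    ‖x + t • EuclideanSpace.single i (1 : ℝ)‖ ^ 2 = ‖x‖ ^ 2 + 2 * x i * t + t ^ 2 := by
  rw [norm_add_sq_real, inner_smul_right, norm_smul, mul_pow]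
  simp [EuclideanSpace.inner_single_right]
  ring

theorem hasDerivAt_quadratic (r b t : ℝ) :
    HasDerivAt (fun t : ℝ => r + b * t + t ^ 2) (b + 2 * t) t := by
  have h := (((hasDerivAt_id t).const_mul b).const_add r).add (hasDerivAt_pow 2 t)
  exact h.congr_deriv (by simp)

/-- A `C²` function with `Δu ≤ 0` cannot touch from above a strictly subharmonic multiple of a
power of the norm. -/
theorem not_isLocalMin_sub_norm_rpow {N : ℕ} {u : EuclideanSpace ℝ (Fin N) → ℝ}
    (hu : ContDiff ℝ 2 u) {A s : ℝ} (hAs : 0 < A * (s * (N + 2 * s - 2)))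
    {x : EuclideanSpace ℝ (Fin N)} (hx : x ≠ 0) (hlap : lap u x ≤ 0) :
    ¬ IsLocalMin (fun z => u z - A * (‖z‖ ^ 2) ^ s) x := by
  intro hmin
  have hr : 0 < ‖x‖ ^ 2 := by positivity
  set r := ‖x‖ ^ 2 with hrdef
  have hQ : ∀ (i : Fin N) (t : ℝ), HasDerivAt (fun t : ℝ => r + 2 * x i * t + t ^ 2)
      (2 * x i + 2 * t) t := fun i t =>
    hasDerivAt_quadratic r (2 * x i) t
  have key := sum_le_lap_of_isLocalMin hu hmin
    (fun i t => A * ((2 * x i + 2 * t) * s * (r + 2 * x i * t + t ^ 2) ^ (s - 1)))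
    (fun i => A * (2 * s * r ^ (s - 1) + 4 * s * (s - 1) * r ^ (s - 2) * x i ^ 2)) ?_ ?_
  · have hsum : ∑ i, x i ^ 2 = r := by rw [hrdef, EuclideanSpace.real_norm_sq_eq]
    have hpow : r ^ (s - 2) * r = r ^ (s - 1) := by
      rw [← Real.rpow_add_one hr.ne']; ring_nf
    rw [← Finset.mul_sum, Finset.sum_add_distrib, ← Finset.mul_sum, ← Finset.mul_sum, hsum] at key
    simp only [Finset.sum_const, Finset.card_univ, Fintype.card_fin, nsmul_eq_mul] at key
    have hp : 0 < r ^ (s - 1) := by positivity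
    have : 0 < A * (s * (N + 2 * s - 2)) * (2 * r ^ (s - 1)) := by positivity
    rw [mul_assoc (4 * s * (s - 1)), hpow] at key
    nlinarith
  · intro i
    have hc : ContinuousAt (fun t : ℝ => r + 2 * x i * t + t ^ 2) 0 := (hQ i 0).continuousAt
    have hev : ∀ᶠ t in 𝓝 (0 : ℝ), 0 < r + 2 * x i * t + t ^ 2 :=
      hc.eventually (lt_mem_nhds (by simpa using hr))
    filter_upwards [hev] with t ht
    simp only [norm_add_smul_single_sq]
    exact ((hQ i t).rpow_const (Or.inl ht.ne')).const_mul A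
  · intro i
    have h1 : HasDerivAt (fun t : ℝ => 2 * x i + 2 * t) 2 0 := by
      simpa using ((hasDerivAt_id (0 : ℝ)).const_mul 2).const_add (2 * x i)
    have h2 := (hQ i 0).rpow_const (p := s - 1) (Or.inl (by simpa using hr.ne'))
    have h3 := ((h1.mul_const s).mul h2).const_mul A
    refine h3.congr_deriv ?_
    have : s - 1 - 1 = s - 2 := by ring
    rw [this]
    ring_nf

/-- Minimum principle on an annulus. -/
theorem le_sub_norm_rpow_of_le_on_spheres {N : ℕ} {u : EuclideanSpace ℝ (Fin N) → ℝ}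
    (hu : ContDiff ℝ 2 u) (hlap : ∀ x, lap u x ≤ 0)
    {A s : ℝ} (hAs : 0 < A * (s * (N + 2 * s - 2))) {ρ R c : ℝ} (hρ : 0 < ρ)
    (hin : ∀ z, ‖z‖ = ρ → c ≤ u z - A * (‖z‖ ^ 2) ^ s)
    (hout : ∀ z, ‖z‖ = R → c ≤ u z - A * (‖z‖ ^ 2) ^ s)
    {x : EuclideanSpace ℝ (Fin N)} (hx1 : ρ ≤ ‖x‖) (hx2 : ‖x‖ ≤ R) :
    c ≤ u x - A * (‖x‖ ^ 2) ^ s := by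
  set K : Set (EuclideanSpace ℝ (Fin N)) := {z | ρ ≤ ‖z‖ ∧ ‖z‖ ≤ R}
  have hK : IsCompact K := by
    refine (isCompact_closedBall (0 : EuclideanSpace ℝ (Fin N)) R).of_isClosed_subset ?_ ?_
    · exact (isClosed_le continuous_const continuous_norm).inter
        (isClosed_le continuous_norm continuous_const)
    · intro z hz; simpa using hz.2
  have hcont : ContinuousOn (fun z => u z - A * (‖z‖ ^ 2) ^ s) K := by
    refine hu.continuous.continuousOn.sub (continuousOn_const.mul ?_)
    refine ContinuousOn.rpow_const (by fun_prop) fun z hz => Or.inl ?_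
    have := hρ.trans_le hz.1
    positivity
  obtain ⟨z, hz, hzmin⟩ := hK.exists_isMinOn ⟨x, hx1, hx2⟩ hcont
  refine le_trans ?_ (hzmin ⟨hx1, hx2⟩)
  rcases hz.1.eq_or_lt with h | h
  · exact hin z h.symm
  rcases hz.2.eq_or_lt with h' | h'
  · exact hout z h'
  have hz0 : z ≠ 0 := norm_pos_iff.1 (hρ.trans h)
  have hnhds : K ∈ 𝓝 z := by
    filter_upwards [continuous_norm.continuousAt.eventually (lt_mem_nhds h),
      continuous_norm.continuousAt.eventually (gt_mem_nhds h')] with y h1 h2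
    exact ⟨h1.le, h2.le⟩
  exact absurd (hzmin.isLocalMin hnhds) (not_isLocalMin_sub_norm_rpow hu hAs hz0 (hlap z))

/-- Lower bound for nonnegative superharmonic functions outside a ball. -/
theorem mul_rpow_le_of_lap_nonpos {N : ℕ} {u : EuclideanSpace ℝ (Fin N) → ℝ}
    (hu : ContDiff ℝ 2 u) (hnonneg : ∀ x, 0 ≤ u x) (hlap : ∀ x, lap u x ≤ 0)
    {β a ρ : ℝ} (hβ : 0 < β) (hβN : (N : ℝ) - 2 < β) (ha : 0 < a) (hρ : 0 < ρ)
    (hin : ∀ z, ‖z‖ = ρ → a ≤ u z) {x : EuclideanSpace ℝ (Fin N)} (hx : ρ ≤ ‖x‖) :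
    a * (ρ / ‖x‖) ^ β ≤ u x := by
  have hpow : ∀ r : ℝ, 0 < r → a * ρ ^ β * (r ^ 2) ^ (-β / 2) = a * (ρ / r) ^ β := by
    intro r hr
    rw [Real.div_rpow hρ.le hr.le, ← Real.rpow_natCast, ← Real.rpow_mul hr.le]
    rw [show ((2 : ℕ) : ℝ) * (-β / 2) = -β by push_cast; ring, Real.rpow_neg hr.le]
    ring
  have hxpos : 0 < ‖x‖ := hρ.trans_le hx
  refine le_of_forall_pos_le_add fun ε hε => ?_
  have hlim : Tendsto (fun R : ℝ => a * (ρ / R) ^ β) atTop (𝓝 0) := by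
    have h1 : Tendsto (fun R : ℝ => ρ / R) atTop (𝓝 0) := tendsto_const_nhds.div_atTop tendsto_id
    have h2 := (h1.rpow_const (p := β) (Or.inr hβ.le)).const_mul a
    simpa [Real.zero_rpow hβ.ne'] using h2
  obtain ⟨R, hR1, hR2⟩ :=
    ((hlim.eventually (gt_mem_nhds hε)).and (eventually_ge_atTop ‖x‖)).exists
  have hRpos : 0 < R := hxpos.trans_le hR2
  have := le_sub_norm_rpow_of_le_on_spheres (A := a * ρ ^ β) (s := -β / 2) (c := -ε) hu hlap
    (by
      have : 0 < a * ρ ^ β := by positivity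
      refine mul_pos this ?_
      nlinarith) hρ
    (fun z hz => by
      rw [hz, hpow ρ hρ, div_self hρ.ne', Real.one_rpow]
      linarith [hin z hz])
    (fun z hz => by
      rw [hz, hpow R hRpos]
      linarith [hnonneg z]) hx hR2
  rw [hpow _ hxpos] at this
  linarith

/-- In dimension one a nonnegative superharmonic function does not go below its minimum on an
interval. -/
theorem le_of_lap_nonpos_dim_one {u : EuclideanSpace ℝ (Fin 1) → ℝ}
    (hu : ContDiff ℝ 2 u) (hnonneg : ∀ x, 0 ≤ u x) (hlap : ∀ x, lap u x ≤ 0)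
    {a ρ : ℝ} (hρ : 0 < ρ)
    (hin : ∀ z, ‖z‖ = ρ → a ≤ u z) {x : EuclideanSpace ℝ (Fin 1)} (hx : ρ ≤ ‖x‖) :
    a ≤ u x := by
  have hxpos : 0 < ‖x‖ := hρ.trans_le hx
  have key : ∀ ε : ℝ, 0 < ε → a ≤ u x + ε * (‖x‖ ^ 2) ^ (1 / 4 : ℝ) := by
    intro ε hε
    have hlim : Tendsto (fun R : ℝ => ε * (R ^ 2) ^ (1 / 4 : ℝ)) atTop atTop :=
      ((tendsto_rpow_atTop (by norm_num)).comp (tendsto_pow_atTop (by norm_num))).const_mul_atTop hε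
    obtain ⟨R, hR1, hR2⟩ :=
      ((hlim.eventually (eventually_ge_atTop a)).and (eventually_ge_atTop ‖x‖)).exists
    have := le_sub_norm_rpow_of_le_on_spheres (A := -ε) (s := 1 / 4) (c := a) hu hlap
      (by norm_num; linarith) hρ
      (fun z hz => by
        have : 0 ≤ ε * (‖z‖ ^ 2) ^ (1 / 4 : ℝ) := by positivity
        linarith [hin z hz])
      (fun z hz => by
        rw [hz]
        linarith [hnonneg z]) hx hR2
    linarith
  have hc : 0 < (‖x‖ ^ 2) ^ (1 / 4 : ℝ) := by positivity
  refine le_of_forall_pos_le_add fun ε hε => ?_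
  have := key (ε / (‖x‖ ^ 2) ^ (1 / 4 : ℝ)) (by positivity)
  rwa [div_mul_cancel₀ _ hc.ne'] at this

/-- Around any point there is a nearby point where `-Δu` is controlled by the value of `u`. -/
theorem exists_neg_lap_le {N : ℕ} {u : EuclideanSpace ℝ (Fin N) → ℝ}
    (hu : ContDiff ℝ 2 u) (hnonneg : ∀ x, 0 ≤ u x) (y : EuclideanSpace ℝ (Fin N))
    {R : ℝ} (hR : 0 < R) :
    ∃ x, ‖x - y‖ ≤ R ∧ -lap u x ≤ 2 * N * u y / R ^ 2 := by
  set k := u y / R ^ 2 with hk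
  have hkR : k * R ^ 2 = u y := by rw [hk]; field_simp
  set v : EuclideanSpace ℝ (Fin N) → ℝ := fun z => u z - (-k) * ‖z - y‖ ^ 2 with hv
  have hcont : Continuous v := by
    have := hu.continuous
    fun_prop
  have hy : y ∈ Metric.closedBall y R := by simp [hR.le]
  obtain ⟨z, hz, hzmin⟩ :=
    (isCompact_closedBall y R).exists_isMinOn ⟨y, hy⟩ hcont.continuousOn
  have hloc : ∃ x, ‖x - y‖ < R ∧ IsMinOn v (Metric.closedBall y R) x := by
    rcases (mem_closedBall_iff_norm.1 hz).eq_or_lt with h | h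
    · refine ⟨y, by simpa using hR, fun w hw => ?_⟩
      refine le_trans (b := v z) ?_ (hzmin hw)
      simp only [hv, h, sub_self, norm_zero]
      nlinarith [hnonneg z]
    · exact ⟨z, h, hzmin⟩
  obtain ⟨x, hx, hxmin⟩ := hloc
  have hmin : IsLocalMin v x :=
    hxmin.isLocalMin (Metric.closedBall_mem_nhds_of_mem (by simpa [dist_eq_norm] using hx))
  refine ⟨x, hx.le, ?_⟩
  have key := sum_le_lap_of_isLocalMin hu hmin
    (fun i t => (-k) * (2 * (x - y) i + 2 * t)) (fun _ => (-k) * 2) ?_ ?_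
  · simp only [Finset.sum_const, Finset.card_univ, Fintype.card_fin, nsmul_eq_mul] at key
    have : 2 * N * u y / R ^ 2 = 2 * N * k := by rw [hk]; ring
    rw [this]; linarith
  · intro i
    refine Eventually.of_forall fun t => ?_
    simp only [add_sub_right_comm, norm_add_smul_single_sq]
    exact (hasDerivAt_quadratic _ _ t).const_mul (-k)
  · intro i
    refine HasDerivAt.const_mul (-k) ?_
    simpa using ((hasDerivAt_id (0 : ℝ)).const_mul 2).const_add (2 * (x - y) i)

/-- If `q f f'' ≤ f'²` near `0⁺`, then `f ^ (1 - 1/q)` grows at least linearly near `0⁺`. -/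
theorem exists_mul_le_rpow_of_mul_deriv_le {f : ℝ → ℝ} (hC2 : ContDiffOn ℝ 2 f (Set.Ici 0))
    (hpos : ∀ t : ℝ, 0 < t → 0 < f t) {q δ : ℝ} (hq : 1 < q) (hδ : 0 < δ)
    (hineq : ∀ t ∈ Set.Ioo 0 δ, q * (f t * deriv (deriv f) t) ≤ deriv f t ^ 2) :
    ∃ c > 0, ∃ d > 0, ∀ t, 0 < t → t < d → c * t ≤ f t ^ (1 - 1 / q) := by
  have hq0 : 0 < q := by linarith
  have hθ : 0 < 1 - 1 / q := by
    rw [sub_pos, div_lt_one hq0]; exact hq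
  have hI : ContDiffOn ℝ 2 f (Set.Ioi 0) := hC2.mono Set.Ioi_subset_Ici_self
  have hf : ∀ t, 0 < t → HasDerivAt f (deriv f t) t := fun t ht =>
    ((hI.differentiableOn (by norm_num)).differentiableAt (Ioi_mem_nhds ht)).hasDerivAt
  have hf' : ∀ t, 0 < t → HasDerivAt (deriv f) (deriv (deriv f) t) t := fun t ht =>
    (((hI.deriv_of_isOpen (m := 1) isOpen_Ioi (by norm_num)).differentiableOn
      (by norm_num)).differentiableAt (Ioi_mem_nhds ht)).hasDerivAt
  have hg : ∀ t, 0 < t → HasDerivAt (fun t => f t ^ (1 - 1 / q))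
      (deriv f t * (1 - 1 / q) * f t ^ (-(1 / q))) t := fun t ht => by
    have := (hf t ht).rpow_const (p := 1 - 1 / q) (Or.inl (hpos t ht).ne')
    rwa [show (1 - 1 / q - 1 : ℝ) = -(1 / q) by ring] at this
  have hg' : ∀ t, 0 < t → HasDerivAt (fun t => deriv f t * (1 - 1 / q) * f t ^ (-(1 / q)))
      (deriv (deriv f) t * (1 - 1 / q) * f t ^ (-(1 / q)) + deriv f t * (1 - 1 / q) *
        (deriv f t * (-(1 / q)) * f t ^ (-(1 / q) - 1))) t := fun t ht =>
    ((hf' t ht).mul_const _).mul ((hf t ht).rpow_const (Or.inl (hpos t ht).ne'))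
  have hanti : AntitoneOn (fun t => deriv f t * (1 - 1 / q) * f t ^ (-(1 / q))) (Set.Ioo 0 δ) := by
    refine antitoneOn_of_hasDerivWithinAt_nonpos (convex_Ioo 0 δ)
      (fun t ht => (hg' t ht.1).continuousAt.continuousWithinAt)
      (fun t ht => (hg' t (interior_subset ht).1).hasDerivWithinAt) fun t ht => ?_
    have ht' := interior_subset ht
    have hft := hpos t ht'.1
    have h1 : f t ^ (-(1 / q)) = f t * f t ^ (-(1 / q) - 1) := by
      rw [mul_comm, ← Real.rpow_add_one hft.ne']; ring_nf
    have h2 : 0 < f t ^ (-(1 / q) - 1) := by positivity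
    have h3 := hineq t ht'
    rw [h1]
    have h4 : f t * deriv (deriv f) t - deriv f t ^ 2 / q ≤ 0 := by
      rw [sub_nonpos, le_div_iff₀ hq0]; linarith
    calc _ = (1 - 1 / q) * f t ^ (-(1 / q) - 1) *
          (f t * deriv (deriv f) t - deriv f t ^ 2 / q) := by ring
      _ ≤ 0 := mul_nonpos_of_nonneg_of_nonpos (by positivity) h4
  have hconc : ConcaveOn ℝ (Set.Ioo 0 δ) (fun t => f t ^ (1 - 1 / q)) := by
    refine AntitoneOn.concaveOn_of_deriv (convex_Ioo 0 δ)
      (fun t ht => (hg t ht.1).continuousAt.continuousWithinAt)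
      (fun t ht => (hg t (interior_subset ht).1).differentiableAt.differentiableWithinAt) ?_
    rw [interior_Ioo]
    exact hanti.congr fun t ht => (hg t ht.1).deriv.symm
  have hG : 0 < f (δ / 2) ^ (1 - 1 / q) := Real.rpow_pos_of_pos (hpos _ (by linarith)) _
  refine ⟨f (δ / 2) ^ (1 - 1 / q) / δ, by positivity, δ / 2, by linarith, fun t ht htd => ?_⟩
  have hden : 0 < δ - t := by linarith
  have hb : 0 ≤ t / (δ - t) := by positivity
  have ha : 0 ≤ (δ - 2 * t) / (δ - t) := div_nonneg (by linarith) hden.le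
  have := hconc.2 (x := t / 2) (y := δ / 2) ⟨by linarith, by linarith⟩ ⟨by linarith, by linarith⟩
    ha hb (by field_simp; ring)
  simp only [smul_eq_mul] at this
  have hcomb : (δ - 2 * t) / (δ - t) * (t / 2) + t / (δ - t) * (δ / 2) = t := by
    field_simp; ring
  rw [hcomb] at this
  have hnn : 0 ≤ f (t / 2) ^ (1 - 1 / q) := (Real.rpow_pos_of_pos (hpos _ (by linarith)) _).le
  have hle : t / δ ≤ t / (δ - t) := by
    gcongr; linarith
  calc f (δ / 2) ^ (1 - 1 / q) / δ * t = t / δ * f (δ / 2) ^ (1 - 1 / q) := by ring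
    _ ≤ t / (δ - t) * f (δ / 2) ^ (1 - 1 / q) := by gcongr
    _ ≤ _ := by nlinarith [mul_nonneg ha hnn]

/-- A lower bound on `liminf q` at `0⁺` as a differential inequality for `f`. -/
theorem exists_mul_deriv_le_of_lt_liminf_qfun {f : ℝ → ℝ} {n : ℝ≥0∞}
    (hq : n < liminf (qfun f) (𝓝[>] (0 : ℝ))) :
    ∃ q : ℝ, n < ENNReal.ofReal q ∧ 0 ≤ q ∧ ∃ δ > 0, ∀ t ∈ Set.Ioo 0 δ,
      q * (f t * deriv (deriv f) t) ≤ deriv f t ^ 2 := by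
  obtain ⟨q, hq1, hq2⟩ := ENNReal.lt_iff_exists_nnreal_btwn.1 hq
  have hev := eventually_lt_of_lt_liminf hq2
  obtain ⟨δ, hδ, hsub⟩ := mem_nhdsGT_iff_exists_Ioo_subset.1 hev
  refine ⟨q, by simpa using hq1, q.2, δ, hδ, fun t ht => ?_⟩
  have h := hsub ht
  simp only [Set.mem_ofPred_eq, qfun] at h
  split_ifs at h with h0
  · rw [h0]; simpa using sq_nonneg _
  · rw [ENNReal.lt_ofReal_iff_toReal_lt (by simp)] at h
    simp only [ENNReal.coe_toReal] at h
    rcases lt_or_gt_of_ne h0 with hn | hp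
    · exact (mul_nonpos_of_nonneg_of_nonpos q.2 hn.le).trans (sq_nonneg _)
    · exact ((lt_div_iff₀ hp).1 h).le

theorem lap_comp_add_right {N : ℕ} (u : EuclideanSpace ℝ (Fin N) → ℝ)
    (a x : EuclideanSpace ℝ (Fin N)) : lap (fun z => u (z + a)) x = lap u (x + a) := by
  simp only [lap, iteratedFDeriv_comp_add_right]

/-- Comparison at scale `R`: if `m` is the minimum of `u` on the ball of radius `R`, then
`f (2⁻ᵝ m) ≤ 2 N m / R²`, while `m` decays at most like `R⁻ᵝ`. -/
theorem exists_min_le_of_scale {N : ℕ} {f : ℝ → ℝ} (hmono : MonotoneOn f (Set.Ici 0))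
    {u : EuclideanSpace ℝ (Fin N) → ℝ} (hu : ContDiff ℝ 2 u) (hnonneg : ∀ x, 0 ≤ u x)
    (hlap : ∀ x, lap u x ≤ 0) (hineq : ∀ x, f (u x) ≤ -lap u x)
    {β a ρ R : ℝ} (hβ : 0 < β) (hβN : (N : ℝ) - 2 < β) (ha : 0 < a) (hρ : 0 < ρ)
    (hin : ∀ z, ‖z‖ ≤ ρ → a ≤ u z) (hR : ρ ≤ R) :
    ∃ m, a * (ρ / R) ^ β ≤ m ∧ m ≤ u 0 ∧ f ((1 / 2) ^ β * m) ≤ 2 * N * m / R ^ 2 := by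
  have hRpos : 0 < R := hρ.trans_le hR
  obtain ⟨y, hy, hymin⟩ := (isCompact_closedBall (0 : EuclideanSpace ℝ (Fin N)) R).exists_isMinOn
    ⟨0, by simp [hRpos.le]⟩ hu.continuous.continuousOn
  have hyR : ‖y‖ ≤ R := by simpa using hy
  have hmin : ∀ z, ‖z‖ ≤ R → u y ≤ u z := fun z hz => hymin (by simpa using hz)
  have hlow : a * (ρ / R) ^ β ≤ u y := by
    rcases le_total ‖y‖ ρ with h | h
    · refine le_trans ?_ (hin y h)
      have : (ρ / R) ^ β ≤ 1 :=
        Real.rpow_le_one (by positivity) ((div_le_one hRpos).2 hR) hβ.le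
      nlinarith
    · refine le_trans ?_ (mul_rpow_le_of_lap_nonpos hu hnonneg hlap hβ hβN ha hρ
        (fun z hz => hin z hz.le) h)
      have := hρ.trans_le h
      gcongr
  have hmpos : 0 < u y := lt_of_lt_of_le (by positivity) hlow
  refine ⟨u y, hlow, hmin 0 (by simpa using hRpos.le), ?_⟩
  obtain ⟨x, hx, hxle⟩ := exists_neg_lap_le hu hnonneg y hRpos
  refine le_trans (hmono ?_ (hnonneg x) ?_) ((hineq x).trans hxle)
  · exact Set.mem_Ici.2 (by positivity)
  · rcases le_total ‖x‖ R with h | h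
    · refine le_trans ?_ (hmin x h)
      have : (1 / 2 : ℝ) ^ β ≤ 1 := Real.rpow_le_one (by norm_num) (by norm_num) hβ.le
      nlinarith
    · have h2 : ‖x‖ ≤ 2 * R := by
        have := norm_add_le (x - y) y
        rw [sub_add_cancel] at this
        linarith
      have hxpos := hRpos.trans_le h
      refine le_trans ?_ (mul_rpow_le_of_lap_nonpos hu hnonneg hlap hβ hβN hmpos hRpos
        (fun z hz => hmin z hz.le) h)
      rw [mul_comm]
      gcongr _ * ?_ ^ _
      rw [div_le_div_iff₀ (by norm_num) hxpos]
      linarith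

/-- On the line, `-u'' ≥ f(u)` has no nonnegative solution that is positive near the origin. -/
theorem false_of_le_neg_lap_dim_one {f : ℝ → ℝ} (hmono : MonotoneOn f (Set.Ici 0))
    (hpos : ∀ t : ℝ, 0 < t → 0 < f t)
    {u : EuclideanSpace ℝ (Fin 1) → ℝ} (hu : ContDiff ℝ 2 u) (hnonneg : ∀ x, 0 ≤ u x)
    (hlap : ∀ x, lap u x ≤ 0) (hineq : ∀ x, f (u x) ≤ -lap u x)
    {a ρ : ℝ} (ha : 0 < a) (hρ : 0 < ρ) (hin : ∀ z, ‖z‖ ≤ ρ → a ≤ u z) : False := by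
  have hall : ∀ x, a ≤ u x := fun x => by
    rcases le_total ‖x‖ ρ with h | h
    · exact hin x h
    · exact le_of_lap_nonpos_dim_one hu hnonneg hlap hρ (fun z hz => hin z hz.le) h
  have hlim : Tendsto (fun R : ℝ => 2 * ((1 : ℕ) : ℝ) * u 0 / R ^ 2) atTop (𝓝 0) :=
    tendsto_const_nhds.div_atTop (tendsto_pow_atTop (by norm_num))
  obtain ⟨R, hR1, hR2⟩ :=
    ((hlim.eventually (gt_mem_nhds (hpos a ha))).and (eventually_gt_atTop 0)).exists
  obtain ⟨x, -, hx⟩ := exists_neg_lap_le hu hnonneg 0 hR2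
  have := hmono ha.le (hnonneg x) (hall x)
  linarith [hineq x]

/-- If `f ^ (1 - 1 / q)` grows at least linearly near `0⁺` for some `q > max 1 (N / 2)`, then
`-Δu ≥ f(u)` has no nonnegative solution that is positive near the origin. -/
theorem false_of_le_neg_lap_of_subcritical {N : ℕ} {f : ℝ → ℝ} (hmono : MonotoneOn f (Set.Ici 0))
    (hpos : ∀ t : ℝ, 0 < t → 0 < f t)
    {u : EuclideanSpace ℝ (Fin N) → ℝ} (hu : ContDiff ℝ 2 u) (hnonneg : ∀ x, 0 ≤ u x)
    (hlap : ∀ x, lap u x ≤ 0) (hineq : ∀ x, f (u x) ≤ -lap u x)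
    {a ρ : ℝ} (ha : 0 < a) (hρ : 0 < ρ) (hin : ∀ z, ‖z‖ ≤ ρ → a ≤ u z)
    {q c d : ℝ} (hq : 1 < q) (hqN : (N : ℝ) / 2 < q) (hc : 0 < c) (hd : 0 < d)
    (hf : ∀ t, 0 < t → t < d → c * t ≤ f t ^ (1 - 1 / q)) : False := by
  have hq0 : 0 < q := by linarith
  obtain ⟨β, hβ1, hβ2⟩ : ∃ β, max 0 ((N : ℝ) - 2) < β ∧ β < 2 * q - 2 :=
    exists_between (max_lt (by linarith) (by linarith))
  obtain ⟨hβ, hβN⟩ := max_lt_iff.1 hβ1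
  set θ := 1 - 1 / q with hθdef
  have hθ : 0 < θ := by
    rw [hθdef, sub_pos, div_lt_one hq0]; exact hq
  have hexp : 0 < 2 * θ - β * (1 / q) := by
    have : 2 * θ - β * (1 / q) = (2 * q - 2 - β) / q := by rw [hθdef]; field_simp
    rw [this]; exact div_pos (by linarith) hq0
  set κ := c * (1 / 2) ^ β * (a * ρ ^ β) ^ (1 / q) with hκ
  have hκpos : 0 < κ := by positivity
  have hlim1 : Tendsto (fun R : ℝ => 2 * N * u 0 / R ^ 2) atTop (𝓝 0) :=
    tendsto_const_nhds.div_atTop (tendsto_pow_atTop (by norm_num))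
  have hlim2 : Tendsto (fun R : ℝ => κ * R ^ (2 * θ - β * (1 / q))) atTop atTop :=
    (tendsto_rpow_atTop hexp).const_mul_atTop hκpos
  obtain ⟨R, ⟨hR1, hR2⟩, hR3⟩ := ((hlim1.eventually (gt_mem_nhds (hpos d hd))).and
    (hlim2.eventually (eventually_gt_atTop ((2 * N : ℝ) ^ θ)))).and
      (eventually_ge_atTop ρ) |>.exists
  have hRpos : 0 < R := hρ.trans_le hR3
  obtain ⟨m, hm1, hm2, hm3⟩ :=
    exists_min_le_of_scale hmono hu hnonneg hlap hineq hβ hβN ha hρ hin hR3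
  have hm : 0 < m := lt_of_lt_of_le (by positivity) hm1
  have hs : 0 < (1 / 2 : ℝ) ^ β * m := by positivity
  have hsd : (1 / 2 : ℝ) ^ β * m < d := by
    by_contra! h
    have h1 := hmono hd.le hs.le h
    have h2 : 2 * N * m / R ^ 2 ≤ 2 * N * u 0 / R ^ 2 := by gcongr
    linarith
  have h1 : c * ((1 / 2) ^ β * m) ≤ (2 * N * m / R ^ 2) ^ θ :=
    (hf _ hs hsd).trans (Real.rpow_le_rpow (hpos _ hs).le hm3 hθ.le)
  have hRθ : (R ^ 2) ^ θ = R ^ (2 * θ) := by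
    rw [← Real.rpow_natCast, ← Real.rpow_mul hRpos.le]; norm_num
  have hmsplit : m = m ^ (1 / q) * m ^ θ := by
    rw [← Real.rpow_add hm, hθdef, add_sub_cancel, Real.rpow_one]
  rw [Real.div_rpow (x := 2 * N * m) (by positivity) (by positivity),
    Real.mul_rpow (x := 2 * N) (by positivity) hm.le, hRθ, le_div_iff₀ (by positivity)] at h1
  have h2 : c * (1 / 2) ^ β * m ^ (1 / q) * R ^ (2 * θ) ≤ (2 * N : ℝ) ^ θ := by
    have hmθ : 0 < m ^ θ := by positivity
    refine le_of_mul_le_mul_right ?_ hmθ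
    calc _ = c * ((1 / 2) ^ β * (m ^ (1 / q) * m ^ θ)) * R ^ (2 * θ) := by ring
      _ ≤ _ := by rwa [← hmsplit]
  have h3 : (a * ρ ^ β) ^ (1 / q) * R ^ (-(β * (1 / q))) ≤ m ^ (1 / q) := by
    refine le_trans (le_of_eq ?_) (Real.rpow_le_rpow (by positivity) hm1 (by positivity))
    rw [Real.div_rpow hρ.le hRpos.le, ← mul_div_assoc a, Real.div_rpow (by positivity) (by positivity),
      ← Real.rpow_mul hRpos.le, Real.rpow_neg hRpos.le]
    exact (div_eq_mul_inv _ _).symm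
  have h4 : κ * R ^ (2 * θ - β * (1 / q)) ≤ (2 * N : ℝ) ^ θ := by
    refine le_trans ?_ h2
    rw [sub_eq_add_neg, Real.rpow_add hRpos, hκ]
    calc _ = c * (1 / 2) ^ β * ((a * ρ ^ β) ^ (1 / q) * R ^ (-(β * (1 / q)))) * R ^ (2 * θ) := by
          ring
      _ ≤ _ := by gcongr
  linarith

/-- Lemma 3.1: if `f ∈ C²([0,∞))` is nondecreasing convex, `f > 0` on `(0,∞)`, and
`liminf_{u→0⁺} q(u) > N/2`, then every nonnegative `C²` solution of `−Δu ≥ f(u)`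
in `ℝ^N` vanishes identically. -/
theorem stmt15 {N : ℕ} (hN : 1 ≤ N) (f : ℝ → ℝ)
    (hC2 : ContDiffOn ℝ 2 f (Set.Ici 0))
    (hconv : ConvexOn ℝ (Set.Ici 0) f) (hmono : MonotoneOn f (Set.Ici 0))
    (hpos : ∀ t : ℝ, 0 < t → 0 < f t)
    (hq : (N : ℝ≥0∞) / 2 < Filter.liminf (qfun f) (𝓝[>] (0:ℝ)))
    (u : EuclideanSpace ℝ (Fin N) → ℝ) (hu : ContDiff ℝ 2 u)
    (hnonneg : ∀ x, 0 ≤ u x)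
    (hineq : ∀ x, f (u x) ≤ -lap u x) :
    ∀ x, u x = 0 := by
  by_contra! hne
  obtain ⟨x₀, hx₀⟩ := hne
  have hf0 : 0 ≤ f 0 := by
    have hc : Tendsto f (𝓝[>] 0) (𝓝 (f 0)) :=
      (hC2.continuousOn 0 Set.self_mem_Ici).mono_left (nhdsWithin_mono _ Set.Ioi_subset_Ici_self)
    exact ge_of_tendsto hc (eventually_mem_nhdsWithin.mono fun t ht => (hpos t ht).le)
  have hlap : ∀ x, lap u x ≤ 0 := fun x => by
    have : 0 ≤ f (u x) := hf0.trans (hmono Set.self_mem_Ici (hnonneg x) (hnonneg x))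
    linarith [hineq x]
  set v : EuclideanSpace ℝ (Fin N) → ℝ := fun z => u (z + x₀) with hv
  have hvC : ContDiff ℝ 2 v := hu.comp (contDiff_id.add contDiff_const)
  have hvlap : ∀ x, lap v x = lap u (x + x₀) := lap_comp_add_right u x₀
  have hv0 : 0 < v 0 := by simpa [hv] using (hnonneg x₀).lt_of_ne' hx₀
  obtain ⟨ρ, hρ, hin⟩ : ∃ ρ > 0, ∀ z, ‖z‖ ≤ ρ → v 0 / 2 ≤ v z := by
    obtain ⟨ρ, hρ, h⟩ := Metric.nhds_basis_closedBall.mem_iff.1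
      (hvC.continuous.continuousAt.eventually (lt_mem_nhds (half_lt_self hv0)))
    exact ⟨ρ, hρ, fun z hz => (h (by simpa using hz)).le⟩
  have hvn : ∀ x, 0 ≤ v x := fun x => hnonneg _
  have hvl : ∀ x, lap v x ≤ 0 := fun x => by rw [hvlap]; exact hlap _
  have hvi : ∀ x, f (v x) ≤ -lap v x := fun x => by rw [hvlap]; exact hineq _
  obtain rfl | hN2 := hN.eq_or_lt
  · exact false_of_le_neg_lap_dim_one hmono hpos hvC hvn hvl hvi (half_pos hv0) hρ hin
  obtain ⟨q, hqN, hq0, δ, hδ, hqf⟩ := exists_mul_deriv_le_of_lt_liminf_qfun hq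
  have hqN' : (N : ℝ) / 2 < q := by
    rw [ENNReal.lt_ofReal_iff_toReal_lt (ENNReal.div_lt_top (by simp) (by simp)).ne] at hqN
    simpa using hqN
  have hq1 : 1 < q := by
    have : (2 : ℝ) ≤ N := by exact_mod_cast hN2
    linarith
  obtain ⟨c, hc, d, hd, hfl⟩ := exists_mul_le_rpow_of_mul_deriv_le hC2 hpos hq1 hδ hqf
  exact false_of_le_neg_lap_of_subcritical hmono hpos hvC hvn hvl hvi (half_pos hv0) hρ hin hq1 hqN' hc hd hfl
end
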